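/- Let H be a non-semisimple Hopf algebra of dimension 4p over an algebraically closed field k of characteristic zero, p an odd prime, with antipode S. Then 4 does not divide the order of the group G(H) of group-like elements of H, and S^8 = id_H. -/

import Mathlib

open scoped TensorProduct

/-- An element of a coalgebra (with comultiplication `Δ`) is group-like if it is
nonzero and `Δ a = a ⊗ a`. -/
def IsGroupLikeOf {k H : Type} [CommRing k] [AddCommGroup H] [Module k H]
    (Δ : H →ₗ[k] H ⊗[k] H) (a : H) : Prop :=
  a ≠ 0 ∧ Δ a = a ⊗ₜ[k] a

/-- A `k`-subspace `C` of a coalgebra with comultiplication `Δ` is a subcoalgebra if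
`Δ C ⊆ C ⊗ C`. -/
def IsSubcoalgebraOf {k H : Type} [CommRing k] [AddCommGroup H] [Module k H]
    (Δ : H →ₗ[k] H ⊗[k] H) (C : Submodule k H) : Prop :=
  ∀ c ∈ C, Δ c ∈ LinearMap.range (TensorProduct.map C.subtype C.subtype)

/-- A subcoalgebra is simple if it is nonzero and has no proper nonzero subcoalgebras. -/
def IsSimpleSubcoalgebraOf {k H : Type} [CommRing k] [AddCommGroup H] [Module k H]
    (Δ : H →ₗ[k] H ⊗[k] H) (C : Submodule k H) : Prop :=
  IsSubcoalgebraOf Δ C ∧ C ≠ ⊥ ∧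
    ∀ D : Submodule k H, IsSubcoalgebraOf Δ D → D ≤ C → D = ⊥ ∨ D = C

/-- A coalgebra is pointed if every simple subcoalgebra is one-dimensional. -/
def IsPointedOf {k H : Type} [CommRing k] [AddCommGroup H] [Module k H]
    (Δ : H →ₗ[k] H ⊗[k] H) : Prop :=
  ∀ C : Submodule k H, IsSimpleSubcoalgebraOf Δ C → Module.finrank k C = 1

namespace HopfFourP

set_option linter.unusedSectionVars false

open Coalgebra HopfAlgebra WithConv TensorProduct

section Convolution

variable {k H B : Type*} [Field k] [Ring H] [HopfAlgebra k H] [Ring B] [Algebra k B]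

theorem conv_algHom_comp_antipode (φ : H →ₐ[k] B) :
    toConv φ.toLinearMap * toConv (φ.toLinearMap ∘ₗ antipode k) = 1 := by
  have h := LinearMap.algHom_comp_convMul_distrib φ (toConv LinearMap.id) (toConv (antipode k))
  rw [LinearMap.id_mul_antipode] at h
  apply ofConv_injective
  simp only [LinearMap.comp_id] at h
  rw [← h]
  ext x
  simp [LinearMap.convOne_def]

theorem conv_antipode_comp_algHom (φ : H →ₐ[k] B) :
    toConv (φ.toLinearMap ∘ₗ antipode k) * toConv φ.toLinearMap = 1 := by
  have h := LinearMap.algHom_comp_convMul_distrib φ (toConv (antipode k)) (toConv LinearMap.id)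
  rw [LinearMap.antipode_mul_id] at h
  apply ofConv_injective
  simp only [LinearMap.comp_id] at h
  rw [← h]
  ext x
  simp [LinearMap.convOne_def]

variable (k H) in
/-- The inclusion of `H` in the left factor of `H ⊗ H`. -/
noncomputable abbrev inl : H →ₐ[k] H ⊗[k] H := Algebra.TensorProduct.includeLeft

variable (k H) in
/-- The inclusion of `H` in the right factor of `H ⊗ H`. -/
noncomputable abbrev inr : H →ₐ[k] H ⊗[k] H := Algebra.TensorProduct.includeRight

variable (k H) in
/-- The comultiplication as an algebra homomorphism. -/
noncomputable abbrev cml : H →ₐ[k] H ⊗[k] H := Bialgebra.comulAlgHom k H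

theorem conv_inl_mul_inr :
    toConv (inl k H).toLinearMap * toConv (inr k H).toLinearMap = toConv (cml k H).toLinearMap := by
  ext x
  rw [(ℛ k x).convMul_apply]
  simp [(ℛ k x).eq]

theorem comul_antipode (x : H) :
    comul (R := k) (antipode k x) =
      TensorProduct.map (antipode k) (antipode k) (TensorProduct.comm k H H (comul x)) := by
  have h1 := conv_algHom_comp_antipode (cml k H)
  have h2 : (toConv ((inr k H).toLinearMap ∘ₗ antipode k) *
      toConv ((inl k H).toLinearMap ∘ₗ antipode k)) * toConv (cml k H).toLinearMap = 1 := by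
    rw [← conv_inl_mul_inr, mul_assoc, ← mul_assoc (toConv ((inl k H).toLinearMap ∘ₗ antipode k)),
      conv_antipode_comp_algHom, one_mul, conv_antipode_comp_algHom]
  have h3 := left_inv_eq_right_inv h2 h1
  have h4 := congrArg (fun F : WithConv (H →ₗ[k] H ⊗[k] H) => F.ofConv x) h3
  simp only at h4
  rw [(ℛ k x).convMul_apply] at h4
  simp only [AlgHom.toLinearMap_apply, LinearMap.comp_apply] at h4
  change _ = comul (R := k) (antipode k x) at h4
  rw [← h4, ← (ℛ k x).eq]
  simp

end Convolution

section Dual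

variable {k H : Type*} [Field k] [Ring H] [HopfAlgebra k H]

variable (k H) in
/-- The convolution algebra of linear functionals. -/
def Dl : Type _ := WithConv (H →ₗ[k] k)

noncomputable instance : Ring (Dl k H) := inferInstanceAs (Ring (WithConv (H →ₗ[k] k)))

noncomputable instance : Algebra k (Dl k H) :=
  inferInstanceAs (Algebra k (WithConv (H →ₗ[k] k)))

variable (k H) in
/-- The underlying functional of an element of the convolution algebra. -/
noncomputable def dlEquiv : Dl k H ≃ₗ[k] (H →ₗ[k] k) where
  toFun f := ofConv f
  invFun f := toConv f
  map_add' _ _ := rfl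
  map_smul' _ _ := rfl
  left_inv _ := rfl
  right_inv _ := rfl

noncomputable instance : CoeFun (Dl k H) (fun _ => H → k) := ⟨fun f => dlEquiv k H f⟩

@[ext] theorem Dl.ext {f g : Dl k H} (h : ∀ x, f x = g x) : f = g :=
  (dlEquiv k H).injective (LinearMap.ext h)

@[simp] theorem dlEquiv_symm_apply (f : H →ₗ[k] k) (x : H) : (dlEquiv k H).symm f x = f x := rfl

theorem Dl.one_apply (x : H) : (1 : Dl k H) x = counit (R := k) x := rfl

theorem Dl.mul_apply (f g : Dl k H) (x : H) :
    (f * g) x = LinearMap.mul' k k (TensorProduct.map (dlEquiv k H f) (dlEquiv k H g)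
      (comul x)) := rfl

theorem Dl.mul_apply_repr {ι : Type*} {x : H} (r : Coalgebra.Repr k x ι) (f g : Dl k H) :
    (f * g) x = ∑ i ∈ r.index, f (r.left i) * g (r.right i) :=
  r.convMul_apply _ _

/-- Evaluation of a tensor of two functionals. -/
noncomputable def ev₂ (x y : H) : Dl k H ⊗[k] Dl k H →ₗ[k] k :=
  LinearMap.mul' k k ∘ₗ TensorProduct.map
    (LinearMap.applyₗ x ∘ₗ (dlEquiv k H).toLinearMap)
    (LinearMap.applyₗ y ∘ₗ (dlEquiv k H).toLinearMap)

@[simp] theorem ev₂_tmul (x y : H) (f g : Dl k H) :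
    ev₂ x y (f ⊗ₜ[k] g) = f x * g y := rfl

variable [FiniteDimensional k H]

variable (k H) in
/-- Tensors of functionals are functionals on the tensor product. -/
noncomputable def tensorDual : Dl k H ⊗[k] Dl k H ≃ₗ[k]
    (H ⊗[k] H →ₗ[k] k) :=
  (TensorProduct.congr (dlEquiv k H)
    (dlEquiv k H)).trans (dualDistribEquiv k H H)

theorem tensorDual_apply (t) (x y : H) : tensorDual k H t (x ⊗ₜ y) = ev₂ x y t := by
  induction t with
  | zero => simp
  | add a b ha hb => simp [ha, hb]
  | tmul f g => simp [tensorDual, dualDistribEquiv, dualDistribEquivOfBasis]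

theorem ev₂_ext {s t : Dl k H ⊗[k] Dl k H}
    (h : ∀ x y, ev₂ x y s = ev₂ x y t) : s = t := by
  apply (tensorDual k H).injective
  ext x y
  simp [tensorDual_apply, h]

/-- Evaluation of a tensor of three functionals. -/
noncomputable def ev₃ (x y z : H) : Dl k H ⊗[k] (Dl k H ⊗[k]
    Dl k H) →ₗ[k] k :=
  LinearMap.mul' k k ∘ₗ TensorProduct.map
    (LinearMap.applyₗ x ∘ₗ (dlEquiv k H).toLinearMap) (ev₂ y z)

omit [FiniteDimensional k H] in
@[simp] theorem ev₃_tmul (x y z : H) (f : Dl k H) (t) :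
    ev₃ x y z (f ⊗ₜ[k] t) = f x * ev₂ y z t := rfl

theorem ev₃_ext {s t : Dl k H ⊗[k] (Dl k H ⊗[k]
    Dl k H)}
    (h : ∀ x y z, ev₃ x y z s = ev₃ x y z t) : s = t := by
  have key : ∀ t, ∀ x y z, (dualDistribEquiv k H (H ⊗[k] H))
      (TensorProduct.congr (dlEquiv k H) (tensorDual k H) t)
      (x ⊗ₜ (y ⊗ₜ z)) = ev₃ x y z t := by
    intro t x y z
    induction t with
    | zero => simp
    | add a b ha hb => simp only [map_add, LinearMap.add_apply, ha, hb]
    | tmul f g => simp [dualDistribEquiv, dualDistribEquivOfBasis, tensorDual_apply]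
  apply (TensorProduct.congr (dlEquiv k H) (tensorDual k H)).injective
  apply (dualDistribEquiv k H (H ⊗[k] H)).injective
  ext x y z
  exact (key s x y z).trans ((h x y z).trans (key t x y z).symm)

/-- The transpose of multiplication. -/
noncomputable def dualComul : Dl k H →ₗ[k]
    Dl k H ⊗[k] Dl k H :=
  (tensorDual k H).symm.toLinearMap ∘ₗ LinearMap.lcomp k k (LinearMap.mul' k H) ∘ₗ
    (dlEquiv k H).toLinearMap

@[simp] theorem ev₂_dualComul (x y : H) (f : Dl k H) :
    ev₂ x y (dualComul f) = f (x * y) := by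
  rw [← tensorDual_apply]
  simp [dualComul]

noncomputable instance : Coalgebra k (Dl k H) where
  comul := dualComul
  counit := LinearMap.applyₗ 1 ∘ₗ (dlEquiv k H).toLinearMap
  coassoc := by
    apply LinearMap.ext
    intro f
    apply ev₃_ext
    intro x y z
    have h1 : ev₃ x y z ∘ₗ (TensorProduct.assoc k _ _ _).toLinearMap ∘ₗ
        LinearMap.rTensor (Dl k H) (dualComul (k := k) (H := H)) =
        ev₂ (x * y) z := by
      apply TensorProduct.ext'
      intro a b
      rw [LinearMap.comp_apply, LinearMap.comp_apply, LinearMap.rTensor_tmul, ev₂_tmul,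
        ← ev₂_dualComul]
      generalize dualComul a = t
      induction t with
      | zero => simp
      | add a b ha hb => simp only [add_tmul, map_add, ha, hb, add_mul]
      | tmul f g => simp [mul_assoc]
    have h2 : ev₃ x y z ∘ₗ
        LinearMap.lTensor (Dl k H) (dualComul (k := k) (H := H)) =
        ev₂ x (y * z) := by
      apply TensorProduct.ext'
      intro a b
      simp
    have h1' := LinearMap.congr_fun h1 (dualComul f)
    have h2' := LinearMap.congr_fun h2 (dualComul f)
    simp only [LinearMap.comp_apply, ev₂_dualComul] at h1' h2' ⊢
    rw [h1', h2', mul_assoc]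
  rTensor_counit_comp_comul := by
    ext f
    apply (TensorProduct.lid k _).injective
    ext x
    have h1 : (LinearMap.applyₗ x ∘ₗ (dlEquiv k H).toLinearMap) ∘ₗ
      (TensorProduct.lid k _).toLinearMap ∘ₗ LinearMap.rTensor (Dl k H)
        (LinearMap.applyₗ 1 ∘ₗ (dlEquiv k H).toLinearMap) = ev₂ 1 x := by
      apply TensorProduct.ext'
      intro a b
      simp
    have h1' := LinearMap.congr_fun h1 (dualComul f)
    simp only [LinearMap.comp_apply, ev₂_dualComul] at h1' ⊢
    simpa using h1'
  lTensor_counit_comp_comul := by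
    ext f
    apply (TensorProduct.rid k _).injective
    ext x
    have h1 : (LinearMap.applyₗ x ∘ₗ (dlEquiv k H).toLinearMap) ∘ₗ
      (TensorProduct.rid k _).toLinearMap ∘ₗ LinearMap.lTensor (Dl k H)
        (LinearMap.applyₗ 1 ∘ₗ (dlEquiv k H).toLinearMap) = ev₂ x 1 := by
      apply TensorProduct.ext'
      intro a b
      simp [mul_comm]
    have h1' := LinearMap.congr_fun h1 (dualComul f)
    simp only [LinearMap.comp_apply, ev₂_dualComul] at h1' ⊢
    simpa using h1'

@[simp] theorem ev₂_comul (x y : H) (f : Dl k H) :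
    ev₂ x y (comul (R := k) f) = f (x * y) := ev₂_dualComul x y f

@[simp] theorem dual_counit (f : Dl k H) : counit (R := k) f = f 1 := rfl

omit [FiniteDimensional k H] in
theorem ev₂_mul {ι κ : Type*} {x y : H} (rx : Coalgebra.Repr k x ι) (ry : Coalgebra.Repr k y κ)
    (s t : Dl k H ⊗[k] Dl k H) :
    ev₂ x y (s * t) = ∑ i ∈ rx.index, ∑ j ∈ ry.index,
      ev₂ (rx.left i) (ry.left j) s * ev₂ (rx.right i) (ry.right j) t := by
  induction s with
  | zero => simp
  | add a b ha hb => simp [add_mul, ha, hb, Finset.sum_add_distrib]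
  | tmul f g =>
    induction t with
    | zero => simp
    | add a b ha hb => simp [mul_add, ha, hb, Finset.sum_add_distrib]
    | tmul f' g' =>
      rw [Algebra.TensorProduct.tmul_mul_tmul, ev₂_tmul, Dl.mul_apply_repr rx, Dl.mul_apply_repr ry,
        Finset.sum_mul_sum]
      refine Finset.sum_congr rfl fun i _ => Finset.sum_congr rfl fun j _ => ?_
      simp only [ev₂_tmul]
      ring

noncomputable instance : Bialgebra k (Dl k H) :=
  Bialgebra.mk' _ _ (by simp [Dl.one_apply])
    (by intro f g; simp [Dl.mul_apply, Bialgebra.comul_one, Algebra.TensorProduct.one_def])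
    (by
      apply ev₂_ext
      intro x y
      rw [ev₂_comul, Algebra.TensorProduct.one_def]
      simp [Dl.one_apply])
    (by
      intro f g
      apply ev₂_ext
      intro x y
      rw [ev₂_comul, ev₂_mul (ℛ k x) (ℛ k y), Dl.mul_apply, Bialgebra.comul_mul,
        ← (ℛ k x).eq, ← (ℛ k y).eq]
      simp [Finset.sum_mul_sum])

/-- The transpose of the antipode. -/
noncomputable def dualAntipode : Dl k H →ₗ[k] Dl k H :=
  (dlEquiv k H).symm.toLinearMap ∘ₗ LinearMap.lcomp k k (antipode k) ∘ₗ
    (dlEquiv k H).toLinearMap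

omit [FiniteDimensional k H] in
theorem mul'_dual_apply (x : H) (t : Dl k H ⊗[k] Dl k H) :
    (LinearMap.mul' k (Dl k H) t) x =
      ∑ i ∈ (ℛ k x).index, ev₂ ((ℛ k x).left i) ((ℛ k x).right i) t := by
  induction t with
  | zero => simp
  | add a b ha hb => simp [Finset.sum_add_distrib, ha, hb]
  | tmul f g => simp only [LinearMap.mul'_apply, Dl.mul_apply_repr (ℛ k x), ev₂_tmul]

noncomputable instance : HopfAlgebra k (Dl k H) where
  antipode := dualAntipode
  mul_antipode_rTensor_comul := by
    apply LinearMap.ext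
    intro f
    ext x
    have h : ∀ x y t, ev₂ x y (LinearMap.rTensor _ (dualAntipode (k := k) (H := H)) t) =
        ev₂ (antipode k x) y t := by
      intro x y t
      induction t with
      | zero => simp
      | add a b ha hb => simp [ha, hb]
      | tmul f g => simp [dualAntipode]
    simp only [LinearMap.comp_apply]
    rw [mul'_dual_apply]
    simp only [h, ev₂_comul, ← map_sum, sum_antipode_mul_eq_algebraMap_counit]
    simp [Algebra.algebraMap_eq_smul_one, Dl.one_apply, mul_comm]
  mul_antipode_lTensor_comul := by
    apply LinearMap.ext
    intro f
    ext x
    have h : ∀ x y t, ev₂ x y (LinearMap.lTensor _ (dualAntipode (k := k) (H := H)) t) =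
        ev₂ x (antipode k y) t := by
      intro x y t
      induction t with
      | zero => simp
      | add a b ha hb => simp [ha, hb]
      | tmul f g => simp [dualAntipode]
    simp only [LinearMap.comp_apply]
    rw [mul'_dual_apply]
    simp only [h, ev₂_comul, ← map_sum, sum_mul_antipode_eq_algebraMap_counit]
    simp [Algebra.algebraMap_eq_smul_one, Dl.one_apply, mul_comm]

theorem dual_antipode_apply (f : Dl k H) (x : H) :
    (antipode k f) x = f (antipode k x) := rfl

end Dual

section Functionals

variable {k H : Type*} [Field k] [Ring H] [HopfAlgebra k H]

theorem eq_of_forall_dl {x y : H} (h : ∀ f : Dl k H, f x = f y) : x = y := by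
  rw [← sub_eq_zero, ← Module.forall_dual_apply_eq_zero_iff k]
  intro φ
  have := h ((dlEquiv k H).symm φ)
  simp only [dlEquiv_symm_apply] at this
  rw [map_sub, this, sub_self]

/-- The operator `h ↦ a(h₁) h₂`. -/
noncomputable def lop (a : Dl k H) : H →ₗ[k] H :=
  (TensorProduct.lid k H).toLinearMap ∘ₗ LinearMap.rTensor H (dlEquiv k H a) ∘ₗ comul

/-- The operator `h ↦ h₁ a(h₂)`. -/
noncomputable def rop (a : Dl k H) : H →ₗ[k] H :=
  (TensorProduct.rid k H).toLinearMap ∘ₗ LinearMap.lTensor H (dlEquiv k H a) ∘ₗ comul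

theorem lop_apply {ι : Type*} {h : H} (r : Coalgebra.Repr k h ι) (a : Dl k H) :
    lop a h = ∑ i ∈ r.index, a (r.left i) • r.right i := by
  simp [lop, ← r.eq]

theorem rop_apply {ι : Type*} {h : H} (r : Coalgebra.Repr k h ι) (a : Dl k H) :
    rop a h = ∑ i ∈ r.index, a (r.right i) • r.left i := by
  simp [rop, ← r.eq]

theorem dl_lop (f a : Dl k H) (h : H) : f (lop a h) = (a * f) h := by
  rw [lop_apply (ℛ k h), Dl.mul_apply_repr (ℛ k h)]
  simp

theorem dl_rop (f a : Dl k H) (h : H) : f (rop a h) = (f * a) h := by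
  rw [rop_apply (ℛ k h), Dl.mul_apply_repr (ℛ k h)]
  simp [mul_comm]

theorem lop_lop (a b : Dl k H) (h : H) : lop a (lop b h) = lop (b * a) h := by
  apply eq_of_forall_dl (k := k)
  intro f
  simp only [dl_lop, mul_assoc]

theorem rop_rop (a b : Dl k H) (h : H) : rop a (rop b h) = rop (a * b) h := by
  apply eq_of_forall_dl (k := k)
  intro f
  simp only [dl_rop, mul_assoc]

theorem lop_rop (a b : Dl k H) (h : H) : lop a (rop b h) = rop b (lop a h) := by
  apply eq_of_forall_dl (k := k)
  intro f
  simp only [dl_rop, dl_lop, mul_assoc]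

theorem lop_one (h : H) : lop (1 : Dl k H) h = h := by
  apply eq_of_forall_dl (k := k)
  intro f
  rw [dl_lop, one_mul]

theorem rop_one (h : H) : rop (1 : Dl k H) h = h := by
  apply eq_of_forall_dl (k := k)
  intro f
  rw [dl_rop, mul_one]

theorem counit_lop (a : Dl k H) (h : H) : counit (R := k) (lop a h) = a h := by
  have := dl_lop (1 : Dl k H) a h
  rwa [mul_one, Dl.one_apply] at this

theorem counit_rop (a : Dl k H) (h : H) : counit (R := k) (rop a h) = a h := by
  have := dl_rop (1 : Dl k H) a h
  rwa [one_mul, Dl.one_apply] at this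

end Functionals

section Opposite

variable {k H : Type*} [Field k] [Ring H] [HopfAlgebra k H]

/-- A linear endomorphism as a map to the opposite algebra. -/
noncomputable def opl (F : H →ₗ[k] H) : WithConv (H →ₗ[k] Hᵐᵒᵖ) :=
  toConv ((MulOpposite.opLinearEquiv k).toLinearMap ∘ₗ F)

theorem opl_apply (F : H →ₗ[k] H) (h : H) : (opl F) h = MulOpposite.op (F h) := rfl

theorem opl_injective : Function.Injective (opl (k := k) (H := H)) := by
  intro F G h
  ext x
  have := congrArg (fun K : WithConv (H →ₗ[k] Hᵐᵒᵖ) => K.ofConv x) h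
  exact MulOpposite.op_injective this

/-- The operator `h ↦ G(h₂) F(h₁)`. -/
noncomputable def cop (F G : H →ₗ[k] H) : H →ₗ[k] H :=
  LinearMap.mul' k H ∘ₗ (TensorProduct.comm k H H).toLinearMap ∘ₗ TensorProduct.map F G ∘ₗ comul

theorem cop_apply {ι : Type*} {h : H} (r : Coalgebra.Repr k h ι) (F G : H →ₗ[k] H) :
    cop F G h = ∑ i ∈ r.index, G (r.right i) * F (r.left i) := by
  simp [cop, ← r.eq]

theorem opl_cop (F G : H →ₗ[k] H) : opl (cop F G) = opl F * opl G := by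
  ext h
  rw [(ℛ k h).convMul_apply]
  simp [opl_apply, cop_apply (ℛ k h)]

theorem opl_antipode_sq_mul : opl (antipode k ∘ₗ antipode k (A := H)) * opl (antipode k) = 1 := by
  ext h
  rw [(ℛ k h).convMul_apply]
  simp only [opl_apply, ← MulOpposite.op_mul, LinearMap.comp_apply, ← antipode_mul_antidistrib]
  rw [← Finset.op_sum, ← map_sum, sum_antipode_mul_eq_algebraMap_counit]
  simp [Algebra.algebraMap_eq_smul_one, antipode_one]

theorem opl_mul_antipode_sq : opl (antipode k (A := H)) * opl (antipode k ∘ₗ antipode k) = 1 := by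
  ext h
  rw [(ℛ k h).convMul_apply]
  simp only [opl_apply, ← MulOpposite.op_mul, LinearMap.comp_apply, ← antipode_mul_antidistrib]
  rw [← Finset.op_sum, ← map_sum, sum_mul_antipode_eq_algebraMap_counit]
  simp [Algebra.algebraMap_eq_smul_one, antipode_one]

theorem cop_cop_antipode_sq (F : H →ₗ[k] H) :
    cop (cop F (antipode k)) (antipode k ∘ₗ antipode k) = F := by
  apply opl_injective
  rw [opl_cop, opl_cop, mul_assoc, opl_mul_antipode_sq, mul_one]

theorem cop_cop_antipode (F : H →ₗ[k] H) :
    cop (cop F (antipode k ∘ₗ antipode k)) (antipode k) = F := by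
  apply opl_injective
  rw [opl_cop, opl_cop, mul_assoc, opl_antipode_sq_mul, mul_one]

end Opposite

section Integral

variable {k H : Type*} [Field k] [Ring H] [HopfAlgebra k H]

variable (k H) in
include k in
theorem one_ne_zero_of_hopf : (1 : H) ≠ 0 := by
  intro h
  have : counit (R := k) (1 : H) = 1 := Bialgebra.counit_one
  rw [h, map_zero] at this
  exact zero_ne_one this

/-- The operator `z ↦ f(z₁) S²(z₂) y`. -/
noncomputable def uop (f : H →ₗ[k] k) (y : H) : H →ₗ[k] H :=
  LinearMap.mulRight k y ∘ₗ (antipode k ∘ₗ antipode k) ∘ₗ lop ((dlEquiv k H).symm f)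

theorem uop_apply {ι : Type*} {z : H} (r : Coalgebra.Repr k z ι) (f : H →ₗ[k] k) (y : H) :
    uop f y z = ∑ i ∈ r.index, f (r.left i) • (antipode k (antipode k (r.right i)) * y) := by
  simp [uop, lop_apply r]

theorem uop_add (f g : H →ₗ[k] k) (y : H) : uop (f + g) y = uop f y + uop g y := by
  ext z
  simp [uop_apply (ℛ k z), add_smul, Finset.sum_add_distrib]

theorem uop_smul (c : k) (f : H →ₗ[k] k) (y : H) : uop (c • f) y = c • uop f y := by
  ext z
  simp [uop_apply (ℛ k z), mul_smul, Finset.smul_sum]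

theorem uop_mul (f : H →ₗ[k] k) (y h z : H) :
    uop (f ∘ₗ LinearMap.mulLeft k h) y z =
      ∑ i ∈ (ℛ k h).index, antipode k ((ℛ k h).right i) * uop f y ((ℛ k h).left i * z) := by
  let rz := ℛ k z
  let Y (j : _) : H →ₗ[k] H := LinearMap.toSpanSingleton k H (antipode k (antipode k (rz.right j)) * y)
    ∘ₗ f ∘ₗ LinearMap.mulRight k (rz.left j)
  have h1 : ∀ h, uop f y (h * z) = ∑ j ∈ rz.index, cop (Y j) (antipode k ∘ₗ antipode k) h := by
    intro h
    simp only [cop_apply (ℛ k h)]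
    rw [Finset.sum_comm]
    simp only [uop, lop, LinearMap.comp_apply, Bialgebra.comul_mul, ← (ℛ k h).eq, ← rz.eq,
      Finset.sum_mul_sum]
    simp [Y, mul_assoc, antipode_mul_antidistrib]
  have h2 : ∀ j, ∑ i ∈ (ℛ k h).index, antipode k ((ℛ k h).right i) *
      cop (Y j) (antipode k ∘ₗ antipode k) ((ℛ k h).left i) = Y j h := by
    intro j
    rw [← cop_apply (ℛ k h), cop_cop_antipode]
  simp only [h1, Finset.mul_sum]
  rw [Finset.sum_comm]
  simp only [h2]
  rw [uop_apply rz]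
  simp [Y]

variable [FiniteDimensional k H]

instance : FiniteDimensional k (Dl k H) := (dlEquiv k H).symm.finiteDimensional

theorem trace_uop_mul (f : H →ₗ[k] k) (y h : H) :
    LinearMap.trace k H (uop (f ∘ₗ LinearMap.mulLeft k h) y) =
      counit (R := k) h * LinearMap.trace k H (uop f y) := by
  have h1 : uop (f ∘ₗ LinearMap.mulLeft k h) y = ∑ i ∈ (ℛ k h).index,
      LinearMap.mulLeft k (antipode k ((ℛ k h).right i)) ∘ₗ
        (uop f y ∘ₗ LinearMap.mulLeft k ((ℛ k h).left i)) := by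
    ext z
    simp [uop_mul f y h z]
  have h2 : ∀ i, LinearMap.trace k H (LinearMap.mulLeft k (antipode k ((ℛ k h).right i)) ∘ₗ
        (uop f y ∘ₗ LinearMap.mulLeft k ((ℛ k h).left i))) = LinearMap.trace k H
        (uop f y ∘ₗ LinearMap.mulLeft k ((ℛ k h).left i * antipode k ((ℛ k h).right i))) := by
    intro i
    rw [LinearMap.trace_comp_comm', LinearMap.comp_assoc, LinearMap.mulLeft_mul]
  have h3 : ∑ i ∈ (ℛ k h).index, uop f y ∘ₗ LinearMap.mulLeft k
      ((ℛ k h).left i * antipode k ((ℛ k h).right i)) = counit (R := k) h • uop f y := by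
    ext z
    simp only [LinearMap.sum_apply, LinearMap.comp_apply, LinearMap.mulLeft_apply, ← map_sum,
      ← Finset.sum_mul, sum_mul_antipode_eq_algebraMap_counit]
    simp [Algebra.algebraMap_eq_smul_one]
  rw [h1, map_sum]
  simp only [h2]
  rw [← map_sum, h3, map_smul, smul_eq_mul]

variable (k H) in
/-- A finite-dimensional Hopf algebra has a nonzero left integral. -/
theorem exists_left_integral :
    ∃ L : H, L ≠ 0 ∧ ∀ h : H, h * L = counit (R := k) h • L := by
  have key : ∃ (f : H →ₗ[k] k) (y : H), LinearMap.trace k H (uop f y) ≠ 0 := by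
    by_contra! hcon
    have h1 : (1 : H) ≠ 0 := one_ne_zero_of_hopf k H
    obtain ⟨f, hf⟩ : ∃ f : H →ₗ[k] k, f 1 ≠ 0 := by
      by_contra! hc
      exact h1 ((Module.forall_dual_apply_eq_zero_iff k _).1 hc)
    let F : H →ₗ[k] H := LinearMap.toSpanSingleton k H 1 ∘ₗ f
    let b := Module.finBasis k H
    let P := cop F (antipode k)
    have h2 : F = ∑ j, uop (b.coord j ∘ₗ P) (b j) := by
      rw [← cop_cop_antipode_sq F]
      ext z
      rw [cop_apply (ℛ k z)]
      simp only [LinearMap.sum_apply, uop_apply (ℛ k z)]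
      rw [Finset.sum_comm]
      refine Finset.sum_congr rfl fun i _ => ?_
      conv_lhs => rw [← b.sum_repr (cop F (antipode k) ((ℛ k z).left i))]
      rw [Finset.mul_sum]
      simp [P]
    have h3 : LinearMap.trace k H F = f 1 := by
      have := LinearMap.trace_comp_comm' (LinearMap.toSpanSingleton k H 1) f
      have h4 : f ∘ₗ LinearMap.toSpanSingleton k H 1 = f 1 • LinearMap.id := by
        ext
        simp
      rw [← this, h4, map_smul, LinearMap.trace_id]
      simp
    apply hf
    rw [← h3, h2, map_sum]
    simp [hcon]
  obtain ⟨f, y, hfy⟩ := key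
  let Th : Module.Dual k (Module.Dual k H) :=
    { toFun := fun f => LinearMap.trace k H (uop f y)
      map_add' := by intro f g; simp [uop_add]
      map_smul' := by intro f g; simp [uop_smul] }
  let L := (Module.evalEquiv k H).symm Th
  have hL : ∀ g : Module.Dual k H, g L = LinearMap.trace k H (uop g y) := by
    intro g
    exact Module.apply_evalEquiv_symm_apply k H g Th
  refine ⟨L, ?_, ?_⟩
  · intro h0
    apply hfy
    rw [← hL, h0, map_zero]
  · intro h
    rw [← sub_eq_zero, ← Module.forall_dual_apply_eq_zero_iff k]
    intro g
    have := trace_uop_mul g y h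
    rw [← hL, ← hL] at this
    rw [map_sub, map_smul, sub_eq_zero, smul_eq_mul, ← this]
    rfl

variable (k H) in
/-- A finite-dimensional Hopf algebra has a nonzero left integral on it. -/
theorem exists_left_cointegral :
    ∃ l : Dl k H, l ≠ 0 ∧ ∀ h : H, rop l h = l h • 1 := by
  obtain ⟨l, h1, h2⟩ := exists_left_integral k (Dl k H)
  refine ⟨l, h1, fun h => eq_of_forall_dl (k := k) fun f => ?_⟩
  rw [dl_rop, h2, dual_counit]
  simp [mul_comm]

end Integral

section Nondegenerate

variable {k H : Type*} [Field k] [Ring H] [HopfAlgebra k H]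

/-- Applying a functional to the right tensor factor. -/
noncomputable def evr (l : Dl k H) : H ⊗[k] H →ₗ[k] H :=
  (TensorProduct.rid k H).toLinearMap ∘ₗ LinearMap.lTensor H (dlEquiv k H l)

/-- Applying a functional to the left tensor factor. -/
noncomputable def evl (l : Dl k H) : H ⊗[k] H →ₗ[k] H :=
  (TensorProduct.lid k H).toLinearMap ∘ₗ LinearMap.rTensor H (dlEquiv k H l)

@[simp] theorem evr_tmul (l : Dl k H) (x y : H) : evr l (x ⊗ₜ y) = l y • x := rfl
@[simp] theorem evl_tmul (l : Dl k H) (x y : H) : evl l (x ⊗ₜ y) = l x • y := rfl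

theorem evr_comul (l : Dl k H) (x : H) : evr l (comul x) = rop l x := rfl
theorem evl_comul (l : Dl k H) (x : H) : evl l (comul x) = lop l x := rfl

theorem evr_mul_inl (l : Dl k H) (t : H ⊗[k] H) (z : H) :
    evr l (t * inl k H z) = evr l t * z := by
  induction t with
  | zero => simp
  | add a b ha hb => simp only [add_mul, map_add, ha, hb]
  | tmul f g => simp

theorem evr_inl_mul (l : Dl k H) (t : H ⊗[k] H) (z : H) :
    evr l (inl k H z * t) = z * evr l t := by
  induction t with
  | zero => simp
  | add a b ha hb => simp only [mul_add, map_add, ha, hb]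
  | tmul f g => simp

theorem evl_mul_inr (l : Dl k H) (t : H ⊗[k] H) (z : H) :
    evl l (t * inr k H z) = evl l t * z := by
  induction t with
  | zero => simp
  | add a b ha hb => simp only [add_mul, map_add, ha, hb]
  | tmul f g => simp

theorem evl_inr_mul (l : Dl k H) (t : H ⊗[k] H) (z : H) :
    evl l (inr k H z * t) = z * evl l t := by
  induction t with
  | zero => simp
  | add a b ha hb => simp only [mul_add, map_add, ha, hb]
  | tmul f g => simp

theorem conv_comul_antipode :
    toConv ((cml k H).toLinearMap ∘ₗ antipode k) =
      toConv ((inr k H).toLinearMap ∘ₗ antipode k) *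
        toConv ((inl k H).toLinearMap ∘ₗ antipode k) := by
  symm
  refine left_inv_eq_right_inv ?_ (conv_algHom_comp_antipode (cml k H))
  rw [← conv_inl_mul_inr, mul_assoc, ← mul_assoc (toConv ((inl k H).toLinearMap ∘ₗ antipode k)),
    conv_antipode_comp_algHom, one_mul, conv_antipode_comp_algHom]

theorem conv_comul_antipode_mul_inl :
    toConv ((cml k H).toLinearMap ∘ₗ antipode k) * toConv (inl k H).toLinearMap =
      toConv ((inr k H).toLinearMap ∘ₗ antipode k) := by
  rw [conv_comul_antipode, mul_assoc, conv_antipode_comp_algHom, mul_one]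

theorem cointegral_antipode {l : Dl k H} (hl : ∀ h : H, rop l h = l h • 1) (x h : H) :
    ∑ i ∈ (ℛ k h).index, l (x * antipode k ((ℛ k h).left i)) • (ℛ k h).right i =
      evr l (comul x * inr k H (antipode k h)) := by
  have h1 := congrArg (fun F : WithConv (H →ₗ[k] H ⊗[k] H) => F.ofConv h)
    (conv_comul_antipode_mul_inl (k := k) (H := H))
  simp only [(ℛ k h).convMul_apply] at h1
  simp only [LinearMap.comp_apply, AlgHom.toLinearMap_apply, Bialgebra.comulAlgHom_apply] at h1
  rw [← h1, Finset.mul_sum, map_sum]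
  refine Finset.sum_congr rfl fun i _ => ?_
  rw [← mul_assoc, ← Bialgebra.comul_mul, evr_mul_inl, evr_comul, hl, smul_mul_assoc, one_mul]

variable [FiniteDimensional k H]

theorem cointegral_antipode_injective {l : Dl k H} (hl : ∀ h : H, rop l h = l h • 1) (hl0 : l ≠ 0)
    {h : H} (hh : ∀ x, l (x * antipode k h) = 0) : h = 0 := by
  have step1 : ∀ h : H, (∀ x, l (x * antipode k h) = 0) → ∀ x,
      ∑ i ∈ (ℛ k h).index, l (x * antipode k ((ℛ k h).left i)) • (ℛ k h).right i = 0 := by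
    intro h hh x
    rw [cointegral_antipode hl]
    rw [← (ℛ k x).eq]
    simp [Finset.sum_mul, hh]
  have step2 : ∀ h : H, (∀ x, l (x * antipode k h) = 0) → counit (R := k) h = 0 := by
    intro h hh
    have h1 := step1 h hh
    let b := Module.finBasis k H
    have h2 : ∀ x, l x * counit (R := k) h = 0 := by
      intro x
      have e1 : ∑ i ∈ (ℛ k h).index, l (x * antipode k (antipode k ((ℛ k h).right i)) *
          antipode k ((ℛ k h).left i)) = l x * counit (R := k) h := by
        simp only [mul_assoc, ← antipode_mul_antidistrib]
        rw [← map_sum, ← Finset.mul_sum, ← map_sum, sum_mul_antipode_eq_algebraMap_counit]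
        simp [Algebra.algebraMap_eq_smul_one, antipode_one, mul_comm]
      rw [← e1]
      have e2 : ∀ i, l (x * antipode k (antipode k ((ℛ k h).right i)) *
          antipode k ((ℛ k h).left i)) = ∑ j, b.repr (x * antipode k (antipode k ((ℛ k h).right i))) j
            * l (b j * antipode k ((ℛ k h).left i)) := by
        intro i
        conv_lhs => rw [← b.sum_repr (x * antipode k (antipode k ((ℛ k h).right i)))]
        simp only [Finset.sum_mul, map_sum, smul_mul_assoc, map_smul, smul_eq_mul]
      simp only [e2]
      rw [Finset.sum_comm]
      refine Finset.sum_eq_zero fun j _ => ?_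
      have e3 := congrArg (fun z => b.repr (x * antipode k (antipode k z)) j) (h1 (b j))
      simp only [map_sum, map_smul, Finset.mul_sum, mul_smul_comm] at e3
      simp only [Finsupp.coe_finsetSum, Finset.sum_apply, Finsupp.smul_apply, smul_eq_mul,
        map_zero, mul_zero, Finsupp.coe_zero, Pi.zero_apply] at e3
      simpa [mul_comm] using e3
    by_contra h3
    apply hl0
    ext x
    have := h2 x
    simp only [mul_eq_zero, h3, or_false] at this
    simpa using this
  apply eq_of_forall_dl (k := k)
  intro f
  rw [map_zero, ← counit_rop]
  apply step2
  intro x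
  have := congrArg f (step1 h hh x)
  rw [map_zero, map_sum] at this
  rw [rop_apply (ℛ k h)]
  simpa [Finset.mul_sum, mul_comm] using this

end Nondegenerate

section Basics

variable {k H : Type*} [Field k] [Ring H] [HopfAlgebra k H]

theorem tensor_ext_evl {s t : H ⊗[k] H} (h : ∀ f : Dl k H, evl f s = evl f t) : s = t := by
  classical
  let b := Module.Basis.ofVectorSpace k H
  apply (TensorProduct.equivFinsuppOfBasisLeft (N := H) b).injective
  ext i
  have e : ∀ u : H ⊗[k] H, TensorProduct.equivFinsuppOfBasisLeft b u i =
      evl ((dlEquiv k H).symm (b.coord i)) u := by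
    intro u
    induction u with
    | zero => simp
    | add x y hx hy => simp only [map_add, Finsupp.add_apply, hx, hy]
    | tmul x y => simp
  rw [e, e, h]

/-- A left integral and a left integral on `H`, normalised against each other. -/
structure Integrals (k H : Type*) [Field k] [Ring H] [HopfAlgebra k H] where
  /-- the left integral in `H` -/
  L : H
  /-- the left integral on `H` -/
  l : Dl k H
  mul_L : ∀ h : H, h * L = counit (R := k) h • L
  rop_l : ∀ h : H, rop l h = l h • 1
  l_L : l L = 1

/-- The square of the antipode. -/
noncomputable def sq (k H : Type*) [Field k] [Ring H] [HopfAlgebra k H] : H →ₗ[k] H :=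
  antipode k ∘ₗ antipode k

theorem sq_apply (h : H) : sq k H h = antipode k (antipode k h) := rfl

theorem sq_mul (x y : H) : sq k H (x * y) = sq k H x * sq k H y := by
  simp [sq_apply, antipode_mul_antidistrib]

theorem sq_one : sq k H 1 = 1 := by simp [sq_apply, antipode_one]

theorem counit_sq (h : H) : counit (R := k) (sq k H h) = counit (R := k) h := by
  simp [sq_apply]

theorem antipode_sq (h : H) : antipode k (sq k H h) = sq k H (antipode k h) := rfl

theorem comul_antipode_repr {ι : Type*} {h : H} (r : Coalgebra.Repr k h ι) :
    comul (R := k) (antipode k h) =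
      ∑ i ∈ r.index, antipode k (r.right i) ⊗ₜ antipode k (r.left i) := by
  rw [comul_antipode, ← r.eq]
  simp

end Basics

section Finite

variable {k H : Type*} [Field k] [Ring H] [HopfAlgebra k H] [FiniteDimensional k H]

theorem lop_antipode (a : Dl k H) (h : H) :
    lop a (antipode k h) = antipode k (rop (antipode k a) h) := by
  rw [rop_apply (ℛ k h), ← evl_comul, comul_antipode_repr (ℛ k h)]
  simp [dual_antipode_apply]

theorem rop_antipode (a : Dl k H) (h : H) :
    rop a (antipode k h) = antipode k (lop (antipode k a) h) := by
  rw [lop_apply (ℛ k h), ← evr_comul, comul_antipode_repr (ℛ k h)]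
  simp [dual_antipode_apply]

theorem lop_sq (a : Dl k H) (h : H) : lop a (sq k H h) = sq k H (lop (sq k (Dl k H) a) h) := by
  rw [sq_apply, lop_antipode, rop_antipode, sq_apply, sq_apply]

theorem rop_sq (a : Dl k H) (h : H) : rop a (sq k H h) = sq k H (rop (sq k (Dl k H) a) h) := by
  rw [sq_apply, rop_antipode, lop_antipode, sq_apply, sq_apply]

theorem dual_sq_apply (a : Dl k H) (h : H) : sq k (Dl k H) a h = a (sq k H h) := rfl

theorem isGroupLikeElem_dual_iff (a : Dl k H) :
    IsGroupLikeElem k a ↔ a 1 = 1 ∧ ∀ x y, a (x * y) = a x * a y := by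
  constructor
  · intro h
    refine ⟨h.counit_eq_one, fun x y => ?_⟩
    rw [← ev₂_comul, h.comul_eq_tmul_self, ev₂_tmul]
  · rintro ⟨h1, h2⟩
    refine ⟨h1, ev₂_ext fun x y => ?_⟩
    rw [ev₂_comul, h2, ev₂_tmul]

omit [FiniteDimensional k H] in
theorem isGroupLikeElem_iff (g : H) :
    IsGroupLikeElem k g ↔ counit (R := k) g = 1 ∧ ∀ f f' : Dl k H, (f * f') g = f g * f' g := by
  constructor
  · intro h
    refine ⟨h.counit_eq_one, fun f f' => ?_⟩
    rw [Dl.mul_apply, h.comul_eq_tmul_self]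
    simp
  · rintro ⟨h1, h2⟩
    refine ⟨h1, tensor_ext_evl fun f => ?_⟩
    rw [evl_comul, evl_tmul]
    apply eq_of_forall_dl (k := k)
    intro f'
    rw [dl_lop, h2, map_smul, smul_eq_mul]

omit [FiniteDimensional k H] in
theorem sq_groupLike {g : H} (hg : IsGroupLikeElem k g) : sq k H g = g := by
  rw [sq_apply, hg.antipode_antipode]

theorem cointegral_bijective {l : Dl k H} (hl : ∀ h : H, rop l h = l h • 1) (hl0 : l ≠ 0) :
    Function.Bijective (antipode k (A := H)) := by
  have hinj : Function.Injective (antipode k (A := H)) := by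
    rw [injective_iff_map_eq_zero]
    intro h hh
    apply cointegral_antipode_injective hl hl0
    simp [hh]
  exact ⟨hinj, LinearMap.surjective_of_injective hinj⟩

variable (k H) in
theorem antipode_bijective : Function.Bijective (antipode k (A := H)) := by
  obtain ⟨l, h1, h2⟩ := exists_left_cointegral k H
  exact cointegral_bijective h2 h1

variable (k H) in
theorem sq_bijective : Function.Bijective (sq k H) :=
  (antipode_bijective k H).comp (antipode_bijective k H)

theorem cointegral_right_injective {l : Dl k H} (hl : ∀ h : H, rop l h = l h • 1) (hl0 : l ≠ 0)
    {h : H} (hh : ∀ x, l (x * h) = 0) : h = 0 := by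
  obtain ⟨y, rfl⟩ := (antipode_bijective k H).2 h
  rw [cointegral_antipode_injective hl hl0 hh, map_zero]

theorem cointegral_right_surjective {l : Dl k H} (hl : ∀ h : H, rop l h = l h • 1) (hl0 : l ≠ 0)
    (f : Dl k H) : ∃ y, ∀ x, f x = l (x * y) := by
  let Φ : H →ₗ[k] (H →ₗ[k] k) := (LinearMap.mul k H).flip.compr₂ (dlEquiv k H l)
  have hinj : Function.Injective Φ := by
    rw [injective_iff_map_eq_zero]
    intro h hh
    apply cointegral_right_injective hl hl0
    intro x
    exact LinearMap.congr_fun hh x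
  have hs : Function.Surjective Φ := by
    refine (LinearMap.injective_iff_surjective_of_finrank_eq_finrank ?_).1 hinj
    exact (Subspace.dual_finrank_eq).symm
  obtain ⟨y, hy⟩ := hs (dlEquiv k H f)
  exact ⟨y, fun x => (LinearMap.congr_fun hy x).symm⟩

theorem cointegral_left_injective {l : Dl k H} (hl : ∀ h : H, rop l h = l h • 1) (hl0 : l ≠ 0)
    {h : H} (hh : ∀ x, l (h * x) = 0) : h = 0 := by
  apply eq_of_forall_dl (k := k)
  intro f
  obtain ⟨y, hy⟩ := cointegral_right_surjective hl hl0 f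
  rw [hy, hh, map_zero]

theorem cointegral_left_surjective {l : Dl k H} (hl : ∀ h : H, rop l h = l h • 1) (hl0 : l ≠ 0)
    (f : Dl k H) : ∃ y, ∀ x, f x = l (y * x) := by
  let Φ : H →ₗ[k] (H →ₗ[k] k) := (LinearMap.mul k H).compr₂ (dlEquiv k H l)
  have hinj : Function.Injective Φ := by
    rw [injective_iff_map_eq_zero]
    intro h hh
    apply cointegral_left_injective hl hl0
    intro x
    exact LinearMap.congr_fun hh x
  have hs : Function.Surjective Φ := by
    refine (LinearMap.injective_iff_surjective_of_finrank_eq_finrank ?_).1 hinj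
    exact (Subspace.dual_finrank_eq).symm
  obtain ⟨y, hy⟩ := hs (dlEquiv k H f)
  exact ⟨y, fun x => (LinearMap.congr_fun hy x).symm⟩

variable (k H) in
theorem exists_integrals : Nonempty (Integrals k H) := by
  obtain ⟨l, h1, h2⟩ := exists_left_cointegral k H
  obtain ⟨L, h3, h4⟩ := exists_left_integral k H
  have h5 : l L ≠ 0 := by
    intro h
    apply h3
    apply cointegral_right_injective h2 h1
    intro x
    rw [h4, map_smul, h, smul_zero]
  refine ⟨⟨(l L)⁻¹ • L, l, fun h => ?_, h2, ?_⟩⟩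
  · rw [mul_smul_comm, h4, smul_comm]
  · rw [map_smul, smul_eq_mul, inv_mul_cancel₀ h5]

theorem left_integral_unique {L L' : H} (hL0 : L ≠ 0) (hL : ∀ h : H, h * L = counit (R := k) h • L)
    (hL' : ∀ h : H, h * L' = counit (R := k) h • L') : ∃ c : k, L' = c • L := by
  obtain ⟨l, h1, h2⟩ := exists_left_cointegral k H
  have h5 : l L ≠ 0 := by
    intro h
    apply hL0
    apply cointegral_right_injective h2 h1
    intro x
    rw [hL, map_smul, h, smul_zero]
  refine ⟨l L' / l L, ?_⟩
  rw [← sub_eq_zero]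
  apply cointegral_right_injective h2 h1
  intro x
  rw [mul_sub, mul_smul_comm, hL, hL', map_sub, map_smul, map_smul, map_smul]
  simp only [smul_eq_mul]
  field_simp
  ring

namespace Integrals

variable (I : Integrals k H)

omit [FiniteDimensional k H] in
theorem l_ne_zero : I.l ≠ 0 := by
  intro h
  have := I.l_L
  rw [h] at this
  simp at this

omit [FiniteDimensional k H] in
theorem L_ne_zero : I.L ≠ 0 := by
  intro h
  have := I.l_L
  rw [h] at this
  simp at this

/-- The modular function: `Λ h = α(h) Λ`. -/
noncomputable def α : Dl k H := (dlEquiv k H).symm (dlEquiv k H I.l ∘ₗ LinearMap.mulLeft k I.L)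

/-- The distinguished group-like element: `λ(x₁) x₂ = λ(x) g`. -/
noncomputable def g : H := lop I.l I.L

theorem L_mul (h : H) : I.L * h = I.α h • I.L := by
  obtain ⟨c, hc⟩ := left_integral_unique I.L_ne_zero I.mul_L (L' := I.L * h) (fun x => by
    rw [← mul_assoc, I.mul_L, smul_mul_assoc])
  have : I.α h = c := by
    change I.l (I.L * h) = c
    rw [hc, map_smul, I.l_L, smul_eq_mul, mul_one]
  rw [this, hc]

theorem α_one : I.α 1 = 1 := by
  change I.l (I.L * 1) = 1
  rw [mul_one, I.l_L]

theorem α_mul (x y : H) : I.α (x * y) = I.α x * I.α y := by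
  change I.l (I.L * (x * y)) = _
  rw [← mul_assoc, I.L_mul, smul_mul_assoc, I.L_mul, map_smul, map_smul, I.l_L]
  simp

theorem α_groupLike : IsGroupLikeElem k I.α :=
  (isGroupLikeElem_dual_iff _).2 ⟨I.α_one, I.α_mul⟩

theorem mul_l (f : Dl k H) : f * I.l = f 1 • I.l := by
  ext x
  rw [← dl_rop, I.rop_l]
  simp [mul_comm]

theorem l_mul (f : Dl k H) : I.l * f = f I.g • I.l := by
  obtain ⟨c, hc⟩ := left_integral_unique (H := Dl k H) (L := I.l) (L' := I.l * f) I.l_ne_zero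
    I.mul_l (fun x => by rw [← mul_assoc, I.mul_l, smul_mul_assoc]; rfl)
  have : f I.g = c := by
    rw [g, dl_lop, hc]
    simp [I.l_L]
  rw [this, hc]

theorem lop_l (x : H) : lop I.l x = I.l x • I.g := by
  apply eq_of_forall_dl (k := k)
  intro f
  rw [dl_lop, I.l_mul]
  simp [mul_comm]

theorem g_groupLike : IsGroupLikeElem k I.g := by
  rw [isGroupLikeElem_iff]
  constructor
  · rw [g, counit_lop, I.l_L]
  · intro f f'
    have h := I.l_mul (f * f')
    rw [← mul_assoc, I.l_mul, smul_mul_assoc, I.l_mul] at h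
    have h2 := congrArg (fun F : Dl k H => F I.L) h
    simpa [I.l_L] using h2.symm

theorem antipode_mul_comul_L (h : H) :
    inl k H (antipode k h) * comul I.L = inr k H h * comul I.L := by
  have h1 : toConv ((inl k H).toLinearMap ∘ₗ antipode k) * toConv (cml k H).toLinearMap =
      toConv (inr k H).toLinearMap := by
    rw [← conv_inl_mul_inr, ← mul_assoc, conv_antipode_comp_algHom, one_mul]
  have h2 := congrArg (fun F : WithConv (H →ₗ[k] H ⊗[k] H) => F.ofConv h) h1
  simp only [(ℛ k h).convMul_apply] at h2
  simp only [LinearMap.comp_apply, AlgHom.toLinearMap_apply, Bialgebra.comulAlgHom_apply] at h2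
  rw [← h2, Finset.sum_mul]
  simp only [mul_assoc, ← Bialgebra.comul_mul, I.mul_L, map_smul, mul_smul_comm]
  simp only [← smul_mul_assoc, ← Finset.sum_mul, ← map_smul, ← map_sum]
  have h3 := rop_apply (ℛ k h) (1 : Dl k H)
  simp only [rop_one, Dl.one_apply] at h3
  rw [← h3]

theorem comul_L_mul (u : H) :
    comul I.L * inl k H u = comul I.L * inr k H (antipode k (lop I.α u)) := by
  have h1 : toConv (cml k H).toLinearMap * toConv ((inr k H).toLinearMap ∘ₗ antipode k) =
      toConv (inl k H).toLinearMap := by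
    rw [← conv_inl_mul_inr, mul_assoc, conv_algHom_comp_antipode, mul_one]
  have h2 := congrArg (fun F : WithConv (H →ₗ[k] H ⊗[k] H) => F.ofConv u) h1
  simp only [(ℛ k u).convMul_apply] at h2
  simp only [LinearMap.comp_apply, AlgHom.toLinearMap_apply, Bialgebra.comulAlgHom_apply] at h2
  rw [← h2, Finset.mul_sum, lop_apply (ℛ k u)]
  simp only [← mul_assoc, ← Bialgebra.comul_mul, I.L_mul, map_smul, smul_mul_assoc]
  simp only [← mul_smul_comm, ← Finset.mul_sum, ← map_smul, ← map_sum]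

theorem evr_inr_mul_comul_L (h : H) : evr I.l (inr k H h * comul I.L) = antipode k h := by
  rw [← I.antipode_mul_comul_L, evr_inl_mul, evr_comul, I.rop_l, I.l_L, one_smul, mul_one]

theorem rop_L_injective {f f' : Dl k H} (h : rop f I.L = rop f' I.L) : f = f' := by
  have key : ∀ f : Dl k H, rop f I.L = 0 → f = 0 := by
    intro f hf
    obtain ⟨y, hy⟩ := cointegral_left_surjective I.rop_l I.l_ne_zero f
    have h1 : rop f I.L = antipode k y := by
      rw [← I.evr_inr_mul_comul_L, rop_apply (ℛ k I.L), ← (ℛ k I.L).eq]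
      simp [Finset.mul_sum, hy]
    rw [hf] at h1
    have h2 : y = 0 := (antipode_bijective k H).1 (by rw [← h1, map_zero])
    ext x
    rw [hy, h2]
    simp
  rw [← sub_eq_zero]
  apply key
  have e : rop (f - f') I.L = rop f I.L - rop f' I.L := by
    simp [rop_apply (ℛ k I.L), sub_smul]
  rw [e, h, sub_self]

/-- The Nakayama automorphism of the left integral. -/
theorem l_mul_comm (x w : H) : I.l (w * x) = I.l (x * sq k H (rop (antipode k I.α) w)) := by
  have h1 : (dlEquiv k H).symm (dlEquiv k H I.l ∘ₗ LinearMap.mulLeft k w) =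
      (dlEquiv k H).symm (dlEquiv k H I.l ∘ₗ
        LinearMap.mulRight k (sq k H (rop (antipode k I.α) w))) := by
    apply I.rop_L_injective
    have e1 : rop ((dlEquiv k H).symm (dlEquiv k H I.l ∘ₗ LinearMap.mulLeft k w)) I.L =
        antipode k w := by
      rw [← I.evr_inr_mul_comul_L, rop_apply (ℛ k I.L), ← (ℛ k I.L).eq]
      simp [Finset.mul_sum]
    have e2 : rop ((dlEquiv k H).symm (dlEquiv k H I.l ∘ₗ
        LinearMap.mulRight k (sq k H (rop (antipode k I.α) w)))) I.L =
        evr I.l (comul I.L * inr k H (sq k H (rop (antipode k I.α) w))) := by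
      rw [rop_apply (ℛ k I.L), ← (ℛ k I.L).eq]
      simp [Finset.sum_mul]
    rw [e1, e2, sq_apply, ← lop_antipode, ← I.comul_L_mul, evr_mul_inl, evr_comul, I.rop_l, I.l_L,
      one_smul, one_mul]
  exact congrArg (fun F : Dl k H => F x) h1

/-- The right integral `λ(· g)`. -/
noncomputable def lr : Dl k H := (dlEquiv k H).symm (dlEquiv k H I.l ∘ₗ LinearMap.mulRight k I.g)

theorem lr_apply (x : H) : I.lr x = I.l (x * I.g) := rfl

theorem lr_L : I.lr I.L = I.α I.g := rfl

theorem lop_lr (x : H) : lop I.lr x = I.lr x • 1 := by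
  have h1 : lop I.lr x * I.g = lop I.l (x * I.g) := by
    rw [← evl_comul I.l, Bialgebra.comul_mul, I.g_groupLike.comul_eq_tmul_self,
      lop_apply (ℛ k x), ← (ℛ k x).eq]
    simp [Finset.sum_mul, lr_apply]
  rw [I.lop_l] at h1
  have h2 := congrArg (fun z => z * antipode k I.g) h1
  simpa [mul_assoc, I.g_groupLike.mul_antipode_cancel, lr_apply] using h2

theorem α_g_ne_zero : I.α I.g ≠ 0 := by
  intro h
  have h1 := I.α_mul I.g (antipode k I.g)
  rw [I.g_groupLike.mul_antipode_cancel, I.α_one, h, zero_mul] at h1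
  exact one_ne_zero h1

theorem evl_inl_mul_comul_L (h : H) :
    evl I.lr (inl k H (antipode k h) * comul I.L) = I.α I.g • h := by
  rw [I.antipode_mul_comul_L, evl_inr_mul, evl_comul, I.lop_lr, I.lr_L, mul_smul_comm, mul_one]

theorem lr_surjective (f : Dl k H) : ∃ y, ∀ x, f x = I.lr (antipode k y * x) := by
  obtain ⟨z, hz⟩ := cointegral_left_surjective I.rop_l I.l_ne_zero
    ((dlEquiv k H).symm (dlEquiv k H f ∘ₗ LinearMap.mulRight k (antipode k I.g)))
  obtain ⟨y, rfl⟩ := (antipode_bijective k H).2 z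
  refine ⟨y, fun x => ?_⟩
  rw [lr_apply, mul_assoc, ← hz]
  change f x = f (x * I.g * antipode k I.g)
  rw [mul_assoc, I.g_groupLike.mul_antipode_cancel, mul_one]

theorem lop_L_injective {f f' : Dl k H} (h : lop f I.L = lop f' I.L) : f = f' := by
  have key : ∀ f : Dl k H, lop f I.L = 0 → f = 0 := by
    intro f hf
    obtain ⟨y, hy⟩ := I.lr_surjective f
    have h1 : lop f I.L = I.α I.g • y := by
      rw [← I.evl_inl_mul_comul_L, lop_apply (ℛ k I.L), ← (ℛ k I.L).eq]
      simp [Finset.mul_sum, hy]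
    rw [hf] at h1
    have h2 : y = 0 := (smul_eq_zero.1 h1.symm).resolve_left I.α_g_ne_zero
    ext x
    rw [hy, h2]
    simp
  rw [← sub_eq_zero]
  apply key
  have e : lop (f - f') I.L = lop f I.L - lop f' I.L := by
    simp [lop_apply (ℛ k I.L), sub_smul]
  rw [e, h, sub_self]

theorem lr_mul_comm (x h : H) : I.lr (x * h) = I.lr (sq k H (lop I.α h) * x) := by
  have h1 : (dlEquiv k H).symm (dlEquiv k H I.lr ∘ₗ LinearMap.mulRight k h) =
      (dlEquiv k H).symm (dlEquiv k H I.lr ∘ₗ LinearMap.mulLeft k (sq k H (lop I.α h))) := by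
    apply I.lop_L_injective
    have e1 : lop ((dlEquiv k H).symm (dlEquiv k H I.lr ∘ₗ LinearMap.mulRight k h)) I.L =
        evl I.lr (comul I.L * inl k H h) := by
      rw [lop_apply (ℛ k I.L), ← (ℛ k I.L).eq]
      simp [Finset.sum_mul]
    have e2 : lop ((dlEquiv k H).symm (dlEquiv k H I.lr ∘ₗ
        LinearMap.mulLeft k (sq k H (lop I.α h)))) I.L =
        evl I.lr (inl k H (sq k H (lop I.α h)) * comul I.L) := by
      rw [lop_apply (ℛ k I.L), ← (ℛ k I.L).eq]
      simp [Finset.mul_sum]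
    rw [e1, e2, sq_apply, I.evl_inl_mul_comul_L, I.comul_L_mul, evl_mul_inr, evl_comul, I.lop_lr,
      I.lr_L, smul_mul_assoc, one_mul]
  exact congrArg (fun F : Dl k H => F x) h1

/-- Radford's formula for the fourth power of the antipode. -/
theorem radford (h : H) :
    I.g * sq k H (rop (antipode k I.α) (sq k H (lop I.α h))) = h * I.g := by
  rw [← sub_eq_zero]
  apply cointegral_right_injective I.rop_l I.l_ne_zero
  intro x
  have h1 := I.lr_mul_comm x h
  rw [I.lr_apply, I.lr_apply, mul_assoc, mul_assoc, I.l_mul_comm (x * I.g), mul_assoc] at h1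
  rw [mul_sub, map_sub, h1, sub_self]

end Integrals

end Finite

section Comul

variable {k H : Type*} [Field k] [Ring H] [HopfAlgebra k H]

theorem comul_lop (a : Dl k H) (h : H) :
    comul (R := k) (lop a h) = TensorProduct.map (lop a) LinearMap.id (comul (R := k) h) := by
  apply tensor_ext_evl
  intro f
  rw [evl_comul, lop_lop, lop_apply (ℛ k h), ← (ℛ k h).eq]
  simp [dl_lop]

end Comul

section TraceFormula

variable {k H : Type*} [Field k] [Ring H] [HopfAlgebra k H] [FiniteDimensional k H]

theorem trace_dl (F : H →ₗ[k] H) (Φ : Dl k H →ₗ[k] Dl k H)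
    (h : ∀ f x, Φ f x = f (F x)) : LinearMap.trace k (Dl k H) Φ = LinearMap.trace k H F := by
  rw [← LinearMap.trace_conj' Φ (dlEquiv k H), ← LinearMap.trace_transpose' F]
  congr 1
  ext f x
  simp only [LinearEquiv.conj_apply, LinearMap.comp_apply, LinearEquiv.coe_coe]
  exact h _ x

theorem Integrals.trace_comp_antipode (I : Integrals k H) (F : H →ₗ[k] H) :
    LinearMap.trace k H (F ∘ₗ antipode k) =
      I.l (LinearMap.mul' k H (TensorProduct.map F LinearMap.id (comul (R := k) I.L))) := by
  let r := ℛ k I.L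
  have h1 : F ∘ₗ antipode k = ∑ i ∈ r.index,
      (dlEquiv k H I.l ∘ₗ LinearMap.mulRight k (r.right i)).smulRight (F (r.left i)) := by
    ext h
    rw [LinearMap.comp_apply, ← I.evr_inr_mul_comul_L, ← r.eq]
    simp [Finset.mul_sum]
  rw [h1, map_sum, ← r.eq]
  simp only [LinearMap.trace_smulRight]
  simp

theorem exists_maschke_complement (I : Integrals k H) (hI : counit (R := k) I.L ≠ 0)
    (m : Submodule H H) : ∃ n, IsCompl m n := by
  have hc : ∀ h : H, inl k H h * TensorProduct.map LinearMap.id (antipode k) (comul I.L) =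
      TensorProduct.map LinearMap.id (antipode k) (comul I.L) * inr k H h := by
    intro h
    obtain ⟨h, rfl⟩ := (antipode_bijective k H).2 h
    have h1 := congrArg (TensorProduct.map LinearMap.id (antipode k)) (I.antipode_mul_comul_L h)
    rw [← (ℛ k I.L).eq] at h1 ⊢
    simpa [Finset.mul_sum, Finset.sum_mul, antipode_mul_antidistrib] using h1
  let m' : Submodule k H := m.restrictScalars k
  obtain ⟨P, hP⟩ := m'.subtype.exists_leftInverse_of_injective
    (LinearMap.ker_eq_bot.2 Subtype.val_injective)
  have hP' : ∀ x (hx : x ∈ m), (P x : H) = x := fun x hx =>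
    congrArg Subtype.val (LinearMap.congr_fun hP ⟨x, hx⟩)
  let A : H → H ⊗[k] H →ₗ[k] H := fun x => TensorProduct.lift
    ((LinearMap.mul k H).compl₂ (m'.subtype ∘ₗ P ∘ₗ LinearMap.mulRight k x))
  have hA : ∀ x s t, A x (s ⊗ₜ t) = s * (P (t * x) : H) := fun x s t => rfl
  have hA1 : ∀ x h t, A x (inl k H h * t) = h * A x t := by
    intro x h t
    induction t with
    | zero => simp
    | add a b ha hb => simp only [mul_add, map_add, ha, hb]
    | tmul f g => simp [hA, mul_assoc]
  have hA2 : ∀ x h t, A x (t * inr k H h) = A (h * x) t := by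
    intro x h t
    induction t with
    | zero => simp
    | add a b ha hb => simp only [add_mul, map_add, ha, hb]
    | tmul f g => simp [hA, mul_assoc]
  have hA3 : ∀ x t, A x t ∈ m := by
    intro x t
    induction t with
    | zero => simp
    | add a b ha hb => rw [map_add]; exact m.add_mem ha hb
    | tmul f g => exact m.smul_mem f (P (g * x)).2
  have hA4 : ∀ x y t, A (x + y) t = A x t + A y t := by
    intro x y t
    induction t with
    | zero => simp
    | add a b ha hb => rw [map_add, ha, hb, map_add, map_add]; abel
    | tmul f g => simp [hA, mul_add]
  have hA5 : ∀ x ∈ m, A x (TensorProduct.map LinearMap.id (antipode k) (comul I.L)) =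
      counit (R := k) I.L • x := by
    intro x hx
    have h1 := sum_mul_antipode_eq_algebraMap_counit (ℛ k I.L)
    rw [← (ℛ k I.L).eq]
    simp only [map_sum, TensorProduct.map_tmul, hA, LinearMap.id_apply]
    have h2 : ∀ y, (P (y * x) : H) = y * x := fun y => hP' _ (m.smul_mem y hx)
    simp only [h2, ← mul_assoc, ← Finset.sum_mul, h1, Algebra.smul_def]
  let q : H →ₗ[H] m :=
    { toFun := fun x => ⟨A x (TensorProduct.map LinearMap.id (antipode k)
        (comul ((counit (R := k) I.L)⁻¹ • I.L))), hA3 _ _⟩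
      map_add' := fun x y => Subtype.ext (hA4 _ _ _)
      map_smul' := fun h x => Subtype.ext (by
        simp only [map_smul, smul_eq_mul, RingHom.id_apply, SetLike.val_smul]
        rw [← hA2, ← hc, hA1, mul_smul_comm]) }
  refine ⟨_, LinearMap.isCompl_of_proj (f := q) ?_⟩
  rintro ⟨x, hx⟩
  apply Subtype.ext
  change A x (TensorProduct.map LinearMap.id (antipode k)
        (comul ((counit (R := k) I.L)⁻¹ • I.L))) = x
  rw [map_smul, map_smul, map_smul, hA5 x hx, smul_smul, inv_mul_cancel₀ hI, one_smul]

theorem Integrals.groupLike_L (I : Integrals k H) (hns : ¬ IsSemisimpleRing H) {γ : Dl k H}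
    (hγ : IsGroupLikeElem k γ) : γ I.L = 0 := by
  have h0 : counit (R := k) I.L = 0 := by
    by_contra h
    apply hns
    have : ComplementedLattice (Submodule H H) := ⟨exists_maschke_complement I h⟩
    exact (isSemisimpleModule_iff H H).2 this
  by_contra h
  have h1 : ∀ x, γ x = counit (R := k) x := by
    intro x
    have h2 := ((isGroupLikeElem_dual_iff γ).1 hγ).2 x I.L
    rw [I.mul_L, map_smul, smul_eq_mul] at h2
    exact (mul_right_cancel₀ h h2).symm
  exact h (by rw [h1, h0])

theorem Integrals.trace_lop (I : Integrals k H) (a : H) (γ : Dl k H) :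
    LinearMap.trace k H ((LinearMap.mulLeft k a ∘ₗ antipode k ∘ₗ lop γ) ∘ₗ antipode k) =
      γ I.L * I.l a := by
  rw [I.trace_comp_antipode]
  have h1 : TensorProduct.map (LinearMap.mulLeft k a ∘ₗ antipode k ∘ₗ lop γ) LinearMap.id
      (comul (R := k) I.L) = TensorProduct.map (LinearMap.mulLeft k a ∘ₗ antipode k) LinearMap.id
      (comul (R := k) (lop γ I.L)) := by
    rw [comul_lop, ← (ℛ k I.L).eq]
    simp
  have h2 := sum_antipode_mul_eq_algebraMap_counit (ℛ k (lop γ I.L))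
  rw [h1, ← (ℛ k (lop γ I.L)).eq]
  simp only [map_sum, TensorProduct.map_tmul, LinearMap.mul'_apply, LinearMap.comp_apply,
    LinearMap.mulLeft_apply, LinearMap.id_apply, mul_assoc]
  rw [← map_sum, ← Finset.mul_sum, h2, counit_lop, Algebra.algebraMap_eq_smul_one, mul_smul_comm,
    map_smul, mul_one, smul_eq_mul]

variable (k H) in
/-- The trace of `L_c ∘ S²` vanishes for every group-like element `c`. -/
def TraceVanish : Prop := ∀ c : H, IsGroupLikeElem k c →
  LinearMap.trace k H (LinearMap.mulLeft k c ∘ₗ sq k H) = 0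

variable (k H) in
theorem traceVanish (hns : ¬ IsSemisimpleRing H) : TraceVanish k H := by
  intro c hc
  obtain ⟨I⟩ := exists_integrals k H
  have h1 := I.trace_lop c 1
  rw [I.groupLike_L hns .one, zero_mul] at h1
  rw [← h1]
  congr 1
  ext x
  simp [lop_one, sq_apply]

/-- The antipode as a linear automorphism. -/
noncomputable def antipodeEquiv (k H : Type*) [Field k] [Ring H] [HopfAlgebra k H]
    [FiniteDimensional k H] : H ≃ₗ[k] H :=
  LinearEquiv.ofBijective (antipode k) (antipode_bijective k H)

theorem trace_eq_of_antipode (F G : H →ₗ[k] H) (h : ∀ x, antipode k (F x) = G (antipode k x)) :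
    LinearMap.trace k H F = LinearMap.trace k H G := by
  rw [← LinearMap.trace_conj' F (antipodeEquiv k H)]
  congr 1
  ext x
  obtain ⟨y, rfl⟩ := (antipodeEquiv k H).surjective x
  simp only [LinearEquiv.conj_apply, LinearMap.comp_apply, LinearEquiv.coe_coe,
    LinearEquiv.symm_apply_apply]
  exact h y

theorem TraceVanish.mulRight (h : TraceVanish k H) {c : H} (hc : IsGroupLikeElem k c) :
    LinearMap.trace k H (LinearMap.mulRight k c ∘ₗ sq k H) = 0 := by
  rw [← h _ hc.antipode]
  apply trace_eq_of_antipode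
  intro x
  simp [antipode_mul_antidistrib, antipode_sq]

variable (k H) in
theorem traceVanish_dual (hns : ¬ IsSemisimpleRing H) : TraceVanish k (Dl k H) := by
  intro β hβ
  obtain ⟨I⟩ := exists_integrals k H
  rw [trace_dl (sq k H ∘ₗ lop β)]
  swap
  · intro f x
    simp only [LinearMap.comp_apply, LinearMap.mulLeft_apply]
    rw [← dl_lop, dual_sq_apply]
  have h1 := I.trace_lop 1 β
  rw [I.groupLike_L hns hβ, zero_mul] at h1
  rw [← h1]
  apply trace_eq_of_antipode
  intro x
  have h2 := rop_antipode (antipode k β) x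
  rw [hβ.antipode_antipode] at h2
  simp only [LinearMap.comp_apply, LinearMap.mulLeft_apply, one_mul]
  rw [lop_antipode, h2, antipode_sq, sq_apply]

end TraceFormula

section RootsOfUnity

open Polynomial

theorem cyclotomic_dvd_of_aeval {K : Type*} [Field K] [CharZero K] {N : ℕ} (hN : 0 < N) {ζ : K}
    (hζ : IsPrimitiveRoot ζ N) {P : ℤ[X]} (hP : aeval ζ P = 0) : cyclotomic N ℤ ∣ P := by
  rw [cyclotomic_eq_minpoly hζ hN]
  exact minpoly.isIntegrallyClosed_dvd (hζ.isIntegral hN) hP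

theorem aeval_eq_zero_of_isPrimitiveRoot {K L : Type*} [Field K] [CharZero K] [Field L]
    {N : ℕ} (hN : 0 < N) {ζ : K} {ω : L}
    (hζ : IsPrimitiveRoot ζ N) (hω : IsPrimitiveRoot ω N) {P : ℤ[X]} (hP : aeval ζ P = 0) :
    aeval ω P = 0 := by
  obtain ⟨Q, rfl⟩ := cyclotomic_dvd_of_aeval hN hζ hP
  have h1 : aeval ω (cyclotomic N ℤ) = 0 := by
    rw [aeval_def, ← eval_map, map_cyclotomic]
    exact hω.isRoot_cyclotomic hN
  rw [map_mul, h1, zero_mul]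

variable {k : Type*} [Field k] [IsAlgClosed k] [CharZero k]

variable (k) in
theorem exists_isPrimitiveRoot {N : ℕ} (hN : 0 < N) : ∃ ζ : k, IsPrimitiveRoot ζ N := by
  have : NeZero N := ⟨hN.ne'⟩
  have : NeZero (N : k) := ⟨by exact_mod_cast hN.ne'⟩
  exact HasEnoughRootsOfUnity.exists_primitiveRoot k N

theorem exists_exponents {N : ℕ} (hN : 0 < N) {ζ : k} (hζ : IsPrimitiveRoot ζ N)
    (r : Multiset k) (hr : ∀ x ∈ r, x ^ N = 1) : ∃ s : Multiset ℕ, r = s.map (ζ ^ ·) := by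
  have h1 : ∀ x : k, ∃ i : ℕ, x ^ N = 1 → ζ ^ i = x := by
    intro x
    by_cases h : x ^ N = 1
    · have : NeZero N := ⟨hN.ne'⟩
      obtain ⟨i, _, hi⟩ := hζ.eq_pow_of_pow_eq_one h
      exact ⟨i, fun _ => hi⟩
    · exact ⟨0, fun h' => absurd h' h⟩
  choose f hf using h1
  refine ⟨r.map f, ?_⟩
  rw [Multiset.map_map]
  conv_lhs => rw [← Multiset.map_id r]
  exact Multiset.map_congr rfl fun x hx => (hf x (hr x hx)).symm

theorem aeval_sum_pow {K : Type*} [Field K] (ζ : K) (s : Multiset ℕ) :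
    aeval ζ ((s.map fun i => (X ^ i : ℤ[X])).sum) = (s.map (ζ ^ ·)).sum := by
  rw [map_multiset_sum, Multiset.map_map]
  simp

theorem sum_inv_eq_zero {N : ℕ} (hN : 0 < N) (r : Multiset k) (hr : ∀ x ∈ r, x ^ N = 1)
    (h : r.sum = 0) : (r.map (·⁻¹)).sum = 0 := by
  obtain ⟨ζ, hζ⟩ := exists_isPrimitiveRoot k hN
  obtain ⟨s, rfl⟩ := exists_exponents hN hζ r hr
  rw [← aeval_sum_pow] at h
  have := aeval_eq_zero_of_isPrimitiveRoot hN hζ hζ.inv h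
  rw [aeval_sum_pow] at this
  rw [Multiset.map_map]
  simpa using this

theorem even_card_of_sum_eq_zero {m : ℕ} (r : Multiset k) (hr : ∀ x ∈ r, x ^ 2 ^ (m + 1) = 1)
    (h : r.sum = 0) : Even r.card := by
  have hN : 0 < 2 ^ (m + 1) := by positivity
  obtain ⟨ζ, hζ⟩ := exists_isPrimitiveRoot k hN
  obtain ⟨s, rfl⟩ := exists_exponents hN hζ r hr
  rw [← aeval_sum_pow] at h
  obtain ⟨Q, hQ⟩ := cyclotomic_dvd_of_aeval hN hζ h
  have h1 := congrArg (eval 1) hQ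
  have : Fact (Nat.Prime 2) := ⟨Nat.prime_two⟩
  rw [eval_mul, eval_one_cyclotomic_prime_pow] at h1
  have h2 : eval 1 ((s.map fun i => (X ^ i : ℤ[X])).sum) = s.card := by
    rw [← coe_evalRingHom, map_multiset_sum, Multiset.map_map]
    simp
  rw [h2] at h1
  rw [Multiset.card_map]
  have h3 : (2 : ℤ) ∣ (s.card : ℤ) := ⟨_, by simpa using h1⟩
  exact even_iff_two_dvd.2 (by exact_mod_cast h3)

theorem eq_one_of_sum_eq_card {N : ℕ} (hN : 0 < N) (r : Multiset k) (hr : ∀ x ∈ r, x ^ N = 1)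
    (h : r.sum = r.card) : ∀ x ∈ r, x = 1 := by
  obtain ⟨ζ, hζ⟩ := exists_isPrimitiveRoot k hN
  obtain ⟨s, rfl⟩ := exists_exponents hN hζ r hr
  have hω := Complex.isPrimitiveRoot_exp N hN.ne'
  set ω := Complex.exp (2 * Real.pi * Complex.I / N) with hωdef
  have h1 : aeval ζ ((s.map fun i => (X ^ i : ℤ[X])).sum - C (s.card : ℤ)) = 0 := by
    rw [map_sub, aeval_sum_pow, h]
    simp
  have h2 := aeval_eq_zero_of_isPrimitiveRoot hN hζ hω h1
  rw [map_sub, aeval_sum_pow] at h2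
  have h3 : (s.map (ω ^ ·)).sum = s.card := by
    rw [← sub_eq_zero, ← h2]
    simp
  have h4 : (s.map fun i => 1 - (ω ^ i).re).sum = 0 := by
    rw [Multiset.sum_map_sub]
    have h5 := congrArg Complex.reAddGroupHom h3
    rw [map_multiset_sum, Multiset.map_map] at h5
    simp only [Function.comp_def, Complex.coe_reAddGroupHom, Complex.natCast_re] at h5
    rw [h5]
    simp
  have hnorm : ∀ i, ‖ω ^ i‖ = 1 := by
    intro i
    rw [norm_pow, hω.norm'_eq_one hN.ne', one_pow]
  have hnn : ∀ x ∈ s.map (fun i => 1 - (ω ^ i).re), 0 ≤ x := by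
    intro x hx
    obtain ⟨i, _, rfl⟩ := Multiset.mem_map.1 hx
    have := Complex.re_le_norm (ω ^ i)
    rw [hnorm] at this
    linarith
  intro x hx
  obtain ⟨i, hi, rfl⟩ := Multiset.mem_map.1 hx
  have h6 := Multiset.all_zero_of_le_zero_le_of_sum_eq_zero hnn h4 _
    (Multiset.mem_map_of_mem (fun i => 1 - (ω ^ i).re) hi)
  have h7 : ω ^ i = 1 := by
    have h8 : (ω ^ i).re = ‖ω ^ i‖ := by rw [hnorm]; linarith
    rw [Complex.re_eq_norm] at h8
    rw [Complex.eq_re_of_ofReal_le h8]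
    have : (ω ^ i).re = 1 := by linarith
    simp [this]
  exact (hζ.pow_eq_one_iff_dvd i).2 ((hω.pow_eq_one_iff_dvd i).1 h7)

section Endomorphism

variable {V : Type*} [AddCommGroup V] [Module k V] [FiniteDimensional k V]

theorem pow_eq_one_of_mem_roots {T : Module.End k V} {N : ℕ} (hT : T ^ N = 1) {x : k}
    (hx : x ∈ T.charpoly.roots) : x ^ N = 1 := by
  have h1 : T.HasEigenvalue x := by
    rw [Module.End.hasEigenvalue_iff_isRoot_charpoly]
    exact isRoot_of_mem_roots hx
  obtain ⟨v, hv⟩ := h1.exists_hasEigenvector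
  have h2 := hv.pow_apply N
  rw [hT, Module.End.one_apply] at h2
  have h3 : (1 - x ^ N) • v = 0 := by rw [sub_smul, one_smul, ← h2, sub_self]
  have h4 := (smul_eq_zero.1 h3).resolve_right hv.2
  exact (sub_eq_zero.1 h4).symm

theorem trace_eq_sum_roots (T : Module.End k V) :
    LinearMap.trace k V T = T.charpoly.roots.sum :=
  Module.End.trace_eq_sum_roots_charpoly_of_splits (IsAlgClosed.splits _)

theorem card_roots_charpoly (T : Module.End k V) :
    T.charpoly.roots.card = Module.finrank k V := by
  rw [← LinearMap.charpoly_natDegree T]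
  exact (IsAlgClosed.splits T.charpoly).natDegree_eq_card_roots.symm

omit [IsAlgClosed k] [FiniteDimensional k V] in
theorem eq_one_of_sub_one_pow {T : Module.End k V} {N : ℕ} (hN : 0 < N) (hT : T ^ N = 1) {m : ℕ}
    (hm : (T - 1) ^ m = 0) : T = 1 := by
  have h1 : minpoly k T ∣ X ^ N - 1 := minpoly.dvd k T (by simp [hT])
  have h2 : minpoly k T ∣ (X - 1) ^ (m + 1) :=
    minpoly.dvd k T (by simp [pow_succ, hm])
  have h3 : Squarefree (minpoly k T) := by
    refine Squarefree.squarefree_of_dvd h1 (Separable.squarefree ?_)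
    exact X_pow_sub_one_separable_iff.2 (by exact_mod_cast hN.ne')
  have h4 : minpoly k T ∣ X - 1 := (h3.dvd_pow_iff_dvd m.succ_ne_zero).1 h2
  have h5 : aeval T (X - 1 : k[X]) = 0 := by
    obtain ⟨Q, hQ⟩ := h4
    rw [hQ, map_mul, minpoly.aeval, zero_mul]
  rw [← sub_eq_zero]
  simpa using h5

theorem eq_one_of_trace_eq_finrank {T : Module.End k V} {N : ℕ} (hN : 0 < N) (hT : T ^ N = 1)
    (h : LinearMap.trace k V T = Module.finrank k V) : T = 1 := by
  rw [trace_eq_sum_roots, ← card_roots_charpoly T] at h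
  have h1 := eq_one_of_sum_eq_card hN _ (fun x => pow_eq_one_of_mem_roots hT) h
  have h2 := (IsAlgClosed.splits T.charpoly).eq_prod_roots_of_monic (LinearMap.charpoly_monic T)
  rw [Multiset.eq_replicate.2 ⟨rfl, h1⟩, Multiset.map_replicate, Multiset.prod_replicate] at h2
  apply eq_one_of_sub_one_pow hN hT
  have h3 := LinearMap.aeval_self_charpoly T
  rw [h2] at h3
  simpa using h3

theorem trace_ne_zero_of_odd_finrank {T : Module.End k V} {m : ℕ} (hT : T ^ 2 ^ (m + 1) = 1)
    (h : Odd (Module.finrank k V)) : LinearMap.trace k V T ≠ 0 := by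
  intro h0
  rw [trace_eq_sum_roots] at h0
  have := even_card_of_sum_eq_zero _ (fun x => pow_eq_one_of_mem_roots hT) h0
  rw [card_roots_charpoly] at this
  exact (Nat.not_even_iff_odd.2 h) this

end Endomorphism

end RootsOfUnity

section FourDim

open Polynomial

variable {k : Type*} [Field k] [IsAlgClosed k] [CharZero k]
variable {V : Type*} [AddCommGroup V] [Module k V] [FiniteDimensional k V]

theorem charpoly_of_trace_eq_zero (hV : Module.finrank k V = 4) {T : Module.End k V} {N : ℕ}
    (hN : 0 < N) (hT : T ^ N = 1) (htr : LinearMap.trace k V T = 0) {v : V} (hv : v ≠ 0)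
    (hTv : T v = v) : ∃ q : k, q ^ N = 1 ∧
      T.charpoly = (X - C 1) * (X - C (-1)) * (X ^ 2 - C q) := by
  have hcard := card_roots_charpoly T
  rw [hV] at hcard
  have hroot := fun x => pow_eq_one_of_mem_roots hT (x := x)
  rw [trace_eq_sum_roots] at htr
  have hprod := (IsAlgClosed.splits T.charpoly).eq_prod_roots_of_monic
    (LinearMap.charpoly_monic T)
  have hinv := sum_inv_eq_zero hN _ hroot htr
  have h1 : (1 : k) ∈ T.charpoly.roots := by
    rw [mem_roots (LinearMap.charpoly_monic T).ne_zero,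
      ← Module.End.hasEigenvalue_iff_isRoot_charpoly]
    exact Module.End.hasEigenvalue_of_hasEigenvector (x := v)
      ⟨by rw [Module.End.mem_eigenspace_iff, hTv, one_smul], hv⟩
  obtain ⟨r, hr⟩ := Multiset.exists_cons_of_mem h1
  rw [hr] at hcard hroot htr hprod hinv
  rw [Multiset.card_cons] at hcard
  obtain ⟨b, c, d, rfl⟩ := Multiset.card_eq_three.1 (Nat.succ.inj hcard)
  have hb : b ^ N = 1 := hroot b (by simp)
  have hc : c ^ N = 1 := hroot c (by simp)
  have hd : d ^ N = 1 := hroot d (by simp)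
  have hne : ∀ x : k, x ^ N = 1 → x ≠ 0 := by
    rintro x hx rfl
    rw [zero_pow hN.ne'] at hx
    exact zero_ne_one hx
  have hb0 := hne b hb
  have hc0 := hne c hc
  have hd0 := hne d hd
  have e1 : 1 + b + c + d = 0 := by
    simp at htr
    rw [← htr]
    ring
  have e2 : b * c * d + c * d + b * d + b * c = 0 := by
    have : 1 + b⁻¹ + c⁻¹ + d⁻¹ = 0 := by
      simp at hinv
      rw [← hinv]
      ring
    field_simp at this
    linear_combination this
  refine ⟨b * c * d, by rw [mul_pow, mul_pow, hb, hc, hd]; ring, ?_⟩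
  have hC1 : (1 : k[X]) + C b + C c + C d = 0 := by
    rw [← C_1, ← C_add, ← C_add, ← C_add, e1, C_0]
  have hC2 : C b * C c * C d + C c * C d + C b * C d + C b * C c = 0 := by
    simp only [← C_mul, ← C_add]
    rw [e2, C_0]
  rw [hprod]
  simp only [Multiset.insert_eq_cons, Multiset.map_cons, Multiset.prod_cons,
    Multiset.map_singleton, Multiset.prod_singleton]
  simp only [C_neg, C_1, C_mul]
  linear_combination (X - 1) * X * hC2 - (X - 1) * X ^ 2 * hC1

theorem sq_sq_eq (q : k) {T : Module.End k V}
    (hq : T.charpoly = (X - C 1) * (X - C (-1)) * (X ^ 2 - C q)) (x : V) :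
    T (T (T (T x))) - q • T (T x) - T (T x) + q • x = 0 := by
  have h := LinearMap.aeval_self_charpoly T
  rw [hq] at h
  have h2 := LinearMap.congr_fun h x
  simp [pow_two] at h2
  rw [← h2]
  module

theorem exists_neg_eigenvector (q : k) {T : Module.End k V}
    (hq : T.charpoly = (X - C 1) * (X - C (-1)) * (X ^ 2 - C q)) : ∃ y ≠ 0, T y = -y := by
  have h : T.HasEigenvalue (-1) := by
    rw [Module.End.hasEigenvalue_iff_isRoot_charpoly, hq]
    simp
  obtain ⟨y, hy⟩ := h.exists_hasEigenvector
  exact ⟨y, hy.2, by rw [hy.apply_eq_smul]; simp⟩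

theorem finrank_eigenspace_le (T : Module.End k V) (μ : k) :
    Module.finrank k (T.eigenspace μ) ≤ T.charpoly.rootMultiplicity μ := by
  rw [← LinearMap.finrank_maxGenEigenspace_eq]
  apply Submodule.finrank_mono
  exact (T.genEigenspace μ).monotone le_top

theorem exists_smul_of_rootMultiplicity_le_one {T : Module.End k V} {μ : k}
    (h : T.charpoly.rootMultiplicity μ ≤ 1) {v w : V} (hv : v ≠ 0) (hTv : T v = μ • v)
    (hTw : T w = μ • w) : ∃ c : k, w = c • v := by
  have h1 := (finrank_eigenspace_le T μ).trans h
  have h2 := finrank_le_one_iff.1 h1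
  have hv' : v ∈ T.eigenspace μ := Module.End.mem_eigenspace_iff.2 hTv
  have hw' : w ∈ T.eigenspace μ := Module.End.mem_eigenspace_iff.2 hTw
  obtain ⟨⟨u, hu⟩, hu2⟩ := h2
  obtain ⟨c, hc⟩ := hu2 ⟨v, hv'⟩
  obtain ⟨d, hd⟩ := hu2 ⟨w, hw'⟩
  have hc' : c • u = v := congrArg Subtype.val hc
  have hd' : d • u = w := congrArg Subtype.val hd
  have hc0 : c ≠ 0 := by
    rintro rfl
    exact hv (by rw [← hc', zero_smul])
  refine ⟨d / c, ?_⟩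
  rw [← hc', ← hd', smul_smul, div_mul_cancel₀ _ hc0]

theorem rootMultiplicity_le_one {q μ : k} (hq1 : q ≠ 1) (hμ : μ = 1 ∨ μ = -1) :
    ((X - C 1) * (X - C (-1)) * (X ^ 2 - C q) : k[X]).rootMultiplicity μ ≤ 1 := by
  classical
  have h0 : ((X - C 1) * (X - C (-1)) * (X ^ 2 - C q) : k[X]) ≠ 0 := by
    have : (X ^ 2 - C q : k[X]) ≠ 0 := X_pow_sub_C_ne_zero (by norm_num) q
    exact mul_ne_zero (mul_ne_zero (X_sub_C_ne_zero _) (X_sub_C_ne_zero _)) this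
  have h2 : (2 : k) ≠ 0 := two_ne_zero
  have h3 : (1 : k) ≠ -1 := by
    intro h
    apply h2
    linear_combination h
  have h4 : (X ^ 2 - C q : k[X]).rootMultiplicity μ = 0 := by
    apply rootMultiplicity_eq_zero
    intro h
    apply hq1
    have : μ ^ 2 - q = 0 := by simpa using h
    rcases hμ with rfl | rfl <;> linear_combination -this
  rw [rootMultiplicity_mul h0, rootMultiplicity_mul (left_ne_zero_of_mul h0), h4,
    rootMultiplicity_X_sub_C, rootMultiplicity_X_sub_C]
  rcases hμ with rfl | rfl
  · simp [h3]
  · simp [h3.symm]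

theorem rootMultiplicity_one_le_two :
    ((X - C 1) * (X - C (-1)) * (X ^ 2 - C 1) : k[X]).rootMultiplicity 1 ≤ 2 := by
  have e : ((X - C 1) * (X - C (-1)) * (X ^ 2 - C 1) : k[X]) =
      (X - C 1) ^ 2 * (X - C (-1)) ^ 2 := by
    simp only [C_neg, C_1]
    ring
  have h2 : (2 : k) ≠ 0 := two_ne_zero
  have h3 : (1 : k) ≠ -1 := by
    intro h
    apply h2
    linear_combination h
  have h0 : ((X - C 1) ^ 2 * (X - C (-1)) ^ 2 : k[X]) ≠ 0 :=
    mul_ne_zero (pow_ne_zero _ (X_sub_C_ne_zero _)) (pow_ne_zero _ (X_sub_C_ne_zero _))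
  rw [e, rootMultiplicity_mul h0, rootMultiplicity_X_sub_C_pow]
  have h4 : ((X - C (-1)) ^ 2 : k[X]).rootMultiplicity 1 = 0 := by
    apply rootMultiplicity_eq_zero
    intro h
    have : (1 + 1 : k) ^ 2 = 0 := by simpa using h
    have h5 : (1 + 1 : k) = 0 := by simpa using this
    apply h2
    linear_combination h5
  rw [h4]

/-- An operator of finite order and trace zero on a four-dimensional space with a nonzero fixed
vector `v`. -/
theorem four_dim_trace_zero (hV : Module.finrank k V = 4) {T : Module.End k V} {N : ℕ}
    (hN : 0 < N) (hT : T ^ N = 1) (htr : LinearMap.trace k V T = 0) {v : V} (hv : v ≠ 0)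
    (hTv : T v = v) : ∃ q : k, q ≠ 0 ∧ (∃ y ≠ 0, T y = -y) ∧
      (∀ x, T (T (T (T x))) - q • T (T x) - T (T x) + q • x = 0) ∧
      (q ≠ 1 → ∀ x, T x = x → ∃ c : k, x = c • v) ∧
      (q ≠ 1 → ∀ y z, y ≠ 0 → T y = -y → T z = -z → ∃ c : k, z = c • y) ∧
      (q = 1 → Module.finrank k (T.eigenspace 1) ≤ 2 ∧ ∀ x, T (T x) = x) := by
  obtain ⟨q, hqN, hq⟩ := charpoly_of_trace_eq_zero hV hN hT htr hv hTv
  refine ⟨q, ?_, exists_neg_eigenvector q hq, sq_sq_eq q hq, ?_, ?_, ?_⟩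
  · rintro rfl
    rw [zero_pow hN.ne'] at hqN
    exact zero_ne_one hqN
  · intro hq1 x hx
    refine exists_smul_of_rootMultiplicity_le_one (T := T) (μ := 1) ?_ hv (by simpa) (by simpa)
    rw [hq]
    exact rootMultiplicity_le_one hq1 (Or.inl rfl)
  · intro hq1 y z hy hTy hTz
    refine exists_smul_of_rootMultiplicity_le_one (T := T) (μ := -1) ?_ hy (by simpa) (by simpa)
    rw [hq]
    exact rootMultiplicity_le_one hq1 (Or.inr rfl)
  · rintro rfl
    constructor
    · refine (finrank_eigenspace_le T 1).trans ?_
      rw [hq]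
      exact rootMultiplicity_one_le_two
    · have h1 : (T ^ 2) ^ N = 1 := by rw [← pow_mul, mul_comm, pow_mul, hT, one_pow]
      have h2 : (T ^ 2 - 1) ^ 2 = 0 := by
        ext x
        have := sq_sq_eq 1 hq x
        simp only [pow_two, LinearMap.sub_apply, Module.End.mul_apply, Module.End.one_apply,
          map_sub, LinearMap.zero_apply]
        rw [← this]
        module
      have h3 := eq_one_of_sub_one_pow hN h1 h2
      intro x
      have := LinearMap.congr_fun h3 x
      simpa [pow_two] using this

end FourDim

section Projection

variable {k V : Type*} [Field k] [AddCommGroup V] [Module k V] [FiniteDimensional k V]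

theorem finrank_range_of_idem {P : V →ₗ[k] V} (hP : ∀ x, P (P x) = P x) :
    (Module.finrank k (LinearMap.range P) : k) = LinearMap.trace k V P := by
  have h : IsIdempotentElem P := LinearMap.ext hP
  exact (LinearMap.IsIdempotentElem.isProj_range P h).trace.symm

theorem mem_range_of_idem {P : V →ₗ[k] V} (hP : ∀ x, P (P x) = P x) {x : V} :
    x ∈ LinearMap.range P ↔ P x = x :=
  ⟨by rintro ⟨y, rfl⟩; exact hP y, fun h => ⟨x, h⟩⟩

theorem mapsTo_range_of_comm {P T : V →ₗ[k] V} (hPT : ∀ x, P (T x) = T (P x)) :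
    ∀ x ∈ LinearMap.range P, T x ∈ LinearMap.range P := by
  rintro _ ⟨y, rfl⟩
  exact ⟨T y, hPT y⟩

theorem trace_restrict_of_idem {P T : V →ₗ[k] V} (hP : ∀ x, P (P x) = P x)
    (hPT : ∀ x, P (T x) = T (P x)) :
    LinearMap.trace k (LinearMap.range P) (T.restrict (mapsTo_range_of_comm hPT)) =
      LinearMap.trace k V (P ∘ₗ T) := by
  have hm : ∀ x, (P ∘ₗ T) x ∈ LinearMap.range P := fun x => LinearMap.mem_range_self P (T x)
  rw [← LinearMap.trace_restrict_eq_of_forall_mem (LinearMap.range P) (P ∘ₗ T) hm]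
  congr 1
  ext ⟨x, hx⟩
  simp only [LinearMap.coe_restrict_apply, LinearMap.comp_apply]
  rw [hPT, (mem_range_of_idem hP).1 hx]

theorem restrict_pow_eq_one {W : Submodule k V} {T : Module.End k V} (h : ∀ x ∈ W, T x ∈ W)
    {N : ℕ} (hT : ∀ x ∈ W, (T ^ N) x = x) : (T.restrict h : Module.End k W) ^ N = 1 := by
  rw [Module.End.pow_restrict]
  ext ⟨x, hx⟩
  exact hT x hx

end Projection

section Trace

variable {k H : Type*} [Field k] [Ring H] [HopfAlgebra k H] [FiniteDimensional k H]

variable (k H) in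
/-- The map `x ⊗ m ↦ Δ(m) (1 ⊗ x)`. -/
noncomputable def galois : H ⊗[k] H →ₗ[k] H ⊗[k] H :=
  LinearMap.mul' k (H ⊗[k] H) ∘ₗ
    TensorProduct.map (cml k H).toLinearMap (inr k H).toLinearMap ∘ₗ
      (TensorProduct.comm k H H).toLinearMap

theorem galois_tmul (x m : H) : galois k H (x ⊗ₜ m) = comul m * inr k H x := rfl

theorem galois_surjective : Function.Surjective (galois k H) := by
  rw [← LinearMap.range_eq_top, eq_top_iff]
  rintro t -
  induction t with
  | zero => exact zero_mem _
  | add a b ha hb => exact add_mem ha hb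
  | tmul u z =>
    have h1 : toConv (cml k H).toLinearMap * toConv ((inr k H).toLinearMap ∘ₗ antipode k) =
        toConv (inl k H).toLinearMap := by
      rw [← conv_inl_mul_inr, mul_assoc, conv_algHom_comp_antipode, mul_one]
    have h2 := congrArg (fun F : WithConv (H →ₗ[k] H ⊗[k] H) => F.ofConv u) h1
    simp only [(ℛ k u).convMul_apply] at h2
    simp only [LinearMap.comp_apply, AlgHom.toLinearMap_apply, Bialgebra.comulAlgHom_apply] at h2
    have h3 : u ⊗ₜ[k] z = inl k H u * inr k H z := by simp [inl, inr]
    rw [h3, ← h2, Finset.sum_mul]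
    refine sum_mem fun i _ => ⟨(antipode k ((ℛ k u).right i) * z) ⊗ₜ (ℛ k u).left i, ?_⟩
    rw [galois_tmul, map_mul, mul_assoc]

theorem galois_intertwine {c : H} (hc : IsGroupLikeElem k c) (a : Dl k H) (t : H ⊗[k] H) :
    galois k H (TensorProduct.map LinearMap.id (LinearMap.mulLeft k c ∘ₗ lop a) t) =
      TensorProduct.map (LinearMap.mulLeft k c ∘ₗ lop a) (LinearMap.mulLeft k c)
        (galois k H t) := by
  induction t with
  | zero => simp
  | add a b ha hb => simp only [map_add, ha, hb]
  | tmul x m =>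
    simp only [TensorProduct.map_tmul, LinearMap.id_apply, LinearMap.comp_apply,
      LinearMap.mulLeft_apply, galois_tmul, Bialgebra.comul_mul, hc.comul_eq_tmul_self, comul_lop]
    rw [← (ℛ k m).eq]
    simp [inr, Finset.mul_sum, Finset.sum_mul, mul_assoc]

theorem trace_mulLeft_lop_mul {c : H} (hc : IsGroupLikeElem k c) (a : Dl k H) :
    (Module.finrank k H : k) * LinearMap.trace k H (LinearMap.mulLeft k c ∘ₗ lop a) =
      LinearMap.trace k H (LinearMap.mulLeft k c ∘ₗ lop a) *
        LinearMap.trace k H (LinearMap.mulLeft k c) := by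
  have hbij : Function.Bijective (galois k H) :=
    ⟨LinearMap.injective_iff_surjective.2 galois_surjective, galois_surjective⟩
  rw [← LinearMap.trace_tensorProduct', ← LinearMap.trace_id, ← LinearMap.trace_tensorProduct',
    ← LinearMap.trace_conj' _ (LinearEquiv.ofBijective (galois k H) hbij)]
  congr 1
  apply LinearMap.ext
  intro t
  obtain ⟨s, rfl⟩ := (LinearEquiv.ofBijective (galois k H) hbij).surjective t
  simp only [LinearEquiv.conj_apply, LinearMap.comp_apply, LinearEquiv.coe_coe,
    LinearEquiv.symm_apply_apply]
  exact galois_intertwine hc a s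

instance : Finite (GroupLike k H) :=
  (linearIndep_groupLikeVal (R := k) (A := H)).finite_of_isNoetherian

theorem exists_pow_eq_one {c : H} (hc : IsGroupLikeElem k c) : ∃ N, 0 < N ∧ c ^ N = 1 := by
  have h := isOfFinOrder_of_finite (⟨c, hc⟩ : GroupLike k H)
  rw [isOfFinOrder_iff_pow_eq_one] at h
  obtain ⟨N, hN, h⟩ := h
  exact ⟨N, hN, by simpa using congrArg GroupLike.val h⟩

variable [IsAlgClosed k] [CharZero k]

theorem eq_one_of_trace_mulLeft {c : H} (hc : IsGroupLikeElem k c)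
    (h : LinearMap.trace k H (LinearMap.mulLeft k c) = Module.finrank k H) : c = 1 := by
  obtain ⟨N, hN, hcN⟩ := exists_pow_eq_one hc
  have h1 := eq_one_of_trace_eq_finrank hN
    (T := LinearMap.mulLeft k c) (by rw [LinearMap.pow_mulLeft, hcN, LinearMap.mulLeft_one]; rfl) h
  simpa using LinearMap.congr_fun h1 (1 : H)

theorem trace_mulLeft_lop {c : H} (hc : IsGroupLikeElem k c) (hc1 : c ≠ 1) (a : Dl k H) :
    LinearMap.trace k H (LinearMap.mulLeft k c ∘ₗ lop a) = 0 := by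
  by_contra h
  have h1 := trace_mulLeft_lop_mul hc a
  rw [mul_comm] at h1
  exact hc1 (eq_one_of_trace_mulLeft hc (mul_left_cancel₀ h h1).symm)

theorem trace_mulLeft {c : H} (hc : IsGroupLikeElem k c) (hc1 : c ≠ 1) :
    LinearMap.trace k H (LinearMap.mulLeft k c) = 0 := by
  rw [← trace_mulLeft_lop hc hc1 1]
  congr 1
  ext x
  simp [lop_one]

end Trace

section Average

variable {k H : Type*} [Field k] [Ring H] [HopfAlgebra k H] [FiniteDimensional k H]
variable [IsAlgClosed k] [CharZero k]

open Classical in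
/-- The average of a group of group-like elements. -/
noncomputable def avg (K : Subgroup (GroupLike k H)) : H :=
  letI := Fintype.ofFinite K
  (Nat.card K : k)⁻¹ • ∑ c : K, c.val.val

variable (K : Subgroup (GroupLike k H))

theorem card_ne_zero : (Nat.card K : k) ≠ 0 := Nat.cast_ne_zero.2 Nat.card_pos.ne'

variable {K} in
theorem mul_avg {c : GroupLike k H} (hc : c ∈ K) : c.val * avg K = avg K := by
  let _ := Fintype.ofFinite K
  rw [avg, mul_smul_comm, Finset.mul_sum]
  congr 1
  refine Fintype.sum_equiv (Equiv.mulLeft (⟨c, hc⟩ : K)) _ _ ?_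
  intro x
  simp

variable {K} in
theorem avg_mul {c : GroupLike k H} (hc : c ∈ K) : avg K * c.val = avg K := by
  let _ := Fintype.ofFinite K
  rw [avg, smul_mul_assoc, Finset.sum_mul]
  congr 1
  refine Fintype.sum_equiv (Equiv.mulRight (⟨c, hc⟩ : K)) _ _ ?_
  intro x
  simp

theorem mul_avg_eq_of_forall {x : H} (h : ∀ c ∈ K, x * GroupLike.val c = x) : x * avg K = x := by
  let _ := Fintype.ofFinite K
  rw [avg, mul_smul_comm, Finset.mul_sum, Finset.sum_congr rfl (fun c _ => h c.val c.2)]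
  simp only [Finset.sum_const, Finset.card_univ, ← Nat.card_eq_fintype_card]
  rw [← Nat.cast_smul_eq_nsmul k, smul_smul, inv_mul_cancel₀ (card_ne_zero K), one_smul]

theorem avg_idem : avg K * avg K = avg K :=
  mul_avg_eq_of_forall K fun _ hc => avg_mul hc

theorem counit_avg : counit (R := k) (avg K) = 1 := by
  let _ := Fintype.ofFinite K
  simp only [avg, map_smul, map_sum, GroupLike.isGroupLikeElem_val, IsGroupLikeElem.counit_eq_one]
  simp only [Finset.sum_const, Finset.card_univ, ← Nat.card_eq_fintype_card]
  rw [nsmul_eq_mul, mul_one, smul_eq_mul, inv_mul_cancel₀ (card_ne_zero K)]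

theorem antipode_avg : antipode k (avg K) = avg K := by
  let _ := Fintype.ofFinite K
  simp only [avg, map_smul, map_sum]
  congr 1
  refine Fintype.sum_equiv (Equiv.inv K) _ _ ?_
  intro x
  simp

theorem sq_avg : sq k H (avg K) = avg K := by
  rw [sq_apply, antipode_avg, antipode_avg]

theorem trace_mulLeft_avg :
    LinearMap.trace k H (LinearMap.mulLeft k (avg K)) =
      (Nat.card K : k)⁻¹ * Module.finrank k H := by
  let _ := Fintype.ofFinite K
  have h : LinearMap.mulLeft k (avg K) =
      (Nat.card K : k)⁻¹ • ∑ c : K, LinearMap.mulLeft k c.val.val := by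
    ext x
    simp [avg, Finset.sum_mul]
  rw [h, map_smul, map_sum, Finset.sum_eq_single 1]
  · simp [LinearMap.trace_id]
  · intro c _ hc
    apply trace_mulLeft c.val.isGroupLikeElem_val
    intro h1
    apply hc
    apply Subtype.ext
    apply GroupLike.val_injective
    simpa using h1
  · simp

theorem trace_mulLeft_avg_sq (hT : TraceVanish k H) :
    LinearMap.trace k H (LinearMap.mulLeft k (avg K) ∘ₗ sq k H) = 0 := by
  let _ := Fintype.ofFinite K
  have h : LinearMap.mulLeft k (avg K) ∘ₗ sq k H =
      (Nat.card K : k)⁻¹ • ∑ c : K, LinearMap.mulLeft k c.val.val ∘ₗ sq k H := by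
    ext x
    simp [avg, Finset.sum_mul]
  rw [h, map_smul, map_sum, Finset.sum_eq_zero, smul_zero]
  intro c _
  exact hT _ c.val.isGroupLikeElem_val

theorem avg_mul_avg_mul (x : H) : LinearMap.mulLeft k (avg K) (LinearMap.mulLeft k (avg K) x) =
    LinearMap.mulLeft k (avg K) x := by
  simp [← mul_assoc, avg_idem]

theorem avg_mul_sq (x : H) : LinearMap.mulLeft k (avg K) (sq k H x) =
    sq k H (LinearMap.mulLeft k (avg K) x) := by
  simp [sq_mul, sq_avg]

theorem card_mul_finrank_range_avg :
    Nat.card K * Module.finrank k (LinearMap.range (LinearMap.mulLeft k (avg K))) =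
      Module.finrank k H := by
  have h := finrank_range_of_idem (avg_mul_avg_mul K)
  rw [trace_mulLeft_avg] at h
  have : (Nat.card K : k) * Module.finrank k (LinearMap.range (LinearMap.mulLeft k (avg K))) =
      Module.finrank k H := by
    rw [h, mul_inv_cancel_left₀ (card_ne_zero K)]
  exact_mod_cast this

theorem card_dvd_finrank : Nat.card K ∣ Module.finrank k H :=
  Dvd.intro _ (card_mul_finrank_range_avg K)

end Average

section Cyclic

variable {k H : Type*} [Field k] [Ring H] [HopfAlgebra k H]

/-- `e` is the average of the powers of the element `c` of order dividing `p`. -/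
structure CyclicAverage (k : Type*) {H : Type*} [Field k] [Ring H] [HopfAlgebra k H]
    (p : ℕ) (c e : H) : Prop where
  mul_e : c * e = e
  e_mul : e * c = e
  mul_e_of {x : H} : x * c = x → x * e = x
  e_mul_of {x : H} : c * x = x → e * x = x
  antipode_e : antipode k e = e
  counit_e : counit (R := k) e = 1
  smul_e : (p : k) • e = ∑ j ∈ Finset.range p, c ^ j

theorem CyclicAverage.idem {p : ℕ} {c e : H} (h : CyclicAverage k p c e) : e * e = e :=
  h.mul_e_of h.e_mul

theorem CyclicAverage.sq_e {p : ℕ} {c e : H} (h : CyclicAverage k p c e) : sq k H e = e := by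
  rw [sq_apply, h.antipode_e, h.antipode_e]

variable [FiniteDimensional k H] [IsAlgClosed k] [CharZero k]

theorem exists_cyclicAverage {p : ℕ} (hp : p.Prime) {c : H} (hc : IsGroupLikeElem k c)
    (hcp : c ^ p = 1) (hc1 : c ≠ 1) : ∃ e : H, CyclicAverage k p c e ∧
      LinearMap.trace k H (LinearMap.mulLeft k e) = (p : k)⁻¹ * Module.finrank k H ∧
      p * Module.finrank k (LinearMap.range (LinearMap.mulLeft k e)) = Module.finrank k H ∧
      (TraceVanish k H → LinearMap.trace k H (LinearMap.mulLeft k e ∘ₗ sq k H) = 0) := by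
  let c' : GroupLike k H := ⟨c, hc⟩
  have hord : orderOf c' = p := by
    have h1 : orderOf c' ∣ p := orderOf_dvd_of_pow_eq_one (GroupLike.val_injective (by simpa using hcp))
    rcases (Nat.dvd_prime hp).1 h1 with h | h
    · exact absurd (congrArg GroupLike.val (orderOf_eq_one_iff.1 h)) (by simpa using hc1)
    · exact h
  have hcard : Nat.card (Subgroup.zpowers c') = p := by rw [Nat.card_zpowers, hord]
  have hmem : c' ∈ Subgroup.zpowers c' := Subgroup.mem_zpowers c'
  have h1 : ∀ x : H, x * c = x → x * avg (Subgroup.zpowers c') = x := by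
    intro x hx
    apply mul_avg_eq_of_forall
    intro d hd
    rw [← mem_powers_iff_mem_zpowers] at hd
    obtain ⟨n, rfl⟩ := hd
    have : ∀ n : ℕ, x * c ^ n = x := by
      intro n
      induction n with
      | zero => simp
      | succ n ih => rw [pow_succ, ← mul_assoc, ih, hx]
    simpa using this n
  have hS := antipode_avg (Subgroup.zpowers c')
  refine ⟨avg (Subgroup.zpowers c'), ⟨mul_avg hmem, avg_mul hmem, fun {x} => h1 x, ?_, hS,
    counit_avg _, ?_⟩, ?_, ?_, trace_mulLeft_avg_sq _⟩
  · intro x hx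
    have h2 : antipode k x * c = antipode k x := by
      nth_rewrite 1 [← hx]
      rw [antipode_mul_antidistrib, mul_assoc, hc.antipode_mul_cancel, mul_one]
    have h3 := h1 _ h2
    nth_rewrite 1 [← hS] at h3
    rw [← antipode_mul_antidistrib] at h3
    exact (antipode_bijective k H).1 h3
  · have h2 : (∑ j ∈ Finset.range p, c ^ j) * c = ∑ j ∈ Finset.range p, c ^ j := by
      have := Finset.sum_range_succ (fun j => c ^ j) p
      rw [Finset.sum_range_succ', hcp, pow_zero] at this
      rw [Finset.sum_mul]
      simpa [pow_succ] using this
    rw [← h1 _ h2, Finset.sum_mul]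
    have h3 : ∀ n : ℕ, c ^ n * avg (Subgroup.zpowers c') = avg (Subgroup.zpowers c') := by
      intro n
      induction n with
      | zero => simp
      | succ n ih =>
        rw [pow_succ, mul_assoc]
        have : c * avg (Subgroup.zpowers c') = _ := mul_avg hmem
        rw [this, ih]
    simp [h3, Nat.cast_smul_eq_nsmul]
  · rw [trace_mulLeft_avg, hcard]
  · have := card_mul_finrank_range_avg (Subgroup.zpowers c')
    rwa [hcard] at this

theorem exists_average_of_finrank {p : ℕ} (hp : p.Prime) (hdim : Module.finrank k H = 4 * p)
    {c : H} (hc : IsGroupLikeElem k c) (hcp : c ^ p = 1) (hc1 : c ≠ 1) :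
    ∃ e : H, CyclicAverage k p c e ∧ LinearMap.trace k H (LinearMap.mulLeft k e) = 4 ∧
      Module.finrank k (LinearMap.range (LinearMap.mulLeft k e)) = 4 ∧
      (TraceVanish k H → LinearMap.trace k H (LinearMap.mulLeft k e ∘ₗ sq k H) = 0) := by
  obtain ⟨e, he, h1, h2, h3⟩ := exists_cyclicAverage hp hc hcp hc1
  refine ⟨e, he, ?_, ?_, h3⟩
  · have : (p : k) ≠ 0 := Nat.cast_ne_zero.2 hp.ne_zero
    rw [h1, hdim]
    push_cast
    field_simp
  · rw [hdim, mul_comm 4 p] at h2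
    exact Nat.eq_of_mul_eq_mul_left hp.pos h2

end Cyclic

section Idempotent

variable {k V : Type*} [Field k] [IsAlgClosed k] [CharZero k] [AddCommGroup V] [Module k V]
  [FiniteDimensional k V]

/-- `four_dim_trace_zero` for the image of a projection `P` commuting with `T`. -/
theorem four_dim_of_idem {P T : Module.End k V} (hP : ∀ x, P (P x) = P x)
    (hPT : ∀ x, P (T x) = T (P x)) (hdim : Module.finrank k (LinearMap.range P) = 4)
    (htr : LinearMap.trace k V (P ∘ₗ T) = 0) {N : ℕ} (hN : 0 < N) (hT : T ^ N = 1)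
    {v : V} (hv : v ≠ 0) (hPv : P v = v) (hTv : T v = v) : ∃ q : k, q ≠ 0 ∧
      (∃ y ≠ 0, P y = y ∧ T y = -y) ∧
      (∀ x, P x = x → T (T (T (T x))) - q • T (T x) - T (T x) + q • x = 0) ∧
      (q ≠ 1 → ∀ x, P x = x → T x = x → ∃ c : k, x = c • v) ∧
      (q ≠ 1 → ∀ y z, P y = y → P z = z → y ≠ 0 → T y = -y → T z = -z → ∃ c : k, z = c • y) ∧
      (q = 1 → (∀ x, P x = x → T (T x) = x) ∧ ∀ w, P w = w → T w = w → (∀ c : k, w ≠ c • v) →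
        ∀ x, P x = x → T x = x → ∃ s t : k, x = s • v + t • w) := by
  have hmem := fun {x} => mem_range_of_idem hP (x := x)
  rw [← trace_restrict_of_idem hP hPT] at htr
  obtain ⟨q, h0, ⟨y, hy0, hy⟩, h1, h2, h3, h4⟩ := four_dim_trace_zero hdim hN
    (restrict_pow_eq_one (mapsTo_range_of_comm hPT) fun x _ => by rw [hT]; rfl) htr
    (v := ⟨v, hmem.2 hPv⟩) (by simpa [Subtype.ext_iff] using hv) (Subtype.ext hTv)
  refine ⟨q, h0, ⟨y, by simpa using hy0, hmem.1 y.2, congrArg Subtype.val hy⟩, ?_, ?_, ?_, ?_⟩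
  · intro x hx
    exact congrArg Subtype.val (h1 ⟨x, hmem.2 hx⟩)
  · intro hq x hx hTx
    obtain ⟨c, hc⟩ := h2 hq ⟨x, hmem.2 hx⟩ (Subtype.ext hTx)
    exact ⟨c, congrArg Subtype.val hc⟩
  · intro hq y z hy hz hy0 hTy hTz
    obtain ⟨c, hc⟩ := h3 hq ⟨y, hmem.2 hy⟩ ⟨z, hmem.2 hz⟩ (by simpa [Subtype.ext_iff] using hy0)
      (Subtype.ext hTy) (Subtype.ext hTz)
    exact ⟨c, congrArg Subtype.val hc⟩
  · intro hq
    obtain ⟨h5, h6⟩ := h4 hq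
    refine ⟨fun x hx => congrArg Subtype.val (h6 ⟨x, hmem.2 hx⟩), ?_⟩
    intro w hw hTw hwv x hx hTx
    set F : Module.End k (LinearMap.range P) := T.restrict (mapsTo_range_of_comm hPT) with hF
    have e1 : ∀ u (hu : P u = u), T u = u → (⟨u, hmem.2 hu⟩ : LinearMap.range P) ∈ F.eigenspace 1 := by
      intro u hu hTu
      rw [Module.End.mem_eigenspace_iff, one_smul]
      exact Subtype.ext hTu
    let u : Fin 2 → F.eigenspace 1 := ![⟨_, e1 v hPv hTv⟩, ⟨_, e1 w hw hTw⟩]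
    have hli : LinearIndependent k u := by
      rw [LinearIndependent.pair_iff]
      intro s t hst
      have hst' : s • v + t • w = 0 := congrArg (fun z => z.val.val) hst
      have ht : t = 0 := by
        by_contra ht
        apply hwv (-(t⁻¹ * s))
        have := congrArg (fun z => t⁻¹ • z) hst'
        simp only [smul_add, smul_smul, inv_mul_cancel₀ ht, one_smul, smul_zero] at this
        rw [neg_smul]
        exact eq_neg_of_add_eq_zero_right this
      rw [ht, zero_smul, add_zero] at hst'
      exact ⟨(smul_eq_zero.1 hst').resolve_right hv, ht⟩
    have hcard : Fintype.card (Fin 2) = Module.finrank k (F.eigenspace 1) := by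
      apply le_antisymm _ (by simpa using h5)
      exact hli.fintype_card_le_finrank
    have hsp := hli.span_eq_top_of_card_eq_finrank' hcard
    have hx' : (⟨_, e1 x hx hTx⟩ : F.eigenspace 1) ∈ Submodule.span k (Set.range u) := by
      rw [hsp]; trivial
    simp only [u, Matrix.range_cons, Matrix.range_empty, Set.union_empty, Set.singleton_union] at hx'
    obtain ⟨s, t, hst⟩ := Submodule.mem_span_pair.1 hx'
    exact ⟨s, t, (congrArg (fun z => z.val.val) hst).symm⟩

end Idempotent

section Derivation

variable {k H M : Type*} [Field k] [Ring H] [HopfAlgebra k H] [AddCommGroup M] [Module k M]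

theorem derivation_antipode {v : H →ₗ[k] M}
    (hv : ∀ x y, v (x * y) = counit (R := k) x • v y + counit (R := k) y • v x) (h : H) :
    v (antipode k h) = -v h := by
  have h1 : v 1 = 0 := by
    have := hv 1 1
    simp only [mul_one, Bialgebra.counit_one, one_smul] at this
    simpa using this
  have h2 : v (∑ i ∈ (ℛ k h).index, (ℛ k h).left i * antipode k ((ℛ k h).right i)) = 0 := by
    rw [sum_mul_antipode_eq_algebraMap_counit, Algebra.algebraMap_eq_smul_one, map_smul, h1,
      smul_zero]
  rw [map_sum] at h2
  simp only [hv, Finset.sum_add_distrib] at h2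
  have e1 := congrArg (fun z => v (antipode k z)) (sum_counit_smul (R := k) (ℛ k h))
  have e2 := congrArg v (rop_one (k := k) h)
  rw [rop_apply (ℛ k h)] at e2
  simp only [map_sum, map_smul, Dl.one_apply] at e1 e2
  simp only [counit_antipode] at h2
  rw [e1, e2] at h2
  exact eq_neg_of_add_eq_zero_left h2

end Derivation

section Central

variable {k H : Type*} [Field k] [IsAlgClosed k] [CharZero k] [Ring H] [HopfAlgebra k H]
  [FiniteDimensional k H]

theorem average_corner_ne {p : ℕ} {c e : H} (he : CyclicAverage k p c e)
    (h8 : ∀ h, (sq k H ^ 8) h * c = c * h) {q : k} (hq4 : q ^ 4 ≠ 1)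
    (hpoly : ∀ x, e * x = x →
      sq k H (sq k H (sq k H (sq k H x))) - q • sq k H (sq k H x) - sq k H (sq k H x) + q • x = 0)
    (hfix : ∀ x, e * x = x → sq k H x = x → ∃ s : k, x = s • e) {y : H} (hy0 : y ≠ 0)
    (hey : e * y = y) (hTy : sq k H y = -y) : False := by
  have hee := he.idem
  have hTe := he.sq_e
  have hpow : ∀ (μ : k) (x : H), sq k H (sq k H x) = μ • x → (sq k H ^ 8) x = μ ^ 4 • x := by
    intro μ x hx
    simp only [pow_succ, pow_zero, one_mul, Module.End.mul_apply, hx, map_smul, smul_smul]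
    congr 1
    ring
  have hT8 : ∀ x, e * x = x → (sq k H ^ 8) x * c = x := by
    intro x hx
    rw [h8, ← hx, ← mul_assoc, he.mul_e]
  have hxc : ∀ x : H, x * e = x → x * c = x := by
    intro x hx
    rw [← hx, mul_assoc, he.e_mul]
  have hA : ∀ x, e * x = x → x * e = x → sq k H (sq k H x) = x := by
    intro x hx hx'
    have hz : sq k H (sq k H (sq k H (sq k H x) - x)) = q • (sq k H (sq k H x) - x) := by
      rw [← sub_eq_zero, ← hpoly x hx]
      simp only [map_sub, smul_sub]
      abel
    have hez : e * (sq k H (sq k H x) - x) = sq k H (sq k H x) - x := by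
      rw [mul_sub, hx]
      nth_rewrite 1 [← hTe, ← hTe]
      rw [← sq_mul, ← sq_mul, hx]
    have hze : (sq k H (sq k H x) - x) * e = sq k H (sq k H x) - x := by
      rw [sub_mul, hx']
      nth_rewrite 1 [← hTe, ← hTe]
      rw [← sq_mul, ← sq_mul, hx']
    have h1 := hT8 _ hez
    rw [hpow q _ hz, smul_mul_assoc, hxc _ hze] at h1
    have h2 : (q ^ 4 - 1) • (sq k H (sq k H x) - x) = 0 := by rw [sub_smul, h1, one_smul, sub_self]
    exact sub_eq_zero.1 ((smul_eq_zero.1 h2).resolve_left (sub_ne_zero.2 hq4))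
  have hB : ∀ x, e * x = x → x * e = 0 → sq k H (sq k H x) = q • x := by
    intro x hx hx'
    have hz : sq k H (sq k H (sq k H (sq k H x) - q • x)) = (1 : k) • (sq k H (sq k H x) - q • x) := by
      rw [← sub_eq_zero, ← hpoly x hx]
      simp only [map_sub, map_smul, one_smul]
      abel
    have hez : e * (sq k H (sq k H x) - q • x) = sq k H (sq k H x) - q • x := by
      rw [mul_sub, mul_smul_comm, hx]
      nth_rewrite 1 [← hTe, ← hTe]
      rw [← sq_mul, ← sq_mul, hx]
    have hze : (sq k H (sq k H x) - q • x) * e = 0 := by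
      rw [sub_mul, smul_mul_assoc, hx']
      nth_rewrite 1 [← hTe, ← hTe]
      rw [← sq_mul, ← sq_mul, hx']
      simp
    have h1 := hT8 _ hez
    rw [hpow 1 _ hz, one_pow, one_smul] at h1
    rw [he.mul_e_of h1] at hze
    exact sub_eq_zero.1 hze
  have hB' : ∀ x, x * e = x → e * x = 0 → sq k H (sq k H x) = q • x := by
    intro x hx hx'
    apply (antipode_bijective k H).1
    rw [antipode_sq, antipode_sq, map_smul]
    apply hB
    · nth_rewrite 1 [← he.antipode_e]
      rw [← antipode_mul_antidistrib, hx]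
    · nth_rewrite 1 [← he.antipode_e]
      rw [← antipode_mul_antidistrib, hx', map_zero]
  have hC : ∀ x x', e * x = x → x * e = 0 → x' * e = x' → e * x' = 0 → x * x' = 0 := by
    intro x x' h1 h2 h3 h4
    have h5 : sq k H (sq k H (x * x')) = q ^ 2 • (x * x') := by
      rw [sq_mul, sq_mul, hB x h1 h2, hB' x' h3 h4, smul_mul_smul_comm, pow_two]
    rw [hA _ (by rw [← mul_assoc, h1]) (by rw [mul_assoc, h3])] at h5
    have h6 : (1 - q ^ 2) • (x * x') = 0 := by rw [sub_smul, ← h5, one_smul, sub_self]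
    refine (smul_eq_zero.1 h6).resolve_left ?_
    intro h7
    apply hq4
    linear_combination (-1 - q ^ 2) * h7
  have hmul : ∀ x y : H, e * (x * y) * e = (e * x * e) * (e * y * e) := by
    intro x y
    have := hC (e * x - e * x * e) (y * e - e * y * e) (by simp only [mul_sub, ← mul_assoc, hee])
      (by rw [sub_mul, mul_assoc _ e e, hee, sub_self])
      (by simp only [sub_mul, mul_assoc, hee]) (by simp only [mul_sub, ← mul_assoc, hee, sub_self])
    have e2 : (e * x - e * x * e) * (y * e - e * y * e) =
        e * (x * y) * e - e * x * (e * e) * y * e := by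
      rw [mul_sub, sub_mul, sub_mul]
      simp only [mul_assoc]
      simp only [← mul_assoc e e, hee]
      abel
    rw [e2, sub_eq_zero] at this
    rw [this]
    simp only [mul_assoc]
  have hplus : ∀ a : H, e * a = a → a * e = a → a + sq k H a = (2 * counit (R := k) a) • e := by
    intro a h1 h2
    obtain ⟨s, hs⟩ := hfix (a + sq k H a) (by
      have h3 : e * sq k H a = sq k H a := by
        nth_rewrite 1 [← hTe]
        rw [← sq_mul, h1]
      rw [mul_add, h1, h3]) (by rw [map_add, hA a h1 h2, add_comm])
    have h3 := congrArg (counit (R := k)) hs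
    rw [map_add, counit_sq, map_smul, he.counit_e, smul_eq_mul, mul_one] at h3
    rw [hs, ← h3, two_mul]
  have hprod : ∀ a b : H, e * a = a → a * e = a → e * b = b → b * e = b →
      a * b = counit (R := k) a • b + counit (R := k) b • a -
        (counit (R := k) a * counit (R := k) b) • e := by
    intro a b h1 h2 h3 h4
    have ha : sq k H a = (2 * counit (R := k) a) • e - a := by rw [← hplus a h1 h2]; abel
    have hb : sq k H b = (2 * counit (R := k) b) • e - b := by rw [← hplus b h3 h4]; abel
    have hab := hplus (a * b) (by rw [← mul_assoc, h1]) (by rw [mul_assoc, h4])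
    rw [sq_mul, ha, hb, Bialgebra.counit_mul] at hab
    simp only [mul_sub, sub_mul, smul_mul_assoc, mul_smul_comm, hee, h2, h3] at hab
    have h2' : (2 : k) ≠ 0 := two_ne_zero
    have : (2 : k) • (a * b - (counit (R := k) a • b + counit (R := k) b • a -
        (counit (R := k) a * counit (R := k) b) • e)) = 0 := by
      rw [← sub_eq_zero] at hab
      rw [← hab]
      module
    exact sub_eq_zero.1 ((smul_eq_zero.1 this).resolve_left h2')
  let v : H →ₗ[k] H := LinearMap.mulRight k e ∘ₗ LinearMap.mulLeft k e -
    (counit (R := k) (A := H)).smulRight e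
  have hv : ∀ x, v x = e * x * e - counit (R := k) x • e := fun x => rfl
  have hce : ∀ x : H, counit (R := k) (e * x * e) = counit (R := k) x := by
    intro x
    simp [Bialgebra.counit_mul, he.counit_e]
  have hvd : ∀ x y, v (x * y) = counit (R := k) x • v y + counit (R := k) y • v x := by
    intro x y
    rw [hv, hv, hv, hmul, hprod _ _ (by simp only [← mul_assoc, hee]) (by simp only [mul_assoc, hee])
      (by simp only [← mul_assoc, hee]) (by simp only [mul_assoc, hee]), hce, hce,
      Bialgebra.counit_mul]
    module
  have hvy : v (sq k H y) = v y := by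
    rw [sq_apply, derivation_antipode hvd, derivation_antipode hvd, neg_neg]
  have hye : y * e = y := by
    apply he.mul_e_of
    have h1 := hT8 y hey
    rwa [hpow 1 y (by rw [hTy, map_neg, hTy, neg_neg, one_smul]), one_pow, one_smul] at h1
  rw [hTy, map_neg, eq_comm, eq_neg_iff_add_eq_zero, ← two_smul k] at hvy
  replace hvy := (smul_eq_zero.1 hvy).resolve_left two_ne_zero
  rw [hv, hey, hye, sub_eq_zero] at hvy
  have : sq k H y = y := by rw [hvy, map_smul, hTe]
  rw [hTy] at this
  have h2 : (2 : k) • y = 0 := by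
    rw [two_smul]
    nth_rewrite 1 [← this]
    exact neg_add_cancel y
  exact hy0 ((smul_eq_zero.1 h2).resolve_left two_ne_zero)

theorem average_comm {p : ℕ} {c e : H} (he : CyclicAverage k p c e)
    (h8 : ∀ h, (sq k H ^ 8) h * c = c * h)
    (hrank : Module.finrank k (LinearMap.range (LinearMap.mulLeft k e)) = 4)
    (htr : LinearMap.trace k H (LinearMap.mulLeft k e ∘ₗ sq k H) = 0) {N : ℕ} (hN : 0 < N)
    (hT : (sq k H : Module.End k H) ^ N = 1) :
    (∀ h, e * h = h * e) ∧ ∃ y ≠ 0, e * y = y ∧ sq k H y = -y := by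
  have hee := he.idem
  have hTe := he.sq_e
  have he0 : e ≠ 0 := by
    rintro rfl
    have := he.counit_e
    rw [map_zero] at this
    exact zero_ne_one this
  obtain ⟨q, hq0, ⟨y, hy0, hey, hTy⟩, hpoly, hfix, -, hq1⟩ := four_dim_of_idem
    (P := LinearMap.mulLeft k e) (T := sq k H) (fun x => by simp [← mul_assoc, hee])
    (fun x => by simp [sq_mul, hTe]) hrank htr hN hT he0 hee hTe
  simp only [LinearMap.mulLeft_apply] at *
  have hq4 : q ^ 4 = 1 := by
    by_contra hq4
    have hq1 : q ≠ 1 := by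
      rintro rfl
      exact hq4 (one_pow 4)
    exact average_corner_ne he h8 hq4 hpoly (hfix hq1) hy0 hey hTy
  have h8' : ∀ x, e * x = x → (sq k H ^ 8) x = x := by
    intro x hx
    simp only [pow_succ, pow_zero, one_mul, Module.End.mul_apply]
    by_cases h1 : q = 1
    · simp only [(hq1 h1).1 x hx]
    · have h2 := hpoly x hx
      have h3 : sq k H (sq k H (sq k H (sq k H x))) = (q + 1) • sq k H (sq k H x) - q • x := by
        rw [← sub_eq_zero, ← h2]
        module
      have h4 : (q + 1) * (q ^ 2 + 1) = 0 := by
        apply mul_left_cancel₀ (sub_ne_zero.2 h1)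
        linear_combination hq4
      simp only [h3, map_sub, map_smul]
      have h5 : ∀ w : H, (q + 1) • ((q + 1) • ((q + 1) • w - q • x) - q • w) -
          q • ((q + 1) • w - q • x) = ((q + 1) * (q ^ 2 + 1)) • w +
            (1 - (q + 1) * (q ^ 2 + 1)) • x := by
        intro w
        module
      rw [h5, h4]
      module
  have h1 : ∀ h, e * h * e = e * h := by
    intro h
    apply he.mul_e_of
    have h2 : e * (e * h) = e * h := by rw [← mul_assoc, hee]
    have h3 := h8 (e * h)
    rwa [h8' _ h2, ← mul_assoc, he.mul_e] at h3
  refine ⟨fun h => ?_, y, hy0, hey, hTy⟩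
  obtain ⟨x, rfl⟩ := (antipode_bijective k H).2 h
  have h2 := congrArg (antipode k) (h1 x)
  simp only [antipode_mul_antidistrib, he.antipode_e] at h2
  rw [← h1, mul_assoc, h2]

end Central

section Twist

variable {k H : Type*} [Field k] [Ring H] [HopfAlgebra k H]

theorem sum_range_shift {M : Type*} [AddCommGroup M] {p : ℕ} {F : ℕ → M} (h : F p = F 0) :
    ∑ j ∈ Finset.range p, F (j + 1) = ∑ j ∈ Finset.range p, F j := by
  have := Finset.sum_range_succ F p
  rw [Finset.sum_range_succ', h] at this
  exact add_right_cancel this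

/-- An unnormalised eigenvector for the multiplication by `c`, where `d` is the inverse of `c`. -/
def eigenIdem (p : ℕ) (ζ : k) (d : H) : H := ∑ j ∈ Finset.range p, ζ ^ j • d ^ j

variable {p : ℕ} {ζ : k} {c d : H}

theorem mul_eigenIdem (hζ : ζ ^ p = 1) (hd : d ^ p = 1) (hcd : c * d = 1) :
    c * eigenIdem p ζ d = ζ • eigenIdem p ζ d := by
  have h := sum_range_shift (F := fun j => ζ ^ j • d ^ j) (p := p) (by simp [hζ, hd])
  rw [eigenIdem, ← h, Finset.mul_sum, h, Finset.smul_sum]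
  refine Finset.sum_congr rfl fun j _ => ?_
  rw [mul_smul_comm, pow_succ' d, ← mul_assoc, hcd, one_mul, smul_smul, pow_succ']

theorem eigenIdem_mul (hζ : ζ ^ p = 1) (hd : d ^ p = 1) (hdc : d * c = 1) :
    eigenIdem p ζ d * c = ζ • eigenIdem p ζ d := by
  have h := sum_range_shift (F := fun j => ζ ^ j • d ^ j) (p := p) (by simp [hζ, hd])
  rw [eigenIdem, ← h, Finset.sum_mul, h, Finset.smul_sum]
  refine Finset.sum_congr rfl fun j _ => ?_
  rw [smul_mul_assoc, pow_succ d, mul_assoc, hdc, mul_one, smul_smul, pow_succ']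

theorem pow_mul_eigenIdem (hζ : ζ ^ p = 1) (hd : d ^ p = 1) (hcd : c * d = 1) (j : ℕ) :
    c ^ j * eigenIdem p ζ d = ζ ^ j • eigenIdem p ζ d := by
  induction j with
  | zero => simp
  | succ j ih => rw [pow_succ, mul_assoc, mul_eigenIdem hζ hd hcd, mul_smul_comm, ih, smul_smul,
      pow_succ']

variable (hc : IsGroupLikeElem k c)

include hc in
theorem antipode_pow_groupLike (j : ℕ) : antipode k (c ^ j) = antipode k c ^ j := by
  induction j with
  | zero => simp [antipode_one]
  | succ j ih => rw [pow_succ, antipode_mul_antidistrib, ih, pow_succ']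

/-- The operator `h ↦ E S(h₁) c h₂`, where `E` is an eigenvector. -/
noncomputable def twistOp (p : ℕ) (ζ : k) (c : H) : H →ₗ[k] H :=
  (toConv (LinearMap.mulLeft k (eigenIdem p ζ (antipode k c)) ∘ₗ antipode k) *
    toConv (LinearMap.mulLeft k c)).ofConv

include hc in
theorem mulRight_antipode_comul (hζ : ζ ^ p = 1) (hcp : c ^ p = 1) {e : H}
    (he : CyclicAverage k p c e) (hcomm : ∀ h, e * h = h * e) (h : H) :
    TensorProduct.map (LinearMap.mulRight k (eigenIdem p ζ (antipode k c)))
      (LinearMap.mulLeft k (eigenIdem p ζ (antipode k c)) ∘ₗ antipode k) (comul (R := k) h) =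
    ∑ j ∈ Finset.range p, TensorProduct.map
      (LinearMap.mulRight k (eigenIdem p ζ (antipode k c)) ∘ₗ LinearMap.mulLeft k (c ^ j))
      (LinearMap.mulRight k (antipode k c ^ j) ∘ₗ antipode k) (comul (R := k) h) := by
  set E := eigenIdem p ζ (antipode k c) with hE
  have hdp : antipode k c ^ p = 1 := by
    rw [← antipode_pow_groupLike hc, hcp, antipode_one]
  have h1 : comul (R := k) ((p : k) • e) * comul (R := k) h =
      comul (R := k) h * comul (R := k) ((p : k) • e) := by
    rw [← Bialgebra.comul_mul, ← Bialgebra.comul_mul, smul_mul_assoc, mul_smul_comm, hcomm]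
  rw [he.smul_e, map_sum] at h1
  have h2 : ∀ j, comul (R := k) (c ^ j) = (c ^ j) ⊗ₜ[k] (c ^ j) :=
    fun j => (hc.pow (n := j)).comul_eq_tmul_self
  simp only [h2] at h1
  have h3 := congrArg (TensorProduct.map (LinearMap.mulRight k E) (antipode k)) h1
  rw [← (ℛ k h).eq] at h3
  simp only [Finset.sum_mul, Finset.mul_sum, map_sum, Algebra.TensorProduct.tmul_mul_tmul,
    TensorProduct.map_tmul, LinearMap.mulRight_apply, antipode_mul_antidistrib,
    antipode_pow_groupLike hc, mul_assoc] at h3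
  rw [← (ℛ k h).eq]
  simp only [map_sum, TensorProduct.map_tmul, LinearMap.comp_apply, LinearMap.mulRight_apply,
    LinearMap.mulLeft_apply]
  rw [Finset.sum_comm]
  rw [Finset.sum_comm] at h3
  simp only [mul_assoc]
  have h4 : ∀ i ∈ (ℛ k h).index, ((ℛ k h).left i * E) ⊗ₜ[k] (E * antipode k ((ℛ k h).right i)) =
      ∑ j ∈ Finset.range p, ((ℛ k h).left i * (c ^ j * E)) ⊗ₜ[k]
        (antipode k c ^ j * antipode k ((ℛ k h).right i)) := by
    intro i _
    nth_rewrite 2 [hE]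
    rw [eigenIdem, Finset.sum_mul, TensorProduct.tmul_sum]
    refine Finset.sum_congr rfl fun j _ => ?_
    rw [hE, pow_mul_eigenIdem hζ hdp hc.mul_antipode_cancel, mul_smul_comm, smul_mul_assoc,
      TensorProduct.tmul_smul, TensorProduct.smul_tmul']
  rw [Finset.sum_congr rfl h4]
  rw [Finset.sum_comm]
  exact h3.symm.trans Finset.sum_comm

theorem map_comul_eq_conv (A B : H →ₗ[k] H) (h : H) :
    TensorProduct.map A B (comul (R := k) h) =
      (toConv ((inl k H).toLinearMap ∘ₗ A) * toConv ((inr k H).toLinearMap ∘ₗ B)).ofConv h := by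
  rw [(ℛ k h).convMul_apply, ← (ℛ k h).eq]
  simp

theorem conv_mulLeft_mul {B : Type*} [Ring B] [Algebra k B] (b : B) (F : H →ₗ[k] B)
    (G : WithConv (H →ₗ[k] B)) : toConv (LinearMap.mulLeft k b ∘ₗ F) * G =
      toConv (LinearMap.mulLeft k b ∘ₗ (toConv F * G).ofConv) := by
  ext h
  change (toConv (LinearMap.mulLeft k b ∘ₗ F) * G).ofConv h = b * (toConv F * G).ofConv h
  rw [(ℛ k h).convMul_apply, (ℛ k h).convMul_apply]
  simp [Finset.mul_sum, mul_assoc]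

theorem conv_algHom_comp {A B : Type*} [Ring A] [Algebra k A] [Ring B] [Algebra k B] (φ : A →ₐ[k] B)
    (F G : H →ₗ[k] A) : toConv (φ.toLinearMap ∘ₗ F) * toConv (φ.toLinearMap ∘ₗ G) =
      toConv (φ.toLinearMap ∘ₗ (toConv F * toConv G).ofConv) := by
  ext h
  change (toConv (φ.toLinearMap ∘ₗ F) * toConv (φ.toLinearMap ∘ₗ G)).ofConv h =
    φ ((toConv F * toConv G).ofConv h)
  rw [(ℛ k h).convMul_apply, (ℛ k h).convMul_apply]
  simp [map_sum]

theorem conv_mulLeft_antipode_mul_id (a : H) :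
    toConv (LinearMap.mulLeft k a ∘ₗ antipode k) * toConv LinearMap.id =
      toConv ((counit (R := k) (A := H)).smulRight a) := by
  rw [conv_mulLeft_mul]
  ext h
  change a * (toConv (antipode k (A := H)) * toConv (LinearMap.id : H →ₗ[k] H)).ofConv h = counit (R := k) h • a
  rw [(ℛ k h).convMul_apply]
  simp only [LinearMap.id_apply]
  rw [sum_antipode_mul_eq_algebraMap_counit, Algebra.algebraMap_eq_smul_one, mul_smul_comm, mul_one]

include hc in
theorem mulRight_twistOp_comul (hζ : ζ ^ p = 1) (hcp : c ^ p = 1) {e : H}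
    (he : CyclicAverage k p c e) (hcomm : ∀ h, e * h = h * e) (h : H) :
    TensorProduct.map (LinearMap.mulRight k (eigenIdem p ζ (antipode k c))) (twistOp p ζ c)
      (comul (R := k) h) = (c * h * eigenIdem p ζ (antipode k c)) ⊗ₜ[k]
        eigenIdem p ζ (antipode k c) := by
  set E := eigenIdem p ζ (antipode k c) with hE
  set d := antipode k c with hd
  have hdp : d ^ p = 1 := by rw [hd, ← antipode_pow_groupLike hc, hcp, antipode_one]
  have hdc : d * c = 1 := hc.antipode_mul_cancel
  let P := (inl k H).toLinearMap ∘ₗ LinearMap.mulRight k E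
  let Q := (inr k H).toLinearMap ∘ₗ LinearMap.mulLeft k E ∘ₗ antipode k
  let C := (inr k H).toLinearMap ∘ₗ LinearMap.mulLeft k c
  let I := (inr k H).toLinearMap ∘ₗ LinearMap.id
  let P' : ℕ → H →ₗ[k] H ⊗[k] H := fun j => (inl k H).toLinearMap ∘ₗ LinearMap.mulRight k E ∘ₗ
    LinearMap.mulLeft k (c ^ j)
  let Q' : ℕ → H →ₗ[k] H ⊗[k] H := fun j => (inr k H).toLinearMap ∘ₗ LinearMap.mulRight k (d ^ j) ∘ₗ
    antipode k
  have hPQ : toConv P * toConv Q = ∑ j ∈ Finset.range p, toConv (P' j) * toConv (Q' j) := by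
    ext h
    have := mulRight_antipode_comul hc hζ hcp he hcomm h
    simp only [map_comul_eq_conv] at this
    simp only [WithConv.ofConv_sum, LinearMap.sum_apply]
    exact this
  have hQC : ∀ j, toConv (Q' (j + 1)) * toConv C = toConv (Q' j) * toConv I := by
    intro j
    rw [conv_algHom_comp, conv_algHom_comp]
    congr 2
    ext h
    rw [(ℛ k h).convMul_apply, (ℛ k h).convMul_apply]
    refine Finset.sum_congr rfl fun i _ => ?_
    simp only [LinearMap.comp_apply, LinearMap.mulRight_apply, LinearMap.mulLeft_apply,
      LinearMap.id_apply, pow_succ, mul_assoc]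
    rw [← mul_assoc d c, hdc, one_mul]
  have hP' : ∀ j, P' (j + 1) = LinearMap.mulLeft k (inl k H c) ∘ₗ P' j := by
    intro j
    ext h
    simp [P', pow_succ', mul_assoc]
  have h1 : toConv P * toConv Q * toConv C =
      toConv (LinearMap.mulLeft k (inl k H c) ∘ₗ (toConv P * (toConv Q * toConv I)).ofConv) := by
    rw [← mul_assoc, hPQ, Finset.sum_mul, Finset.sum_mul,
      ← sum_range_shift (F := fun j => toConv (P' j) * toConv (Q' j) * toConv C)
        (by simp [P', Q', hcp, hdp])]
    have h2 : ∀ j, toConv (P' (j + 1)) * toConv (Q' (j + 1)) * toConv C =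
        toConv (LinearMap.mulLeft k (inl k H c) ∘ₗ
          (toConv (P' j) * toConv (Q' j) * toConv I).ofConv) := by
      intro j
      rw [mul_assoc, hQC, hP', conv_mulLeft_mul, mul_assoc]
    simp only [h2]
    ext h
    simp only [WithConv.ofConv_sum, LinearMap.sum_apply, LinearMap.comp_apply, map_sum]
  have hQC' : toConv Q * toConv C = toConv ((inr k H).toLinearMap ∘ₗ twistOp p ζ c) :=
    conv_algHom_comp _ _ _
  have hQI : toConv Q * toConv I =
      toConv ((inr k H).toLinearMap ∘ₗ (counit (R := k) (A := H)).smulRight E) := by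
    rw [conv_algHom_comp, conv_mulLeft_antipode_mul_id]
  rw [mul_assoc, hQC', hQI] at h1
  rw [map_comul_eq_conv]
  have h3 := congrArg (fun F : WithConv (H →ₗ[k] H ⊗[k] H) => F.ofConv h) h1
  refine h3.trans ?_
  simp only [LinearMap.comp_apply, LinearMap.mulLeft_apply]
  have h4 := map_comul_eq_conv (LinearMap.mulRight k E) ((counit (R := k) (A := H)).smulRight E) h
  rw [← h4, ← (ℛ k h).eq]
  have e2 := rop_one (k := k) h
  rw [rop_apply (ℛ k h)] at e2
  simp only [Dl.one_apply] at e2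
  refine Eq.trans ?_ (congrArg (fun z => (c * z * E) ⊗ₜ[k] E) e2)
  simp [TensorProduct.tmul_smul, TensorProduct.smul_tmul', Finset.sum_mul, Finset.mul_sum,
    TensorProduct.sum_tmul, mul_assoc]

end Twist

section TwistFunctional

variable {k H : Type*} [Field k] [Ring H] [HopfAlgebra k H]

theorem conv_id_antipode : toConv (LinearMap.id : H →ₗ[k] H) * toConv (antipode k (A := H)) = 1 :=
  conv_algHom_comp_antipode (AlgHom.id k H)

theorem conv_antipode_id : toConv (antipode k (A := H)) * toConv (LinearMap.id : H →ₗ[k] H) = 1 :=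
  conv_antipode_comp_algHom (AlgHom.id k H)

theorem conv_antipode_rop (a : Dl k H) :
    toConv (antipode k (A := H)) * toConv (rop a) = toConv ((dlEquiv k H a).smulRight 1) := by
  have h1 : toConv (rop a) =
      toConv (LinearMap.id : H →ₗ[k] H) * toConv ((dlEquiv k H a).smulRight 1) := by
    ext h
    change rop a h = (toConv (LinearMap.id : H →ₗ[k] H) *
      toConv ((dlEquiv k H a).smulRight 1)).ofConv h
    rw [(ℛ k h).convMul_apply, rop_apply (ℛ k h)]
    simp
  rw [h1, ← mul_assoc, conv_antipode_id, one_mul]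

theorem rop_mul_eq_zero {E : H} (hE : E ≠ 0) {a : Dl k H} (h : ∀ x, rop a x * E = 0) : a = 0 := by
  ext x
  have h1 := congrArg (fun F : WithConv (H →ₗ[k] H) => F.ofConv x * E) (conv_antipode_rop a)
  simp only at h1
  rw [(ℛ k x).convMul_apply, Finset.sum_mul] at h1
  simp only [mul_assoc, h, mul_zero, Finset.sum_const_zero] at h1
  have h2 : a x • E = 0 := by simpa using h1.symm
  simpa using (smul_eq_zero.1 h2).resolve_right hE

theorem rop_sub (a b : Dl k H) (x : H) : rop (a - b) x = rop a x - rop b x := by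
  rw [rop_apply (ℛ k x), rop_apply (ℛ k x), rop_apply (ℛ k x), ← Finset.sum_sub_distrib]
  refine Finset.sum_congr rfl fun i _ => ?_
  rw [← sub_smul]
  simp

theorem rop_smul (s : k) (a : Dl k H) (x : H) : rop (s • a) x = s • rop a x := by
  rw [rop_apply (ℛ k x), rop_apply (ℛ k x), Finset.smul_sum]
  refine Finset.sum_congr rfl fun i _ => ?_
  rw [smul_smul]
  simp

theorem eq_of_rop_mul_eq {E : H} (hE : E ≠ 0) {a b : Dl k H} (h : ∀ x, rop a x * E = rop b x * E) :
    a = b := by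
  rw [← sub_eq_zero]
  exact rop_mul_eq_zero hE fun x => by rw [rop_sub, sub_mul, h, sub_self]

/-- The functional `x ↦ a (x y)`. -/
noncomputable def transR (y : H) (a : Dl k H) : Dl k H :=
  (dlEquiv k H).symm (dlEquiv k H a ∘ₗ LinearMap.mulRight k y)

/-- The functional `x ↦ a (y x)`. -/
noncomputable def transL (y : H) (a : Dl k H) : Dl k H :=
  (dlEquiv k H).symm (dlEquiv k H a ∘ₗ LinearMap.mulLeft k y)

@[simp] theorem transR_apply (y : H) (a : Dl k H) (x : H) : transR y a x = a (x * y) := rfl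
@[simp] theorem transL_apply (y : H) (a : Dl k H) (x : H) : transL y a x = a (y * x) := rfl

variable {c : H} (hc : IsGroupLikeElem k c)

include hc

theorem rop_mul_groupLike (a : Dl k H) (x : H) : rop a (x * c) = rop (transR c a) x * c := by
  rw [← evr_comul, ← evr_comul, Bialgebra.comul_mul, hc.comul_eq_tmul_self, ← (ℛ k x).eq]
  simp [Finset.sum_mul]

theorem rop_groupLike_mul (a : Dl k H) (x : H) : rop a (c * x) = c * rop (transL c a) x := by
  rw [← evr_comul, ← evr_comul, Bialgebra.comul_mul, hc.comul_eq_tmul_self, ← (ℛ k x).eq]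
  simp [Finset.mul_sum]

variable {p : ℕ} {ζ : k} {θ : Dl k H} {E : H} (hE : E ≠ 0)
  (hθ : ∀ x, rop θ x * E = c * x * E)

include hE hθ

theorem twist_transR (hζ : ζ ≠ 0) (hcE : c * E = ζ • E) : transR c θ = θ := by
  refine eq_of_rop_mul_eq hE fun x => ?_
  have h1 := hθ (x * c)
  rw [rop_mul_groupLike hc, mul_assoc, hcE, ← mul_assoc, mul_assoc _ c E, hcE, mul_smul_comm,
    mul_smul_comm] at h1
  rw [hθ]
  exact smul_right_injective H hζ h1

omit hE hc in
theorem rop_twist_pow (n : ℕ) (x : H) : rop (θ ^ n) x * E = c ^ n * x * E := by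
  induction n with
  | zero => rw [pow_zero, pow_zero, rop_one, one_mul]
  | succ n ih => rw [pow_succ', ← rop_rop, hθ, mul_assoc, ih, pow_succ', mul_assoc, mul_assoc,
      mul_assoc]

omit hc in
theorem twist_pow_eq_one (hcp : c ^ p = 1) : θ ^ p = 1 :=
  eq_of_rop_mul_eq hE fun x => by rw [rop_twist_pow hθ, hcp, one_mul, rop_one]

theorem twist_comm (hdE : ∀ a : Dl k H, transR c a = a → ∀ x, rop a (x * E) = rop a x * E)
    {a : Dl k H} (ha : transR c a = a) (ha' : transL c a = a) : a * θ = θ * a := by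
  refine eq_of_rop_mul_eq hE fun x => ?_
  rw [← rop_rop, ← rop_rop, hθ, ← hdE a ha, hθ, hdE a ha, rop_groupLike_mul hc, ha']

omit hE hθ in
theorem rop_mul_eigenIdem {a : Dl k H} (ha : transR c a = a) (x : H) :
    rop a (x * eigenIdem p ζ c) = rop a x * eigenIdem p ζ c := by
  have h1 : ∀ j, rop a (x * c ^ j) = rop a x * c ^ j := by
    intro j
    induction j with
    | zero => simp
    | succ j ih => rw [pow_succ, ← mul_assoc, rop_mul_groupLike hc, ha, ih, mul_assoc]
  simp only [eigenIdem, Finset.mul_sum, map_sum, mul_smul_comm, map_smul, h1]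

theorem sq_twist [FiniteDimensional k H] (hTE : sq k H E = E) : sq k (Dl k H) θ = θ := by
  refine eq_of_rop_mul_eq hE fun x => (sq_bijective k H).1 ?_
  rw [sq_mul, ← rop_sq, hTE, hθ, hθ, sq_mul, sq_mul, hTE, sq_groupLike hc]

end TwistFunctional

section Reduced

variable {k A : Type*} [Field k] [CharZero k] [Ring A] [Algebra k A]

theorem add_pow_of_sq_zero {n : A} (hn : n * n = 0) (r : k) (m : ℕ) :
    (r • (1 : A) + n) ^ (m + 1) = r ^ (m + 1) • (1 : A) + ((m + 1 : ℕ) * r ^ m : k) • n := by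
  induction m with
  | zero => simp
  | succ m ih =>
    rw [pow_succ, ih, mul_add, add_mul, add_mul]
    simp only [smul_mul_assoc, mul_smul_comm, one_mul, mul_one, hn, smul_zero, add_zero]
    push_cast
    module

theorem reduced_of_pow_eq_one {p : ℕ} (hp : 1 < p) {θ : A} (hθ : θ ^ p = 1)
    (hns : ∀ s : k, θ ≠ s • (1 : A)) {s t : k}
    (h : (s • (1 : A) + t • θ) * (s • (1 : A) + t • θ) = 0) : s • (1 : A) + t • θ = 0 := by
  by_cases ht : t = 0
  · subst ht
    rw [zero_smul, add_zero] at h ⊢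
    rw [smul_mul_smul_comm, one_mul] at h
    rcases smul_eq_zero.1 h with h | h
    · rw [mul_self_eq_zero.1 h, zero_smul]
    · rw [h, smul_zero]
  · exfalso
    set n := θ + (s / t) • (1 : A) with hn
    have hnn : n * n = 0 := by
      have h1 : s • (1 : A) + t • θ = t • n := by
        rw [hn, smul_add, smul_smul, mul_div_cancel₀ _ ht, add_comm]
      rw [h1, smul_mul_smul_comm] at h
      exact (smul_eq_zero.1 h).resolve_left (mul_ne_zero ht ht)
    have hθn : θ = (-(s / t)) • (1 : A) + n := by rw [hn]; module
    obtain ⟨m, rfl⟩ : ∃ m, p = m + 1 := ⟨p - 1, by omega⟩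
    have h2 := add_pow_of_sq_zero hnn (-(s / t)) m
    rw [← hθn, hθ] at h2
    set r := -(s / t) with hr
    by_cases hr0 : r = 0
    · rw [hr0, zero_pow (by omega), zero_pow (by omega), mul_zero, zero_smul, zero_smul,
        add_zero] at h2
      apply hns 0
      rw [zero_smul, ← mul_one θ, h2, mul_zero]
    · set u : k := (m + 1 : ℕ) * r ^ m with hu
      have hu0 : u ≠ 0 := mul_ne_zero (Nat.cast_ne_zero.2 (by omega)) (pow_ne_zero _ hr0)
      apply hns (r + u⁻¹ * (1 - r ^ (m + 1)))
      have h3 : u • n = (1 - r ^ (m + 1)) • (1 : A) := by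
        rw [sub_smul, one_smul, eq_sub_iff_add_eq, add_comm]
        exact h2.symm
      have h4 : n = (u⁻¹ * (1 - r ^ (m + 1))) • (1 : A) := by
        rw [mul_smul, ← h3, smul_smul, inv_mul_cancel₀ hu0, one_smul]
      rw [add_smul, ← h4]
      exact hθn

theorem comm_of_involution {B : A → Prop} (hBm : ∀ {a b}, B a → B b → B (a * b))
    (hBa : ∀ {a b}, B a → B b → B (a + b)) (hBs : ∀ {a} (s : k), B a → B (s • a))
    {T : A →ₗ[k] A} (hTm : ∀ a b, T (a * b) = T a * T b) (hBT : ∀ {a}, B a → B (T a))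
    (hTT : ∀ {a}, B a → T (T a) = a) {θ : A}
    (hfix : ∀ {a}, B a → T a = a → ∃ s t : k, a = s • (1 : A) + t • θ)
    (hθc : ∀ {a}, B a → a * θ = θ * a)
    (hred : ∀ s t : k, (s • (1 : A) + t • θ) * (s • (1 : A) + t • θ) = 0 → s • (1 : A) + t • θ = 0)
    {a b : A} (ha : B a) (hb : B b) : a * b = b * a := by
  have hcen : ∀ {x y}, B x → T x = x → B y → x * y = y * x := by
    intro x y hx hTx hy
    obtain ⟨s, t, rfl⟩ := hfix hx hTx
    simp only [add_mul, mul_add, smul_mul_assoc, mul_smul_comm, one_mul, mul_one, hθc hy]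
  have hodd : ∀ {y z}, B y → B z → T y = -y → T z = -z → y * z = z * y := by
    intro y z hy hz hTy hTz
    have h1 : ∀ {u v}, B u → B v → T u = -u → T v = -v → ∀ {w}, B w → u * v * w = w * (u * v) :=
      fun hu hv hTu hTv w hw => hcen (hBm hu hv) (by rw [hTm, hTu, hTv, neg_mul_neg]) hw
    have hneg : B (z * y + (-1 : k) • (y * z)) := hBa (hBm hz hy) (hBs _ (hBm hy hz))
    obtain ⟨s, t, hst⟩ := hfix hneg (by
      rw [map_add, map_smul, hTm, hTm, hTy, hTz, neg_mul_neg, neg_mul_neg])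
    have h2 : (z * y + (-1 : k) • (y * z)) * y = 0 := by
      rw [add_mul, smul_mul_assoc, h1 hz hy hTz hTy hy, neg_one_smul, ← mul_assoc, add_neg_cancel]
    have h3 : (z * y + (-1 : k) • (y * z)) * z = 0 := by
      rw [add_mul, smul_mul_assoc, h1 hy hz hTy hTz hz, neg_one_smul, ← mul_assoc, add_neg_cancel]
    have h4 : (z * y + (-1 : k) • (y * z)) * (z * y + (-1 : k) • (y * z)) = 0 := by
      have h6 : ∀ x : A, x * y = 0 → x * z = 0 → x * (z * y + (-1 : k) • (y * z)) = 0 := by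
        intro x hy hz
        rw [mul_add, mul_smul_comm, ← mul_assoc, ← mul_assoc, hy, hz, zero_mul, zero_mul, smul_zero,
          add_zero]
      exact h6 _ h2 h3
    rw [hst] at h4
    have h5 := hred s t h4
    rw [← hst, neg_one_smul, ← sub_eq_add_neg, sub_eq_zero] at h5
    exact h5.symm
  have h2 : ∀ {x}, B x → ∃ u v, B u ∧ B v ∧ T u = u ∧ T v = -v ∧ (2 : k) • x = u + v := by
    intro x hx
    refine ⟨x + T x, x + (-1 : k) • T x, hBa hx (hBT hx), hBa hx (hBs _ (hBT hx)), ?_, ?_, ?_⟩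
    · rw [map_add, hTT hx, add_comm]
    · rw [map_add, map_smul, hTT hx]
      module
    · module
  obtain ⟨u, v, hu, hv, hTu, hTv, huv⟩ := h2 ha
  obtain ⟨u', v', hu', hv', hTu', hTv', huv'⟩ := h2 hb
  have h3 : ((2 : k) • a) * ((2 : k) • b) = ((2 : k) • b) * ((2 : k) • a) := by
    rw [huv, huv', add_mul, mul_add, mul_add, add_mul, mul_add, mul_add, hcen hu hTu hu',
      hcen hu hTu hv', hodd hv hv' hTv hTv', hcen hu' hTu' hv]
    abel
  rw [smul_mul_smul_comm, smul_mul_smul_comm] at h3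
  exact smul_right_injective A (by norm_num : (2 * 2 : k) ≠ 0) h3

end Reduced

section Cocommutative

variable {k H : Type*} [Field k] [Ring H] [HopfAlgebra k H]

theorem sq_mul_central_of_comm {e : H} (hcen : ∀ h, e * h = h * e) (hee : e * e = e)
    (hSe : antipode k e = e)
    (hcomm : ∀ a b : Dl k H, transR e a * transR e b = transR e b * transR e a) (h : H) :
    e * sq k H h = e * h := by
  have h1 : ∀ h : H, TensorProduct.map (LinearMap.mulLeft k e) (LinearMap.mulLeft k e)
      (comul (R := k) h) = TensorProduct.comm k H H
        (TensorProduct.map (LinearMap.mulLeft k e) (LinearMap.mulLeft k e) (comul (R := k) h)) := by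
    intro h
    apply tensor_ext_evl
    intro a
    apply eq_of_forall_dl (k := k)
    intro b
    have := congrArg (fun f : Dl k H => f h) (hcomm a b)
    simp only [Dl.mul_apply_repr (ℛ k h), transR_apply, ← hcen] at this
    rw [← (ℛ k h).eq]
    simp only [map_sum, TensorProduct.map_tmul, TensorProduct.comm_tmul, evl_tmul, map_smul,
      LinearMap.mulLeft_apply, smul_eq_mul]
    rw [this]
    exact Finset.sum_congr rfl fun i _ => mul_comm _ _
  have h2 : ∀ h : H, e * ∑ i ∈ (ℛ k h).index, antipode k ((ℛ k h).right i) * (ℛ k h).left i =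
      counit (R := k) h • e := by
    intro h
    have h3 := congrArg (LinearMap.mul' k H ∘ₗ TensorProduct.map (antipode k) LinearMap.id) (h1 h)
    rw [← (ℛ k h).eq] at h3
    simp only [map_sum, TensorProduct.map_tmul, TensorProduct.comm_tmul, LinearMap.mulLeft_apply,
      LinearMap.comp_apply, LinearMap.mul'_apply, LinearMap.id_apply, antipode_mul_antidistrib,
      hSe] at h3
    have h4 : ∀ x y : H, antipode k x * e * (e * y) = e * (antipode k x * y) := by
      intro x y
      rw [← hcen, mul_assoc, ← mul_assoc (antipode k x), ← hcen, mul_assoc, ← mul_assoc, hee]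
    simp only [h4, ← Finset.mul_sum, sum_antipode_mul_eq_algebraMap_counit,
      Algebra.algebraMap_eq_smul_one, mul_smul_comm, mul_one] at h3
    exact h3.symm
  have h5 : toConv (antipode k (A := H)) * toConv (LinearMap.mulLeft k e ∘ₗ sq k H) =
      toConv (antipode k (A := H)) * toConv (LinearMap.mulLeft k e ∘ₗ LinearMap.id) := by
    ext h
    rw [(ℛ k h).convMul_apply, (ℛ k h).convMul_apply]
    simp only [LinearMap.comp_apply, LinearMap.mulLeft_apply, LinearMap.id_apply]
    have h6 : ∀ x y : H, x * (e * y) = e * (x * y) := fun x y => by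
      rw [← mul_assoc, ← hcen, mul_assoc]
    simp only [h6, ← Finset.mul_sum, sum_antipode_mul_eq_algebraMap_counit,
      Algebra.algebraMap_eq_smul_one, mul_smul_comm, mul_one]
    have h7 := congrArg (antipode k) (h2 h)
    rw [map_smul, antipode_mul_antidistrib, hSe, ← hcen, map_sum] at h7
    simp only [antipode_mul_antidistrib] at h7
    exact h7
  have h8 := congrArg (toConv (LinearMap.id : H →ₗ[k] H) * ·) h5
  simp only [← mul_assoc, conv_id_antipode, one_mul] at h8
  exact congrArg (fun F : WithConv (H →ₗ[k] H) => F.ofConv h) h8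

end Cocommutative

section Central

variable {k H : Type*} [Field k] [IsAlgClosed k] [CharZero k] [Ring H] [HopfAlgebra k H]
  [FiniteDimensional k H] {p : ℕ} {c e : H}

theorem twist_scalar (hp : 1 < p) (hc : IsGroupLikeElem k c) (he : CyclicAverage k p c e)
    (hcen : ∀ h, e * h = h * e) (htr4 : LinearMap.trace k H (LinearMap.mulLeft k e) = 4)
    (htr : LinearMap.trace k H (LinearMap.mulLeft k e ∘ₗ sq k H) = 0) {N : ℕ} (hN : 0 < N)
    (hT : (sq k H : Module.End k H) ^ N = 1) (hy : ∃ y ≠ 0, e * y = y ∧ sq k H y = -y)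
    {θ : Dl k H} (hθp : θ ^ p = 1) (hTθ : sq k (Dl k H) θ = θ) (hθ : transR c θ = θ)
    (hθc : ∀ a : Dl k H, transR c a = a → transL c a = a → a * θ = θ * a) :
    ∃ s : k, θ = s • (1 : Dl k H) := by
  have hee := he.idem
  have hTe := he.sq_e
  by_contra! hns
  let P : Module.End k (Dl k H) :=
    { toFun := transR e
      map_add' := fun a b => by ext x; simp
      map_smul' := fun s a => by ext x; simp }
  have hPa : ∀ a, P a = transR e a := fun _ => rfl
  have hPiff : ∀ a, P a = a ↔ transR c a = a := by
    intro a
    constructor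
    · intro h
      ext x
      rw [transR_apply, ← h, hPa, transR_apply, transR_apply, mul_assoc, he.mul_e]
    · intro h
      have h1 : ∀ j x, a (x * c ^ j) = a x := by
        intro j
        induction j with
        | zero => simp
        | succ j ih =>
          intro x
          rw [pow_succ, ← mul_assoc]
          have := congrArg (fun f : Dl k H => f (x * c ^ j)) h
          simp only [transR_apply] at this
          rw [this, ih]
      ext x
      rw [hPa, transR_apply]
      have hp0 : (p : k) ≠ 0 := Nat.cast_ne_zero.2 (by omega)
      apply mul_left_cancel₀ hp0
      have h2 : (p : k) * a (x * e) = a (x * ((p : k) • e)) := by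
        rw [mul_smul_comm]
        simp
      rw [h2, he.smul_e, Finset.mul_sum]
      simp [h1]
  have hPP : ∀ a, P (P a) = P a := by
    intro a
    ext x
    simp only [hPa, transR_apply, mul_assoc, hee]
  have hPT : ∀ a, P (sq k (Dl k H) a) = sq k (Dl k H) (P a) := by
    intro a
    ext x
    simp only [hPa, transR_apply, dual_sq_apply, sq_mul, hTe]
  have htrP : LinearMap.trace k (Dl k H) P = 4 := by
    rw [trace_dl (LinearMap.mulLeft k e) P (fun f x => by rw [hPa, transR_apply, ← hcen]; rfl), htr4]
  have hrank : Module.finrank k (LinearMap.range P) = 4 := by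
    have := finrank_range_of_idem hPP
    rw [htrP] at this
    exact_mod_cast this
  have htrPT : LinearMap.trace k (Dl k H) (P ∘ₗ sq k (Dl k H)) = 0 := by
    rw [trace_dl (LinearMap.mulLeft k e ∘ₗ sq k H) _ (fun f x => ?_), htr]
    rw [LinearMap.comp_apply, hPa, transR_apply, dual_sq_apply, sq_mul, hTe, ← hcen]
    rfl
  have hTpow : ∀ (n : ℕ) (a : Dl k H) (x : H), ((sq k (Dl k H) : Module.End k (Dl k H)) ^ n) a x =
      a (((sq k H : Module.End k H) ^ n) x) := by
    intro n
    induction n with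
    | zero => simp
    | succ n ih =>
      intro a x
      rw [pow_succ, Module.End.mul_apply, ih, dual_sq_apply, pow_succ', Module.End.mul_apply]
  have hTd : (sq k (Dl k H) : Module.End k (Dl k H)) ^ N = 1 := by
    ext a x
    rw [hTpow, hT]
    rfl
  have hP1 : P 1 = 1 := by
    ext x
    rw [hPa, transR_apply, Dl.one_apply, Dl.one_apply, Bialgebra.counit_mul, he.counit_e, mul_one]
  obtain ⟨q, -, -, -, hq, -, hq1⟩ := four_dim_of_idem hPP hPT hrank htrPT hN hTd
    (one_ne_zero_of_hopf k (Dl k H)) hP1 sq_one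
  have hPθ := (hPiff θ).2 hθ
  by_cases hq' : q = 1
  swap
  · obtain ⟨s, hs⟩ := hq hq' θ hPθ hTθ
    exact hns s hs
  obtain ⟨hTT, hfix⟩ := hq1 hq'
  have hfix' := hfix θ hPθ hTθ hns
  have hBm : ∀ {a b : Dl k H}, P a = a → P b = b → P (a * b) = a * b := by
    intro a b ha hb
    rw [hPiff] at *
    ext x
    have h1 : ∀ x, a (x * c) = a x := fun x => congrArg (fun f : Dl k H => f x) ha
    have h2 : ∀ x, b (x * c) = b x := fun x => congrArg (fun f : Dl k H => f x) hb
    rw [transR_apply, ← dl_rop, rop_mul_groupLike hc, hb, h1, dl_rop]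
  have hBL : ∀ {a : Dl k H}, P a = a → transL c a = a := by
    intro a ha
    ext x
    rw [transL_apply, ← ha, hPa, transR_apply, transR_apply, ← hcen, ← mul_assoc, he.e_mul, hcen]
  have hcomm : ∀ a b : Dl k H, transR e a * transR e b = transR e b * transR e a := by
    intro a b
    refine comm_of_involution (k := k) (B := fun a : Dl k H => P a = a) (T := sq k (Dl k H)) (θ := θ) hBm
      (fun ha hb => by rw [map_add, ha, hb]) (fun s ha => by rw [map_smul, ha]) sq_mul
      (fun ha => by rw [hPT, ha]) (fun {a} ha => hTT a ha) (fun {a} ha h => hfix' a ha h)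
      (fun {a} ha => hθc a ((hPiff a).1 ha) (hBL ha))
      (fun s t h => reduced_of_pow_eq_one hp hθp hns h) (hPP a) (hPP b)
  obtain ⟨y, hy0, hey, hTy⟩ := hy
  have h1 := sq_mul_central_of_comm hcen hee he.antipode_e hcomm y
  rw [hTy, mul_neg, hey, eq_comm, eq_neg_iff_add_eq_zero, ← two_smul k] at h1
  exact hy0 ((smul_eq_zero.1 h1).resolve_left two_ne_zero)

theorem central_mul_eigenIdem (hp : 1 < p) (hc : IsGroupLikeElem k c) (hcp : c ^ p = 1)
    (he : CyclicAverage k p c e)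
    (hcen : ∀ h, e * h = h * e) (htr4 : LinearMap.trace k H (LinearMap.mulLeft k e) = 4)
    (htr : LinearMap.trace k H (LinearMap.mulLeft k e ∘ₗ sq k H) = 0) {N : ℕ} (hN : 0 < N)
    (hT : (sq k H : Module.End k H) ^ N = 1) (hy : ∃ y ≠ 0, e * y = y ∧ sq k H y = -y)
    {ζ : k} (hζ : ζ ^ p = 1) (h : H) :
    c * h * eigenIdem p ζ (antipode k c) = h * c * eigenIdem p ζ (antipode k c) := by
  set E := eigenIdem p ζ (antipode k c) with hE
  by_cases hE0 : E = 0
  · rw [hE0, mul_zero, mul_zero]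
  have hζ0 : ζ ≠ 0 := by
    rintro rfl
    rw [zero_pow (by omega)] at hζ
    exact zero_ne_one hζ
  have hdp : antipode k c ^ p = 1 := by rw [← antipode_pow_groupLike hc, hcp, antipode_one]
  have hcE : c * E = ζ • E := mul_eigenIdem hζ hdp hc.mul_antipode_cancel
  obtain ⟨f, hf⟩ : ∃ f : Dl k H, f E = 1 := by
    obtain ⟨f, hf⟩ : ∃ f : Dl k H, f E ≠ 0 := by
      by_contra! hf
      exact hE0 (eq_of_forall_dl (k := k) fun f => by rw [hf]; simp)
    exact ⟨(f E)⁻¹ • f, by simp [hf]⟩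
  let θ : Dl k H := (dlEquiv k H).symm (dlEquiv k H f ∘ₗ twistOp p ζ c)
  have hθ : ∀ x, rop θ x * E = c * x * E := by
    intro x
    have h1 := congrArg (evr f) (mulRight_twistOp_comul hc hζ hcp he hcen x)
    rw [evr_tmul, ← hE, hf, one_smul] at h1
    rw [← h1, rop_apply (ℛ k x), ← (ℛ k x).eq]
    simp [θ, Finset.sum_mul]
  have hTE : sq k H E = E := by
    have : ∀ j, sq k H (antipode k c ^ j) = antipode k c ^ j :=
      fun j => sq_groupLike (hc.antipode.pow)
    simp [hE, eigenIdem, map_sum, this]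
  have hdR : ∀ a : Dl k H, transR c a = a → transR (antipode k c) a = a := by
    intro a ha
    ext x
    nth_rewrite 1 [← ha]
    rw [transR_apply, transR_apply, mul_assoc, hc.antipode_mul_cancel, mul_one]
  obtain ⟨s, hs⟩ := twist_scalar hp hc he hcen htr4 htr hN hT hy
    (twist_pow_eq_one hE0 hθ hcp) (sq_twist hc hE0 hθ hTE) (twist_transR hc hE0 hθ hζ0 hcE)
    (fun a ha ha' => twist_comm hc hE0 hθ
      (fun a ha x => rop_mul_eigenIdem hc.antipode (hdR a ha) x) ha ha')
  have h2 : ∀ x, s • (x * E) = c * x * E := by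
    intro x
    rw [← hθ, hs, rop_smul, rop_one, smul_mul_assoc]
  have h3 : s = ζ := by
    have := h2 1
    rw [one_mul, mul_one, hcE] at this
    exact smul_left_injective k hE0 this
  rw [← h2, h3, mul_assoc, hcE, mul_smul_comm]

theorem sum_eigenIdem (k : Type*) {A : Type*} [Field k] [Ring A] [Algebra k A] {p : ℕ} {ω : k}
    (hω : IsPrimitiveRoot ω p) (hp : 0 < p) (d : A) :
    ∑ i ∈ Finset.range p, ∑ j ∈ Finset.range p, (ω ^ i) ^ j • d ^ j = (p : k) • (1 : A) := by
  rw [Finset.sum_comm, Finset.sum_eq_single 0]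
  · simp [Nat.cast_smul_eq_nsmul]
  · intro j hj hj0
    rw [← Finset.sum_smul]
    have h1 : ∑ i ∈ Finset.range p, (ω ^ i) ^ j = 0 := by
      have h2 : ω ^ j - 1 ≠ 0 :=
        sub_ne_zero.2 (hω.pow_ne_one_of_pos_of_lt hj0 (Finset.mem_range.1 hj))
      have h3 := geom_sum_mul (ω ^ j) p
      rw [← pow_mul, mul_comm j p, pow_mul, hω.pow_eq_one, one_pow, sub_self] at h3
      simpa only [← pow_mul, mul_comm] using (mul_eq_zero.1 h3).resolve_right h2
    rw [h1, zero_smul]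
  · intro h
    exact absurd (Finset.mem_range.2 hp) h

theorem groupLike_central (hp : p.Prime) (hdim : Module.finrank k H = 4 * p)
    (hc : IsGroupLikeElem k c) (hcp : c ^ p = 1) (hTV : TraceVanish k H)
    (h8 : ∀ h, (sq k H ^ 8) h * c = c * h) {N : ℕ} (hN : 0 < N)
    (hT : (sq k H : Module.End k H) ^ N = 1) (h : H) : c * h = h * c := by
  by_cases hc1 : c = 1
  · rw [hc1, one_mul, mul_one]
  obtain ⟨e, he, htr4, hrank, htr⟩ := exists_average_of_finrank hp hdim hc hcp hc1
  obtain ⟨hcen, hy⟩ := average_comm he h8 hrank (htr hTV) hN hT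
  obtain ⟨ω, hω⟩ := exists_isPrimitiveRoot k hp.pos
  have h1 : c * h * ((p : k) • 1) = h * c * ((p : k) • 1) := by
    rw [← sum_eigenIdem k hω hp.pos (antipode k c), Finset.mul_sum, Finset.mul_sum]
    refine Finset.sum_congr rfl fun i _ => ?_
    exact central_mul_eigenIdem hp.one_lt hc hcp he hcen htr4 (htr hTV) hN hT hy
      (by rw [← pow_mul, mul_comm, pow_mul, hω.pow_eq_one, one_pow]) h
  rw [mul_smul_comm, mul_smul_comm, mul_one, mul_one] at h1
  exact smul_right_injective H (Nat.cast_ne_zero.2 hp.ne_zero : (p : k) ≠ 0) h1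

end Central

section Derivation

variable {k A : Type*} [Field k] [CharZero k] [Ring A] [Algebra k A]

/-- The operator `(T - 1) (T² - q)`. -/
def oddOp (T : A →ₗ[k] A) (q : k) : A →ₗ[k] A :=
  (T - LinearMap.id) ∘ₗ (T ∘ₗ T - q • LinearMap.id)

theorem oddOp_apply (T : A →ₗ[k] A) (q : k) (x : A) :
    oddOp T q x = T (T (T x) - q • x) - (T (T x) - q • x) := rfl

variable {B : Submodule k A} (hBm : ∀ {a b}, a ∈ B → b ∈ B → a * b ∈ B)
  {T : A →ₗ[k] A} (hTm : ∀ a b, T (a * b) = T a * T b) (hBT : ∀ {a}, a ∈ B → T a ∈ B)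
  {q : k} (hpoly : ∀ x ∈ B, T (T (T (T x))) - q • T (T x) - T (T x) + q • x = 0)
  {y : A} (hneg : ∀ z ∈ B, T z = -z → ∃ s : k, z = s • y)

include hBT hpoly

theorem T_oddOp {x : A} (hx : x ∈ B) : oddOp T q x ∈ B ∧ T (oddOp T q x) = -oddOp T q x := by
  rw [oddOp_apply]
  refine ⟨B.sub_mem (hBT (B.sub_mem (hBT (hBT hx)) (B.smul_mem _ hx)))
    (B.sub_mem (hBT (hBT hx)) (B.smul_mem _ hx)), ?_⟩
  have h := hpoly x hx
  rw [← sub_eq_zero, ← h]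
  simp only [map_sub, map_smul]
  abel

include hneg in
theorem oddOp_mem {x : A} (hx : x ∈ B) : ∃ s : k, oddOp T q x = s • y := by
  obtain ⟨h1, h2⟩ := T_oddOp hBT hpoly hx
  exact hneg _ h1 h2

include hBm hTm hneg

theorem oddOp_mul {ε : A →ₐ[k] k} (hε : ∀ x, ε (T x) = ε x)
    (hT1 : T 1 = 1) (hfix : ∀ x ∈ B, T x = x → ∃ s : k, x = s • (1 : A)) (hy : y ∈ B) (hTy : T y = -y)
    (hq0 : q ≠ 0) (hq : q ^ 2 ≠ 1) {a b : A} (ha : a ∈ B) (hb : b ∈ B) :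
    oddOp T q (a * b) = ε a • oddOp T q b + ε b • oddOp T q a := by
  have hq1 : 1 - q ≠ 0 := by
    intro h
    apply hq
    rw [← sub_eq_zero.1 h, one_pow]
  let W : A → A := fun x => T (T x) - q • x
  let U : A → A := fun x => T (T x) - x
  have hWB : ∀ {x}, x ∈ B → W x ∈ B := fun hx => B.sub_mem (hBT (hBT hx)) (B.smul_mem _ hx)
  have hUB : ∀ {x}, x ∈ B → U x ∈ B := fun hx => B.sub_mem (hBT (hBT hx)) hx
  have hTW : ∀ {x}, x ∈ B → T (T (W x)) = W x := by
    intro x hx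
    rw [← sub_eq_zero, ← hpoly x hx]
    simp only [W, map_sub, map_smul]
    abel
  have hTU : ∀ {x}, x ∈ B → T (T (U x)) = q • U x := by
    intro x hx
    rw [← sub_eq_zero, ← hpoly x hx]
    simp only [U, map_sub, smul_sub]
    abel
  have hrep : ∀ x, (1 - q) • x = W x - U x := by
    intro x
    simp only [W, U]
    module
  have hUU : U a * U b = 0 := by
    have h1 := hpoly _ (hBm (hUB ha) (hUB hb))
    have h2 : T (T (U a * U b)) = (q * q) • (U a * U b) := by
      rw [hTm, hTm, hTU ha, hTU hb, smul_mul_smul_comm]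
    have h3 : ((q ^ 2 - 1) * (q * (1 - q))) • (U a * U b) = 0 := by
      rw [← neg_eq_zero, ← h1]
      simp only [h2, map_smul, smul_smul]
      module
    exact (smul_eq_zero.1 h3).resolve_left
      (mul_ne_zero (sub_ne_zero.2 hq) (mul_ne_zero hq0 hq1))
  have hWab : (1 - q) • W (a * b) = W a * W b := by
    have h1 : T (T (W a * W b)) = W a * W b := by rw [hTm, hTm, hTW ha, hTW hb]
    have h2 : T (T (W a * U b)) = q • (W a * U b) := by
      rw [hTm, hTm, hTW ha, hTU hb, mul_smul_comm]
    have h3 : T (T (U a * W b)) = q • (U a * W b) := by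
      rw [hTm, hTm, hTU ha, hTW hb, smul_mul_assoc]
    have h4 : ((1 - q) * (1 - q)) • (a * b) = W a * W b - W a * U b - U a * W b := by
      rw [← smul_mul_smul_comm, hrep, hrep, sub_mul, mul_sub (W a) (W b), mul_sub (U a) (W b), hUU, sub_zero]
    have h5 : (1 - q) • ((1 - q) • W (a * b)) = (1 - q) • (W a * W b) := by
      have h6 : (1 - q) • ((1 - q) • W (a * b)) = T (T (((1 - q) * (1 - q)) • (a * b))) -
          q • (((1 - q) * (1 - q)) • (a * b)) := by
        simp only [W, map_smul]
        module
      rw [h6, h4, map_sub, map_sub, map_sub, map_sub, h1, h2, h3]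
      module
    exact smul_right_injective A hq1 h5
  have hWD : ∀ {x}, x ∈ B → (2 : k) • W x = (2 * ((1 - q) * ε x)) • (1 : A) - oddOp T q x := by
    intro x hx
    obtain ⟨s, hs⟩ := hfix (T (W x) + W x) (B.add_mem (hBT (hWB hx)) (hWB hx))
      (by rw [map_add, hTW hx, add_comm])
    have h1 := congrArg ε hs
    have h2 : ε (W x) = (1 - q) * ε x := by
      simp only [W, map_sub, map_smul, hε, smul_eq_mul]
      ring
    rw [map_add, hε, map_smul, map_one, h2, smul_eq_mul, mul_one, ← two_mul] at h1
    rw [h1, ← hs, oddOp_apply]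
    simp only [W]
    module
  have hεy : ε y = 0 := by
    have := hε y
    rw [hTy, map_neg, neg_eq_iff_add_eq_zero, ← two_mul] at this
    exact (mul_eq_zero.1 this).resolve_left two_ne_zero
  have hyy : y * y = 0 := by
    obtain ⟨s, hs⟩ := hfix (y * y) (hBm hy hy) (by rw [hTm, hTy, neg_mul_neg])
    have := congrArg ε hs
    rw [map_mul, hεy, map_smul, map_one, smul_eq_mul, mul_one, zero_mul] at this
    rw [hs, ← this, zero_smul]
  have hDD : oddOp T q a * oddOp T q b = 0 := by
    obtain ⟨s, hs⟩ := oddOp_mem hBT hpoly hneg ha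
    obtain ⟨t, ht⟩ := oddOp_mem hBT hpoly hneg hb
    rw [hs, ht, smul_mul_smul_comm, hyy, smul_zero]
  have h1 : oddOp T q (a * b) = T (W (a * b)) - W (a * b) := rfl
  have h2 : ((2 : k) * 2 * (1 - q)) • W (a * b) =
      (2 * ((1 - q) * ε a) * (2 * ((1 - q) * ε b))) • (1 : A) - (2 * ((1 - q) * ε a)) • oddOp T q b -
        (2 * ((1 - q) * ε b)) • oddOp T q a := by
    rw [mul_smul, hWab, ← smul_mul_smul_comm, hWD ha, hWD hb, sub_mul, mul_sub, mul_sub, hDD]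
    simp only [smul_mul_assoc, mul_smul_comm, one_mul, mul_one]
    module
  have h3 : ((2 : k) * 2 * (1 - q)) • oddOp T q (a * b) =
      ((2 : k) * 2 * (1 - q)) • (ε a • oddOp T q b + ε b • oddOp T q a) := by
    rw [h1, smul_sub, ← map_smul, h2]
    simp only [map_sub, map_smul, hT1, (T_oddOp hBT hpoly ha).2, (T_oddOp hBT hpoly hb).2]
    module
  refine smul_right_injective A (mul_ne_zero (by norm_num) hq1) h3

end Derivation

section LopLinear

variable {k H : Type*} [Field k] [Ring H] [HopfAlgebra k H]

theorem lop_smul (s : k) (a : Dl k H) (x : H) : lop (s • a) x = s • lop a x := by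
  apply eq_of_forall_dl (k := k)
  intro f
  rw [dl_lop, smul_mul_assoc, map_smul, map_smul, dl_lop]
  rfl

theorem lop_sum {ι : Type*} (s : Finset ι) (a : ι → Dl k H) (x : H) :
    lop (∑ i ∈ s, a i) x = ∑ i ∈ s, lop (a i) x := by
  apply eq_of_forall_dl (k := k)
  intro f
  rw [dl_lop, Finset.sum_mul, map_sum, map_sum]
  simp [dl_lop]

theorem lop_mul [FiniteDimensional k H] {β : Dl k H} (hβ : IsGroupLikeElem k β) (x y : H) :
    lop β (x * y) = lop β x * lop β y := by
  rw [← evl_comul, ← evl_comul, ← evl_comul, Bialgebra.comul_mul, ← (ℛ k x).eq, ← (ℛ k y).eq]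
  simp only [Finset.sum_mul_sum, map_sum, Algebra.TensorProduct.tmul_mul_tmul, evl_tmul,
    ((isGroupLikeElem_dual_iff β).1 hβ).2, smul_mul_smul_comm]

theorem lop_groupLike {c : H} (hc : IsGroupLikeElem k c) (a : Dl k H) : lop a c = a c • c := by
  rw [← evl_comul, hc.comul_eq_tmul_self, evl_tmul]

theorem lop_unit (a : Dl k H) : lop a (1 : H) = a 1 • 1 := lop_groupLike .one a

theorem pow_apply_groupLike {c : H} (hc : IsGroupLikeElem k c) (a : Dl k H) (n : ℕ) :
    (a ^ n) c = a c ^ n := by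
  induction n with
  | zero => rw [pow_zero, pow_zero, Dl.one_apply, hc.counit_eq_one]
  | succ n ih => rw [pow_succ, ← dl_rop, ← evr_comul, hc.comul_eq_tmul_self, evr_tmul, map_smul,
      ih, pow_succ, smul_eq_mul, mul_comm]

theorem lop_pow_eq {a : Dl k H} {x : H} (h : lop a x = x) (n : ℕ) : lop (a ^ n) x = x := by
  induction n with
  | zero => rw [pow_zero, lop_one]
  | succ n ih => rw [pow_succ', ← lop_lop, h, ih]

end LopLinear

section Pairing

variable {k H : Type*} [Field k] [IsAlgClosed k] [CharZero k] [Ring H] [HopfAlgebra k H]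
  [FiniteDimensional k H] {p : ℕ} {c : H} {β : Dl k H}

theorem finrank_dl : Module.finrank k (Dl k H) = Module.finrank k H := by
  rw [(dlEquiv k H).finrank_eq, Subspace.dual_finrank_eq]

theorem trace_lop (a : Dl k H) :
    LinearMap.trace k H (lop a) = LinearMap.trace k (Dl k H) (LinearMap.mulLeft k a) :=
  (trace_dl (lop a) (LinearMap.mulLeft k a) fun f x => (dl_lop f a x).symm).symm

theorem pow_ne_one_of_prime {M : Type*} [Monoid M] {x : M} (hp : p.Prime) (hx : x ^ p = 1)
    (hx1 : x ≠ 1) {i : ℕ} (hi : i ≠ 0) (hip : i < p) : x ^ i ≠ 1 := by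
  have := Fact.mk hp
  exact pow_ne_one_of_lt_orderOf hi (by rwa [orderOf_eq_prime hx hx1])

theorem pairing_ne_one (hp : p.Prime) (hodd : Odd p) (hdim : Module.finrank k H = 4 * p)
    (hc : IsGroupLikeElem k c) (hcp : c ^ p = 1) (hc1 : c ≠ 1)
    (hβ : IsGroupLikeElem k β) (hβp : β ^ p = 1) (hβ1 : β ≠ 1) : β c ≠ 1 := by
  intro hβc
  obtain ⟨e, he, -⟩ := exists_average_of_finrank hp hdim hc hcp hc1
  obtain ⟨f, hf, htr, -⟩ := exists_average_of_finrank hp (finrank_dl.trans hdim) hβ hβp hβ1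
  have hp0 : (p : k) ≠ 0 := Nat.cast_ne_zero.2 hp.ne_zero
  have h1 : ∀ x, lop f (c * x) = c * lop f x := by
    intro x
    apply smul_right_injective H hp0
    change (p : k) • _ = (p : k) • _
    rw [← mul_smul_comm, ← lop_smul, ← lop_smul, hf.smul_e, lop_sum, lop_sum, Finset.mul_sum]
    refine Finset.sum_congr rfl fun j _ => ?_
    rw [lop_mul hβ.pow, lop_groupLike hc, pow_apply_groupLike hc, hβc, one_pow, one_smul]
  have h2 : ∀ x, lop f (e * x) = e * lop f x := by
    intro x
    have h3 : ∀ j, lop f (c ^ j * x) = c ^ j * lop f x := by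
      intro j
      induction j with
      | zero => simp
      | succ j ih => rw [pow_succ', mul_assoc, h1, ih, mul_assoc]
    apply smul_right_injective H hp0
    change (p : k) • _ = (p : k) • _
    rw [← smul_mul_assoc, ← map_smul, ← smul_mul_assoc, he.smul_e, Finset.sum_mul, Finset.sum_mul,
      map_sum]
    exact Finset.sum_congr rfl fun j _ => h3 j
  have h3 := finrank_range_of_idem (k := k) (P := LinearMap.mulLeft k e ∘ₗ lop f) (fun x => by
    simp only [LinearMap.comp_apply, LinearMap.mulLeft_apply]
    rw [h2, lop_lop, hf.idem, ← mul_assoc, he.idem])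
  have h4 : (p : k) * LinearMap.trace k H (LinearMap.mulLeft k e ∘ₗ lop f) = 4 := by
    have h5 : (p : k) • (LinearMap.mulLeft k e ∘ₗ lop f) =
        ∑ j ∈ Finset.range p, LinearMap.mulLeft k (c ^ j) ∘ₗ lop f := by
      ext x
      simp only [LinearMap.smul_apply, LinearMap.comp_apply, LinearMap.sum_apply,
        LinearMap.mulLeft_apply]
      rw [← smul_mul_assoc, he.smul_e, Finset.sum_mul]
    rw [← smul_eq_mul, ← map_smul, h5, map_sum, Finset.sum_eq_single 0]
    · rw [pow_zero, LinearMap.mulLeft_one, LinearMap.id_comp, trace_lop, htr]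
    · intro j hj hj0
      exact trace_mulLeft_lop hc.pow
        (pow_ne_one_of_prime hp hcp hc1 hj0 (Finset.mem_range.1 hj)) f
    · intro h
      exact absurd (Finset.mem_range.2 hp.pos) h
  rw [← h3] at h4
  have h5 : p ∣ 2 ^ 2 := ⟨_, (by exact_mod_cast h4.symm : 2 ^ 2 = p * _)⟩
  have h6 := (Nat.prime_dvd_prime_iff_eq hp Nat.prime_two).1 (hp.dvd_of_dvd_pow h5)
  subst h6
  exact absurd hodd (by decide)

end Pairing

section SkewPrimitive

variable {k H : Type*} [Field k] [CharZero k] [Ring H] [HopfAlgebra k H] [FiniteDimensional k H]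

theorem skewPrimitive_eq_zero {p : ℕ} (hodd : Odd p) {γ δ : Dl k H} (hγ : IsGroupLikeElem k γ)
    (hγp : γ ^ p = 1)
    (hδ : ∀ x y, δ (x * y) = γ x * δ y + δ x * counit (R := k) y)
    (hTδ : sq k (Dl k H) δ = -δ) : δ = 0 := by
  have h1 : δ 1 = 0 := by
    have := hδ 1 1
    rw [mul_one, ((isGroupLikeElem_dual_iff γ).1 hγ).1, Bialgebra.counit_one] at this
    linear_combination -this
  have h2 : γ * antipode k δ = -δ := by
    rw [eq_neg_iff_add_eq_zero]
    ext x
    have h3 := congrArg δ (sum_mul_antipode_eq_algebraMap_counit (R := k) (ℛ k x))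
    rw [Algebra.algebraMap_eq_smul_one] at h3
    simp only [map_sum, map_smul, h1, smul_zero, hδ, counit_antipode, Finset.sum_add_distrib] at h3
    have h4 : (γ * antipode k δ + δ) x = (γ * antipode k δ + δ * 1) x := by rw [mul_one]
    rw [h4, map_add, LinearMap.add_apply, Dl.mul_apply_repr (ℛ k x), Dl.mul_apply_repr (ℛ k x)]
    simp only [dual_antipode_apply, Dl.one_apply]
    simpa using h3
  have h3 : γ * sq k (Dl k H) δ = δ * γ := by
    have h4 := congrArg (antipode k) h2
    rw [antipode_mul_antidistrib, map_neg] at h4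
    have h5 := congrArg (fun z => γ * z * γ) h4
    simp only [mul_neg, h2, neg_neg] at h5
    rw [← h5, mul_assoc, mul_assoc, hγ.antipode_mul_cancel, mul_one, sq_apply]
  rw [hTδ, mul_neg] at h3
  have h4 : ∀ n, δ * γ ^ n = (-1 : k) ^ n • (γ ^ n * δ) := by
    intro n
    induction n with
    | zero => simp
    | succ n ih => rw [pow_succ, ← mul_assoc, ih, smul_mul_assoc, mul_assoc, ← h3, pow_succ,
        mul_neg, mul_assoc, mul_smul, neg_one_smul]
  have h5 := h4 p
  rw [hγp, mul_one, one_mul, hodd.neg_one_pow, neg_one_smul, eq_neg_iff_add_eq_zero,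
    ← two_smul k] at h5
  exact (smul_eq_zero.1 h5).resolve_left two_ne_zero

end SkewPrimitive

section Paired

variable {k H : Type*} [Field k] [IsAlgClosed k] [CharZero k] [Ring H] [HopfAlgebra k H]
  [FiniteDimensional k H] {p : ℕ} {c : H} {β : Dl k H}

omit [IsAlgClosed k] [CharZero k] in
theorem groupLike_apply_pow (hβ : IsGroupLikeElem k β) (x : H) (n : ℕ) : β (x ^ n) = β x ^ n := by
  induction n with
  | zero => rw [pow_zero, pow_zero, ((isGroupLikeElem_dual_iff β).1 hβ).1]
  | succ n ih => rw [pow_succ, ((isGroupLikeElem_dual_iff β).1 hβ).2, ih, pow_succ]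

theorem coinvariants_induction (hp : 0 < p) (hω : IsPrimitiveRoot (β c) p)
    (hc : IsGroupLikeElem k c) (hcp : c ^ p = 1) (hβ : IsGroupLikeElem k β) (hβp : β ^ p = 1)
    {S : Submodule k H} (hR : ∀ r, lop β r = r → r ∈ S) (hS : ∀ x ∈ S, c * x ∈ S) (h : H) :
    h ∈ S := by
  have hp0 : (p : k) ≠ 0 := Nat.cast_ne_zero.2 hp.ne'
  have hpow : ∀ n, ∀ x ∈ S, c ^ n * x ∈ S := by
    intro n
    induction n with
    | zero => simp
    | succ n ih =>
      intro x hx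
      rw [pow_succ, mul_assoc]
      exact ih _ (hS x hx)
  have h1 : ∀ i, lop (eigenIdem p (β c ^ i) β) h ∈ S := by
    intro i
    set E := eigenIdem p (β c ^ i) β with hE
    have h2 : E * antipode k β = β c ^ i • E :=
      eigenIdem_mul (by rw [← pow_mul, mul_comm, pow_mul, hω.pow_eq_one, one_pow]) hβp
        hβ.mul_antipode_cancel
    have h3 : β c ^ i • (E * β) = E := by
      rw [← smul_mul_assoc, ← h2, mul_assoc, hβ.antipode_mul_cancel, mul_one]
    have h4 : c ^ i * lop E h ∈ S := by
      apply hR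
      rw [lop_mul hβ, lop_groupLike hc.pow, lop_lop, smul_mul_assoc, ← mul_smul_comm,
        ← lop_smul]
      rw [groupLike_apply_pow hβ, h3]
    have h5 := hpow (i * (p - 1)) _ h4
    rwa [← mul_assoc, ← pow_add, ← Nat.mul_succ, Nat.succ_eq_add_one, Nat.sub_add_cancel hp, mul_comm,
      pow_mul, hcp, one_pow, one_mul] at h5
  have h2 : (p : k) • h = ∑ i ∈ Finset.range p, lop (eigenIdem p (β c ^ i) β) h := by
    have h3 := sum_eigenIdem k hω hp β
    rw [← lop_sum]
    unfold eigenIdem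
    rw [h3, lop_smul, lop_one]
  rw [← inv_smul_smul₀ hp0 h, h2]
  exact S.smul_mem _ (S.sum_mem fun i _ => h1 i)

end Paired

section Retraction

variable {k H : Type*} [Field k] [IsAlgClosed k] [CharZero k] [Ring H] [HopfAlgebra k H]
  [FiniteDimensional k H] {p : ℕ} {c e : H} {β f : Dl k H}

theorem lop_fixed_of_average (hf : CyclicAverage k p β f) (x : H) : lop β (lop f x) = lop f x := by
  rw [lop_lop, hf.e_mul]

theorem lop_average_eq_iff (hp : 0 < p) (hf : CyclicAverage k p β f) {x : H} :
    lop f x = x ↔ lop β x = x := by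
  have hp0 : (p : k) ≠ 0 := Nat.cast_ne_zero.2 hp.ne'
  refine ⟨fun h => by rw [← h, lop_fixed_of_average hf], fun h => ?_⟩
  apply smul_right_injective H hp0
  change (p : k) • _ = (p : k) • _
  rw [← lop_smul, hf.smul_e, lop_sum, Finset.sum_congr rfl fun j _ => lop_pow_eq h j,
    Finset.sum_const, Finset.card_range, Nat.cast_smul_eq_nsmul]

theorem lop_average_mul (hp : 0 < p) (hβ : IsGroupLikeElem k β) (hf : CyclicAverage k p β f)
    {r : H} (hr : lop β r = r) (x : H) : lop f (r * x) = r * lop f x := by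
  have hp0 : (p : k) ≠ 0 := Nat.cast_ne_zero.2 hp.ne'
  apply smul_right_injective H hp0
  change (p : k) • _ = (p : k) • _
  rw [← mul_smul_comm, ← lop_smul, ← lop_smul, hf.smul_e, lop_sum, lop_sum, Finset.mul_sum]
  refine Finset.sum_congr rfl fun j _ => ?_
  rw [lop_mul hβ.pow, lop_pow_eq hr]

theorem lop_average_conj (hp : 0 < p) (hβ : IsGroupLikeElem k β) (hf : CyclicAverage k p β f)
    (hc : IsGroupLikeElem k c) (x : H) :
    lop f (c * x * antipode k c) = c * lop f x * antipode k c := by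
  have hp0 : (p : k) ≠ 0 := Nat.cast_ne_zero.2 hp.ne'
  apply smul_right_injective H hp0
  change (p : k) • _ = (p : k) • _
  rw [← smul_mul_assoc, ← mul_smul_comm, ← lop_smul, ← lop_smul, hf.smul_e, lop_sum, lop_sum,
    Finset.mul_sum, Finset.sum_mul]
  refine Finset.sum_congr rfl fun j _ => ?_
  have h : (β ^ j) c * (β ^ j) (antipode k c) = 1 := by
    rw [← ((isGroupLikeElem_dual_iff (β ^ j)).1 hβ.pow).2, hc.mul_antipode_cancel,
      ((isGroupLikeElem_dual_iff (β ^ j)).1 hβ.pow).1]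
  rw [lop_mul hβ.pow, lop_mul hβ.pow, lop_groupLike hc, lop_groupLike hc.antipode,
    mul_smul_comm, smul_mul_assoc, smul_mul_assoc, smul_smul, mul_comm, h, one_smul]

theorem mul_apply_groupLike (hc : IsGroupLikeElem k c) (a b : Dl k H) : (a * b) c = a c * b c := by
  rw [← dl_rop, ← evr_comul, hc.comul_eq_tmul_self, evr_tmul, map_smul, smul_eq_mul, mul_comm]

theorem lop_average_average (hp : 0 < p) (hω : IsPrimitiveRoot (β c) p)
    (hc : IsGroupLikeElem k c) (hβ : IsGroupLikeElem k β) (he : CyclicAverage k p c e)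
    (hf : CyclicAverage k p β f) : (p : k) • lop f e = 1 := by
  rw [← map_smul, he.smul_e, map_sum, Finset.sum_eq_single 0]
  · rw [pow_zero, lop_unit, ← dual_counit, hf.counit_e, one_smul]
  · intro j hj hj0
    have h1 := mul_apply_groupLike (hc.pow (n := j)) β f
    rw [hf.mul_e, groupLike_apply_pow hβ] at h1
    have h2 : β c ^ j ≠ 1 := hω.pow_ne_one_of_pos_of_lt hj0 (Finset.mem_range.1 hj)
    have h3 : f (c ^ j) = 0 := by
      by_contra h0
      exact h2 (mul_right_cancel₀ h0 (by rw [← h1, one_mul]))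
    rw [lop_groupLike hc.pow, h3, zero_smul]
  · intro h
    exact absurd (Finset.mem_range.2 hp) h

/-- The retraction of `H` onto the coinvariants of `β` attached to averages `e` and `f`. -/
noncomputable def retraction (p : ℕ) (e : H) (f : Dl k H) : H →ₗ[k] H :=
  (p : k) • (lop f ∘ₗ LinearMap.mulRight k e)

theorem retraction_apply (h : H) : retraction p e f h = (p : k) • lop f (h * e) := rfl

theorem lop_retraction (hf : CyclicAverage k p β f) (h : H) :
    lop β (retraction p e f h) = retraction p e f h := by
  rw [retraction_apply, map_smul, lop_fixed_of_average hf]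

theorem retraction_mul (hp : 0 < p) (hβ : IsGroupLikeElem k β) (hf : CyclicAverage k p β f)
    {r : H} (hr : lop β r = r) (h : H) :
    retraction p e f (r * h) = r * retraction p e f h := by
  rw [retraction_apply, retraction_apply, mul_assoc, lop_average_mul hp hβ hf hr, mul_smul_comm]

theorem retraction_eq (hp : 0 < p) (hω : IsPrimitiveRoot (β c) p)
    (hc : IsGroupLikeElem k c) (hβ : IsGroupLikeElem k β) (he : CyclicAverage k p c e)
    (hf : CyclicAverage k p β f) {r : H} (hr : lop β r = r) : retraction p e f r = r := by
  rw [← mul_one r, retraction_mul hp hβ hf hr, retraction_apply, one_mul,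
    lop_average_average hp hω hc hβ he hf]

theorem retraction_groupLike_mul (hp : 0 < p) (hc : IsGroupLikeElem k c)
    (hβ : IsGroupLikeElem k β) (he : CyclicAverage k p c e) (hf : CyclicAverage k p β f) (h : H) :
    retraction p e f (c * h) = c * retraction p e f h * antipode k c := by
  have h1 : e * antipode k c = e := by
    nth_rw 1 [← he.e_mul]
    rw [mul_assoc, hc.mul_antipode_cancel, mul_one]
  rw [retraction_apply, retraction_apply, mul_smul_comm, smul_mul_assoc,
    ← lop_average_conj hp hβ hf hc, mul_assoc, mul_assoc, mul_assoc, h1]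

theorem retraction_sq (he : CyclicAverage k p c e) (hf : CyclicAverage k p β f) (h : H) :
    retraction p e f (sq k H h) = sq k H (retraction p e f h) := by
  rw [retraction_apply, retraction_apply, map_smul]
  nth_rw 1 [← he.sq_e]
  rw [← sq_mul, lop_sq, hf.sq_e]

theorem counit_retraction (hp : 0 < p) (hω : IsPrimitiveRoot (β c) p)
    (hc : IsGroupLikeElem k c) (hcp : c ^ p = 1) (hβ : IsGroupLikeElem k β) (hβp : β ^ p = 1)
    (he : CyclicAverage k p c e) (hf : CyclicAverage k p β f) (h : H) :
    counit (R := k) (retraction p e f h) = counit (R := k) h := by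
  refine coinvariants_induction hp hω hc hcp hβ hβp
    (S := LinearMap.eqLocus (counit (R := k) ∘ₗ retraction p e f) counit) ?_ ?_ h
  · intro r hr
    exact congrArg _ (retraction_eq hp hω hc hβ he hf hr)
  · intro x hx
    have hx' : counit (R := k) (retraction p e f x) = counit (R := k) x := hx
    change counit (R := k) (retraction p e f (c * x)) = counit (R := k) (c * x)
    rw [retraction_groupLike_mul hp hc hβ he hf, Bialgebra.counit_mul, Bialgebra.counit_mul,
      Bialgebra.counit_mul, hx', counit_antipode, hc.counit_eq_one, mul_one]

end Retraction

section Paired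

variable {k H : Type*} [Field k] [IsAlgClosed k] [CharZero k] [Ring H] [HopfAlgebra k H]
  [FiniteDimensional k H] {p : ℕ} {c : H} {β : Dl k H}

theorem exists_functional_eq_one {V : Type*} [AddCommGroup V] [Module k V] {y : V} (hy : y ≠ 0) :
    ∃ g : V →ₗ[k] k, g y = 1 := by
  obtain ⟨g, hg⟩ := Module.Projective.exists_dual_ne_zero k hy
  exact ⟨(g y)⁻¹ • g, by simp [hg]⟩

/-- The skew-primitive functional attached to an odd operator on the coinvariants must vanish. -/
theorem oddOp_retraction_eq_zero (hp : p.Prime) (hodd : Odd p) {e : H} {f : Dl k H}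
    (hω : IsPrimitiveRoot (β c) p) (hc : IsGroupLikeElem k c) (hcp : c ^ p = 1)
    (hβ : IsGroupLikeElem k β) (hβp : β ^ p = 1) (he : CyclicAverage k p c e)
    (hf : CyclicAverage k p β f) {q : k} (hq0 : q ≠ 0) (hq : q ^ 2 ≠ 1) {y : H} (hy0 : y ≠ 0)
    (hy : lop β y = y) (hTy : sq k H y = -y)
    (hpoly : ∀ x, lop β x = x → sq k H (sq k H (sq k H (sq k H x))) - q • sq k H (sq k H x) -
      sq k H (sq k H x) + q • x = 0)
    (hfix : ∀ x, lop β x = x → sq k H x = x → ∃ s : k, x = s • (1 : H))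
    (hneg : ∀ z, lop β z = z → sq k H z = -z → ∃ s : k, z = s • y) (h : H) :
    oddOp (sq k H) q (retraction p e f h) = 0 := by
  set B : Submodule k H := LinearMap.eqLocus (lop β) LinearMap.id with hB
  have hBm : ∀ {a b}, a ∈ B → b ∈ B → a * b ∈ B := by
    intro a b ha hb
    change lop β (a * b) = a * b
    rw [lop_mul hβ, show lop β a = a from ha, show lop β b = b from hb]
  have hBT : ∀ {a}, a ∈ B → sq k H a ∈ B := by
    intro a ha
    change lop β (sq k H a) = sq k H a
    rw [lop_sq, sq_groupLike hβ, show lop β a = a from ha]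
  have hρB : ∀ x, retraction p e f x ∈ B := lop_retraction hf
  have hρε := counit_retraction hp.pos hω hc hcp hβ hβp he hf
  have hρc := retraction_groupLike_mul hp.pos hc hβ he hf
  obtain ⟨g, hg⟩ := exists_functional_eq_one (k := k) hy0
  set δ : Dl k H := (dlEquiv k H).symm (g ∘ₗ oddOp (sq k H) q ∘ₗ retraction p e f) with hδ
  have hδa : ∀ x, δ x = g (oddOp (sq k H) q (retraction p e f x)) := fun x => rfl
  have hDδ : ∀ x, oddOp (sq k H) q (retraction p e f x) = δ x • y := by
    intro x
    obtain ⟨s, hs⟩ := oddOp_mem hBT hpoly hneg (hρB x)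
    rw [hδa, hs, map_smul, hg, smul_eq_mul, mul_one]
  have hcyB : ∀ z, lop β z = z → lop β (c * z * antipode k c) = c * z * antipode k c := by
    intro z hz
    rw [← (lop_average_eq_iff hp.pos hf), lop_average_conj hp.pos hβ hf hc,
      (lop_average_eq_iff hp.pos hf).2 hz]
  have hcT : ∀ z, sq k H (c * z * antipode k c) = c * sq k H z * antipode k c := by
    intro z
    rw [sq_mul, sq_mul, sq_groupLike hc, sq_groupLike hc.antipode]
  have hcD : ∀ z, oddOp (sq k H) q (c * z * antipode k c) =
      c * oddOp (sq k H) q z * antipode k c := by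
    intro z
    simp only [oddOp_apply, hcT, map_sub, map_smul, mul_sub, sub_mul, mul_smul_comm, smul_mul_assoc]
  obtain ⟨χ, hχ⟩ := hneg (c * y * antipode k c) (hcyB y hy) (by
    rw [hcT, hTy, mul_neg, neg_mul])
  have hχp : χ ^ p = 1 := by
    have h1 : ∀ n, c ^ n * y * antipode k c ^ n = χ ^ n • y := by
      intro n
      induction n with
      | zero => simp
      | succ n ih =>
        rw [pow_succ' c, pow_succ (antipode k c), mul_assoc c, mul_assoc c, ← mul_assoc (c ^ n * y),
          ih, smul_mul_assoc, mul_smul_comm, ← mul_assoc, hχ, smul_smul, pow_succ]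
    have h2 := h1 p
    rw [hcp, one_mul, ← antipode_pow_groupLike hc, hcp, antipode_one, mul_one] at h2
    exact (smul_left_injective k hy0 (by simpa using h2)).symm
  have : NeZero p := ⟨hp.ne_zero⟩
  obtain ⟨s, -, hs⟩ := hω.eq_pow_of_pow_eq_one hχp
  set γ : Dl k H := β ^ s with hγ
  have hγg : IsGroupLikeElem k γ := hβ.pow
  have hγc : γ c = χ := by rw [hγ, pow_apply_groupLike hc, hs]
  have hγB : ∀ r, lop β r = r → γ r = counit (R := k) r := by
    intro r hr
    rw [← counit_lop, hγ, lop_pow_eq hr]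
  have hδc : ∀ x, δ (c * x) = χ * δ x := by
    intro x
    rw [hδa, hρc, hcD, hDδ, mul_smul_comm, smul_mul_assoc, hχ, map_smul, map_smul, hg]
    simp [mul_comm]
  have hδmul : ∀ x x', δ (x * x') = γ x * δ x' + δ x * counit (R := k) x' := by
    intro x x'
    refine coinvariants_induction hp.pos hω hc hcp hβ hβp
      (S := LinearMap.eqLocus ((dlEquiv k H δ : H →ₗ[k] k) ∘ₗ LinearMap.mulRight k x')
        (δ x' • (dlEquiv k H γ : H →ₗ[k] k) + counit (R := k) x' • (dlEquiv k H δ : H →ₗ[k] k)))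
      ?_ ?_ x |>.trans ?_
    · intro r hr
      change δ (r * x') = δ x' * γ r + counit (R := k) x' * δ r
      rw [hδa (r * x'), retraction_mul hp.pos hβ hf hr,
        oddOp_mul hBm sq_mul hBT hpoly hneg (ε := Bialgebra.counitAlgHom k H)
          (fun z => counit_sq z) sq_one hfix hy hTy hq0 hq hr (hρB x'), hDδ, map_add, map_smul,
        map_smul, map_smul, hg, hγB r hr]
      have h1 := hδa r
      rw [retraction_eq hp.pos hω hc hβ he hf hr] at h1
      rw [← h1]
      change counit (R := k) r * (δ x' * 1) + counit (R := k) (retraction p e f x') * δ r = _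
      rw [hρε]
      ring
    · intro z hz
      have hz' : δ (z * x') = δ x' * γ z + counit (R := k) x' * δ z := hz
      change δ (c * z * x') = δ x' * γ (c * z) + counit (R := k) x' * δ (c * z)
      rw [mul_assoc, hδc, hδc, hz', ((isGroupLikeElem_dual_iff γ).1 hγg).2, hγc]
      ring
    · change δ x' * γ x + counit (R := k) x' * δ x = _
      ring
  have hTδ : sq k (Dl k H) δ = -δ := by
    ext x
    change δ (sq k H x) = -δ x
    rw [hδa, retraction_sq he hf]
    have h1 : oddOp (sq k H) q (sq k H (retraction p e f x)) =
        sq k H (oddOp (sq k H) q (retraction p e f x)) := by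
      simp only [oddOp_apply, map_sub, map_smul]
    rw [h1, (T_oddOp hBT hpoly (hρB x)).2, map_neg, hδa]
  have hγp : γ ^ p = 1 := by rw [hγ, ← pow_mul, mul_comm, pow_mul, hβp, one_pow]
  rw [hDδ, skewPrimitive_eq_zero hodd hγg hγp hδmul hTδ]
  exact zero_smul k y

theorem sq_pow_eight_of_pair (hp : p.Prime) (hodd : Odd p) (hdim : Module.finrank k H = 4 * p)
    (hc : IsGroupLikeElem k c) (hcp : c ^ p = 1) (hc1 : c ≠ 1)
    (hβ : IsGroupLikeElem k β) (hβp : β ^ p = 1) (hβ1 : β ≠ 1) (hTV : TraceVanish k (Dl k H))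
    {N : ℕ} (hN : 0 < N) (hT : sq k H ^ N = 1) (h : H) : (sq k H ^ 8) h = h := by
  have hω : IsPrimitiveRoot (β c) p := by
    have := Fact.mk hp
    rw [← orderOf_eq_prime (p := p) (x := β c) (by
      rw [← groupLike_apply_pow hβ, hcp, ((isGroupLikeElem_dual_iff β).1 hβ).1])
      (pairing_ne_one hp hodd hdim hc hcp hc1 hβ hβp hβ1)]
    exact IsPrimitiveRoot.orderOf _
  obtain ⟨e, he, -⟩ := exists_average_of_finrank hp hdim hc hcp hc1
  obtain ⟨f, hf, htr, hrk, htT⟩ :=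
    exists_average_of_finrank hp (finrank_dl.trans hdim) hβ hβp hβ1
  have hiff := fun {x} => lop_average_eq_iff hp.pos hf (x := x)
  have hP : ∀ x : H, lop f (lop f x) = lop f x := fun x => by rw [lop_lop, hf.idem]
  have hrk' : Module.finrank k (LinearMap.range (lop f)) = 4 := by
    have h1 := finrank_range_of_idem (k := k) (P := lop f) hP
    rw [trace_lop, htr] at h1
    exact_mod_cast h1
  have htr' : LinearMap.trace k H (lop f ∘ₗ sq k H) = 0 := by
    rw [← htT hTV, LinearMap.trace_comp_comm']
    symm
    apply trace_dl
    intro a x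
    change (f * sq k (Dl k H) a) x = a (sq k H (lop f x))
    rw [← dl_lop, dual_sq_apply]
  obtain ⟨q, hq0, ⟨y, hy0, hy, hTy⟩, hpoly, hfix, hneg, hq1⟩ := four_dim_of_idem hP
    (T := sq k H) (fun x => by rw [lop_sq, hf.sq_e]) hrk' htr' hN hT (v := 1)
    (one_ne_zero_of_hopf k H) (by rw [lop_unit, ← dual_counit, hf.counit_e, one_smul]) sq_one
  by_cases hq : q ^ 2 = 1
  · refine coinvariants_induction hp.pos hω hc hcp hβ hβp
      (S := LinearMap.eqLocus (sq k H ^ 8) LinearMap.id) ?_ ?_ h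
    · intro r hr
      have hr' := hiff.2 hr
      change (sq k H ^ 8) r = r
      simp only [pow_succ, pow_zero, one_mul, Module.End.mul_apply]
      have h4 : sq k H (sq k H (sq k H (sq k H r))) = r := by
        rcases _root_.sq_eq_one_iff.1 hq with h1 | h1
        · have h2 := (hq1 h1).1 r hr'
          rw [h2, h2]
        · have h2 := hpoly r hr'
          rw [h1, neg_smul, neg_smul, one_smul, one_smul, sub_neg_eq_add, add_sub_cancel_right,
            ← sub_eq_add_neg, sub_eq_zero] at h2
          exact h2
      rw [h4, h4]
    · intro x hx
      have hx' : (sq k H ^ 8) x = x := hx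
      change (sq k H ^ 8) (c * x) = c * x
      simp only [pow_succ, pow_zero, one_mul, Module.End.mul_apply, sq_mul, sq_groupLike hc] at hx' ⊢
      rw [hx']
  · exfalso
    have hqq : q ≠ 1 := fun h1 => hq (by rw [h1, one_pow])
    have hy' := hiff.1 hy
    have h1 := oddOp_retraction_eq_zero hp hodd hω hc hcp hβ hβp he hf hq0 hq hy0 hy' hTy
      (fun x hx => hpoly x (hiff.2 hx)) (fun x hx => hfix hqq x (hiff.2 hx))
      (fun z hz hTz => hneg hqq y z hy (hiff.2 hz) hy0 hTy hTz) y
    rw [retraction_eq hp.pos hω hc hβ he hf hy', oddOp_apply] at h1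
    simp only [map_sub, map_smul, hTy, map_neg] at h1
    have h2 : (-2 * (1 - q)) • y = 0 := by
      rw [← h1]
      module
    have h3 := (smul_eq_zero.1 h2).resolve_right hy0
    have h4 : (1 : k) - q = 0 := by simpa using h3
    exact hqq (sub_eq_zero.1 h4).symm

end Paired

section Powers

variable {k H : Type*} [Field k] [Ring H] [HopfAlgebra k H] [FiniteDimensional k H]

theorem dual_sq_pow_apply (a : Dl k H) (n : ℕ) (x : H) :
    (sq k (Dl k H) ^ n) a x = a ((sq k H ^ n) x) := by
  induction n generalizing x with
  | zero => rfl
  | succ n ih =>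
    rw [pow_succ', Module.End.mul_apply, dual_sq_apply, ih, pow_succ, Module.End.mul_apply]

theorem pow_finrank_groupLike [IsAlgClosed k] [CharZero k] {c : H} (hc : IsGroupLikeElem k c) :
    c ^ Module.finrank k H = 1 := by
  have h1 : orderOf (⟨c, hc⟩ : GroupLike k H) ∣ Module.finrank k H := by
    rw [← Nat.card_zpowers]
    exact card_dvd_finrank _
  simpa using congrArg GroupLike.val (orderOf_dvd_iff_pow_eq_one.1 h1)

theorem sq_pow_lop {α : Dl k H} (hα : IsGroupLikeElem k α) (n : ℕ) (x : H) :
    (sq k H ^ n) (lop α x) = lop α ((sq k H ^ n) x) := by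
  induction n with
  | zero => rfl
  | succ n ih =>
    rw [pow_succ', Module.End.mul_apply, Module.End.mul_apply, ih, lop_sq, sq_groupLike hα]

theorem sq_pow_rop {α : Dl k H} (hα : IsGroupLikeElem k α) (n : ℕ) (x : H) :
    (sq k H ^ n) (rop α x) = rop α ((sq k H ^ n) x) := by
  induction n with
  | zero => rfl
  | succ n ih =>
    rw [pow_succ', Module.End.mul_apply, Module.End.mul_apply, ih, rop_sq, sq_groupLike hα]

theorem Integrals.radford_pow [IsAlgClosed k] [CharZero k] (I : Integrals k H) (n : ℕ) (h : H) :
    I.g ^ n * (sq k H ^ (2 * n)) (rop (antipode k I.α ^ n) (lop (I.α ^ n) h)) = h * I.g ^ n := by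
  induction n with
  | zero => simp [rop_one, lop_one]
  | succ n ih =>
    have h1 := I.radford
      ((sq k H ^ (2 * n)) (rop (antipode k I.α ^ n) (lop (I.α ^ n) h)))
    have h2 : ∀ m x, sq k H ((sq k H ^ m) x) = (sq k H ^ (m + 1)) x := fun m x => by
      rw [pow_succ', Module.End.mul_apply]
    rw [← sq_pow_lop I.α_groupLike, h2, ← sq_pow_rop I.α_groupLike.antipode, h2,
      lop_rop, rop_rop, lop_lop, ← pow_succ', ← pow_succ] at h1
    rw [Nat.mul_succ, pow_succ I.g, mul_assoc, h1, ← mul_assoc, ih, mul_assoc]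

end Powers

section Order

variable {k H : Type*} [Field k] [IsAlgClosed k] [CharZero k] [Ring H] [HopfAlgebra k H]
  [FiniteDimensional k H] {p : ℕ}

theorem sq_pow_eq_one_of_integrals (I : Integrals k H) {n : ℕ} (hg : I.g ^ n = 1)
    (hα : I.α ^ n = 1) : sq k H ^ (2 * n) = (1 : Module.End k H) := by
  ext h
  have h1 := I.radford_pow n h
  rw [← antipode_pow_groupLike I.α_groupLike, hα, hg, antipode_one, one_mul, mul_one, lop_one,
    rop_one] at h1
  exact h1

theorem sq_pow_eight (hp : p.Prime) (hodd : Odd p) (hdim : Module.finrank k H = 4 * p)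
    (hns : ¬ IsSemisimpleRing H) : sq k H ^ 8 = (1 : Module.End k H) := by
  obtain ⟨I⟩ := exists_integrals k H
  have hdim' := (finrank_dl (k := k) (H := H)).trans hdim
  have hg := I.g_groupLike
  have hα := I.α_groupLike
  have hgp : (I.g ^ 4) ^ p = 1 := by
    rw [← pow_mul, ← hdim, pow_finrank_groupLike hg]
  have hαp : (I.α ^ 4) ^ p = 1 := by
    rw [← pow_mul, ← hdim', pow_finrank_groupLike hα]
  have hN : 0 < 2 * (4 * p) := by have := hp.pos; omega
  have hT : sq k H ^ (2 * (4 * p)) = (1 : Module.End k H) :=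
    sq_pow_eq_one_of_integrals I (by rw [pow_mul, hgp]) (by rw [pow_mul, hαp])
  have hR := I.radford_pow 4
  rw [← antipode_pow_groupLike hα] at hR
  ext h
  change (sq k H ^ 8) h = h
  by_cases hα1 : I.α ^ 4 = 1
  · have h8 : ∀ x, (sq k H ^ 8) x * antipode k (I.g ^ 4) = antipode k (I.g ^ 4) * x := by
      intro x
      have h1 := hR x
      rw [hα1, antipode_one, lop_one, rop_one] at h1
      have h2 := congrArg (fun z => antipode k (I.g ^ 4) * z * antipode k (I.g ^ 4)) h1
      simpa only [← mul_assoc, hg.pow.antipode_mul_cancel, one_mul, mul_assoc _ (I.g ^ 4),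
        hg.pow.mul_antipode_cancel, mul_one] using h2
    have h1 := groupLike_central hp hdim (hg.pow (n := 4)).antipode
      (by rw [← antipode_pow_groupLike hg.pow, hgp, antipode_one]) (traceVanish k H hns) h8 hN hT h
    have h2 := congrArg (· * I.g ^ 4) ((h8 h).trans h1)
    simpa only [mul_assoc, hg.pow.antipode_mul_cancel, mul_one] using h2
  by_cases hg1 : I.g ^ 4 = 1
  · have h8 : ∀ φ : Dl k H, (sq k (Dl k H) ^ 8) φ * antipode k (I.α ^ 4) =
        antipode k (I.α ^ 4) * φ := by
      intro φ
      have h1 : I.α ^ 4 * ((sq k (Dl k H) ^ 8) φ * antipode k (I.α ^ 4)) = φ := by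
        ext x
        have h2 := hR x
        rw [hg1, one_mul, mul_one] at h2
        rw [← dl_lop, ← dl_rop, dual_sq_pow_apply, h2]
      nth_rw 2 [← h1]
      rw [← mul_assoc, hα.pow.antipode_mul_cancel, one_mul]
    have hT' : sq k (Dl k H) ^ (2 * (4 * p)) = (1 : Module.End k (Dl k H)) := by
      ext φ x
      change (sq k (Dl k H) ^ (2 * (4 * p))) φ x = φ x
      rw [dual_sq_pow_apply, hT]
      rfl
    apply eq_of_forall_dl (k := k)
    intro φ
    have h1 := groupLike_central hp hdim' (hα.pow (n := 4)).antipode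
      (by rw [← antipode_pow_groupLike hα.pow, hαp, antipode_one]) (traceVanish_dual k H hns)
      h8 hN hT' φ
    have h2 := congrArg (· * I.α ^ 4) ((h8 φ).trans h1)
    simp only [mul_assoc, hα.pow.antipode_mul_cancel, mul_one] at h2
    rw [← dual_sq_pow_apply, h2]
  exact sq_pow_eight_of_pair hp hodd hdim hg.pow hgp hg1 hα.pow hαp hα1
    (traceVanish_dual k H hns) hN hT h

theorem not_four_dvd_card (hodd : Odd p) (hdim : Module.finrank k H = 4 * p)
    (hTV : TraceVanish k H) (h8 : sq k H ^ 8 = (1 : Module.End k H))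
    (K : Subgroup (GroupLike k H)) : ¬ 4 ∣ Nat.card K := by
  rintro ⟨m, hm⟩
  have h1 := card_mul_finrank_range_avg K
  rw [hm, hdim, mul_assoc] at h1
  have h2 : Odd (Module.finrank k (LinearMap.range (LinearMap.mulLeft k (avg K)))) :=
    (Nat.odd_mul.1 (by rwa [Nat.eq_of_mul_eq_mul_left (by norm_num) h1])).2
  have hP : ∀ x, LinearMap.mulLeft k (avg K) (LinearMap.mulLeft k (avg K) x) =
      LinearMap.mulLeft k (avg K) x := fun x => by simp [← mul_assoc, avg_idem]
  refine trace_ne_zero_of_odd_finrank (m := 2) (restrict_pow_eq_one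
    (mapsTo_range_of_comm (T := sq k H) (avg_mul_sq K)) fun x _ => ?_) h2 ?_
  · change (sq k H ^ 8) x = x
    rw [h8]
    rfl
  · rw [trace_restrict_of_idem hP (avg_mul_sq K), trace_mulLeft_avg_sq K hTV]

theorem dvd_two_mul_of_dvd_four_mul {d p : ℕ} (hd : d ∣ 4 * p) (h4 : ¬ 4 ∣ d) :
    d ∣ 2 * p := by
  rcases Nat.even_or_odd d with h | h
  · obtain ⟨m, rfl⟩ := h.two_dvd
    have hm : Odd m := by
      rw [← Nat.not_even_iff_odd]
      intro hm
      obtain ⟨j, rfl⟩ := hm.two_dvd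
      exact h4 ⟨j, by ring⟩
    rw [show 4 * p = 2 * (2 * p) by ring] at hd
    exact Nat.mul_dvd_mul_left 2 (((Nat.coprime_two_right.2 hm).dvd_of_dvd_mul_left
      (Nat.dvd_of_mul_dvd_mul_left two_pos hd)))
  · exact Dvd.dvd.mul_left (((Nat.coprime_two_right.2 h).pow_right 2).dvd_of_dvd_mul_left hd) 2

theorem groupLike_pow_two_mul (hodd : Odd p) (hdim : Module.finrank k H = 4 * p)
    (hTV : TraceVanish k H) (h8 : sq k H ^ 8 = (1 : Module.End k H)) {c : H}
    (hc : IsGroupLikeElem k c) : c ^ (2 * p) = 1 := by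
  have h1 : orderOf (⟨c, hc⟩ : GroupLike k H) ∣ 2 * p := by
    rw [← Nat.card_zpowers]
    exact dvd_two_mul_of_dvd_four_mul (hdim ▸ card_dvd_finrank _)
      (not_four_dvd_card hodd hdim hTV h8 _)
  simpa using congrArg GroupLike.val (orderOf_dvd_iff_pow_eq_one.1 h1)

theorem sq_pow_four (hp : p.Prime) (hodd : Odd p) (hdim : Module.finrank k H = 4 * p)
    (hns : ¬ IsSemisimpleRing H) : sq k H ^ 4 = (1 : Module.End k H) := by
  have h8 := sq_pow_eight hp hodd hdim hns
  have h8' : sq k (Dl k H) ^ 8 = (1 : Module.End k (Dl k H)) := by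
    ext φ x
    change (sq k (Dl k H) ^ 8) φ x = φ x
    rw [dual_sq_pow_apply, h8]
    rfl
  obtain ⟨I⟩ := exists_integrals k H
  have h1 := sq_pow_eq_one_of_integrals I
    (groupLike_pow_two_mul hodd hdim (traceVanish k H hns) h8 I.g_groupLike)
    (groupLike_pow_two_mul hodd (finrank_dl.trans hdim) (traceVanish_dual k H hns) h8'
      I.α_groupLike)
  have h2 : Nat.gcd (4 * p) (4 * 2) = 4 := by
    rw [Nat.gcd_mul_left, Nat.coprime_two_right.2 hodd]
  rw [← h2]
  exact pow_gcd_eq_one.2 ⟨by rw [← h1]; congr 1; ring, h8⟩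

end Order

section Translation

variable {k H : Type} [Field k] [Ring H] [HopfAlgebra k H]

theorem isGroupLikeOf_iff (a : H) :
    IsGroupLikeOf (comul (R := k) (A := H)) a ↔ IsGroupLikeElem k a := by
  constructor
  · rintro ⟨h0, h⟩
    refine ⟨?_, h⟩
    have h1 := rTensor_counit_comul (R := k) a
    rw [h, LinearMap.rTensor_tmul] at h1
    have h2 := congrArg (TensorProduct.lid k H) h1
    rw [TensorProduct.lid_tmul, TensorProduct.lid_tmul] at h2
    exact smul_left_injective k h0 h2
  · intro h
    have : Nontrivial H := ⟨_, _, one_ne_zero_of_hopf k H⟩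
    exact ⟨h.ne_zero, h.comul_eq_tmul_self⟩

theorem card_isGroupLikeOf :
    Nat.card {a : H // IsGroupLikeOf (comul (R := k) (A := H)) a} = Nat.card (GroupLike k H) :=
  Nat.card_congr ((Equiv.subtypeEquivRight isGroupLikeOf_iff).trans GroupLike.valEquiv.symm)

end Translation

end HopfFourP

open HopfFourP in
/-- for a non-semisimple Hopf algebra `H` of dimension `4p` (`p` an odd prime)
over an algebraically closed field of characteristic zero, `4` does not divide the order of
the group of group-like elements of `H`, and the antipode satisfies `S ^ 8 = id`. -/
theorem nonsemisimple_dim_4p_card_groupLike_and_antipode_pow_eight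
    (k : Type) [Field k] [IsAlgClosed k] [CharZero k]
    (p : ℕ) (hp : p.Prime) (hodd : Odd p)
    (H : Type) [Ring H] [HopfAlgebra k H]
    (hdim : Module.finrank k H = 4 * p)
    (hns : ¬ IsSemisimpleRing H) :
    ¬ (4 ∣ Nat.card {a : H // IsGroupLikeOf (Coalgebra.comul (R := k) (A := H)) a}) ∧
      ((HopfAlgebra.antipode (R := k) (A := H) : Module.End k H) ^ 8) = LinearMap.id := by
  have : FiniteDimensional k H := Module.finite_of_finrank_pos (by have := hp.pos; omega)
  constructor
  · rw [card_isGroupLikeOf, ← Subgroup.card_top]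
    exact not_four_dvd_card hodd hdim (traceVanish k H hns) (sq_pow_eight hp hodd hdim hns) ⊤
  · have h : (HopfAlgebra.antipode k : Module.End k H) ^ 2 = sq k H := pow_two _
    rw [show 8 = 2 * 4 by norm_num, pow_mul, h]
    exact sq_pow_four hp hodd hdim hns
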